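/- Let K be a congruence function field over 𝔽₂ with genus g_K = 4 and class number h_K = 1, and let k = 𝔽₂(T) be its unique rational subfield with [K : k] = 5. Then the order of the automorphism group Aut_{𝔽₂}(K) divides 30, and the extension K/k is normal if and only if Aut_{𝔽₂}(K) ≠ {Id}. -/

import Mathlib

set_option synthInstance.maxHeartbeats 1000000
set_option maxHeartbeats 1000000

open scoped Classical

noncomputable section

namespace CFF

variable (F : Type*) [Field F]

/-- `K` is a (congruence) function field in one variable over `F`: a finitely
generated field extension of transcendence degree one. -/
def IsFunctionField (K : Type*) [Field K] [Algebra F K] : Prop :=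
  ∃ x : K, Transcendental F x ∧
    FiniteDimensional (IntermediateField.adjoin F {x}) K

/-- The exact field of constants of `K` is `F`: every element of `K` algebraic
over `F` already lies in `F`. -/
def HasExactConstants (K : Type*) [Field K] [Algebra F K] : Prop :=
  ∀ a : K, IsAlgebraic F a → a ∈ (algebraMap F K).range

variable (K : Type*) [Field K] [Algebra F K]

/-- A place of the function field `K/F`: a proper valuation subring of `K`
containing the constants. -/
def IsPlace (O : ValuationSubring K) : Prop :=
  O ≠ ⊤ ∧ ∀ c : F, algebraMap F K c ∈ O

/-- The type of places (prime divisors) of `K/F`. -/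
def Place := {O : ValuationSubring K // IsPlace F K O}

variable {K}

/-- `𝔪`-adic order of an element of a valuation subring. -/
def ordAux (O : ValuationSubring K) (x : O) : ℕ :=
  sSup {n : ℕ | x ∈ IsLocalRing.maximalIdeal O ^ n}

/-- The order (normalized valuation) of `f ∈ K` at a valuation subring `O`. -/
def ordAt (O : ValuationSubring K) (f : K) : ℤ :=
  if h : f ∈ O then (ordAux O ⟨f, h⟩ : ℤ)
  else -(ordAux O ⟨f⁻¹, (O.mem_or_inv_mem f).resolve_left h⟩ : ℤ)

/-- The constants embed into (the valuation ring of) any place. -/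
def constHom (p : Place F K) : F →+* p.1 :=
  (algebraMap F K).codRestrict p.1.toSubring fun c => p.2.2 c

/-- The map from the constants to the residue field of a place. -/
def residueHom (p : Place F K) : F →+* IsLocalRing.ResidueField p.1 :=
  (IsLocalRing.residue (p.1 : ValuationSubring K)).comp (constHom F p)

/-- The degree of a place: the dimension of its residue field over the
constants. -/
def placeDegree (p : Place F K) : ℕ :=
  letI := (residueHom F p).toAlgebra
  Module.finrank F (IsLocalRing.ResidueField p.1)

variable (K)

/-- The group of divisors of `K/F`. -/
abbrev Divisor := Place F K →₀ ℤ

/-- The degree homomorphism on divisors. -/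
def degHom : Divisor F K →+ ℤ :=
  Finsupp.liftAddHom fun p => AddMonoidHom.mulRight (placeDegree F p : ℤ)

variable {K}

/-- The Riemann-Roch space `L(D)` of a divisor `D` (the span coincides with the
set of `f` with `div f ≥ -D`, which is an `F`-subspace). -/
def RRspace (D : Divisor F K) : Submodule F K :=
  Submodule.span F {f : K | ∀ p : Place F K, 0 ≤ D p + ordAt p.1 f}

/-- `ℓ(D)`, the dimension of the Riemann-Roch space of `D`. -/
def ell (D : Divisor F K) : ℕ := Module.finrank F (RRspace F D)

variable (K)

/-- The genus of `K/F`, via Riemann's theorem: `g = max_D (deg D + 1 - ℓ(D))`. -/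
def genus : ℕ :=
  sSup {g : ℕ | ∃ D : Divisor F K, (g : ℤ) = degHom F K D + 1 - ell F D}

/-- The subgroup of divisors of degree zero. -/
def zeroDivisors : AddSubgroup (Divisor F K) := (degHom F K).ker

/-- The subgroup of principal divisors. -/
def principalDivisors : AddSubgroup (Divisor F K) :=
  AddSubgroup.closure
    {D : Divisor F K | ∃ f : K, f ≠ 0 ∧ ∀ p : Place F K, D p = ordAt p.1 f}

/-- The group of divisor classes of degree zero of `K/F`. -/
def ClassGroup0 :=
  zeroDivisors F K ⧸ (principalDivisors F K).addSubgroupOf (zeroDivisors F K)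

instance : AddGroup (ClassGroup0 F K) := by
  unfold ClassGroup0; infer_instance

/-- The class number of `K/F`: the order of the group of divisor classes of
degree zero. -/
def classNumber : ℕ := Nat.card (ClassGroup0 F K)

section Extension

variable {k L : Type*} [Field k] [Field L] [Algebra F k] [Algebra F L] [Algebra k L]

/-- A place `P` of `L` lies over the place `p` of `k`. -/
def LiesOver (P : Place F L) (p : Place F k) : Prop :=
  P.1.comap (algebraMap k L) = p.1

variable (L)

/-- `p` is inert in `L/k`: there is a unique place of `L` above `p`, and its
degree is `[L:k] · deg p` (i.e. the residue degree is `[L:k]`, so `e = 1`). -/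
def IsInert (p : Place F k) : Prop :=
  ∃ P : Place F L, LiesOver F P p ∧
    placeDegree F P = Module.finrank k L * placeDegree F p ∧
    ∀ P' : Place F L, LiesOver F P' p → P' = P

/-- `p` splits completely in `L/k`: there are `[L:k]` places above `p`, each of
the same degree as `p`. -/
def SplitsCompletely (p : Place F k) : Prop :=
  Nat.card {P : Place F L // LiesOver F P p} = Module.finrank k L ∧
    ∀ P : Place F L, LiesOver F P p → placeDegree F P = placeDegree F p

/-- `p` is totally ramified in `L/k`: there is a unique place above `p`, of the
same degree (so `f = 1` and `e = [L:k]`). -/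
def IsTotallyRamified (p : Place F k) : Prop :=
  ∃ P : Place F L, LiesOver F P p ∧ placeDegree F P = placeDegree F p ∧
    ∀ P' : Place F L, LiesOver F P' p → P' = P

/-- `p` is unramified in `L/k`: at every place above `p` the orders of elements
of `k` are preserved (`e = 1`). -/
def IsUnramifiedAt (p : Place F k) : Prop :=
  ∀ P : Place F L, LiesOver F P p →
    ∀ x : k, ordAt P.1 (algebraMap k L x) = ordAt p.1 x

end Extension

section Rational

/-- The finite place of `𝔽₂(T)` corresponding to an irreducible polynomial `P`:
the place contains all polynomials and `P` lies in its maximal ideal. -/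
def IsFinitePlaceOf (p : Place (ZMod 2) (RatFunc (ZMod 2)))
    (P : Polynomial (ZMod 2)) : Prop :=
  (∀ g : Polynomial (ZMod 2), algebraMap (Polynomial (ZMod 2)) (RatFunc (ZMod 2)) g ∈ p.1) ∧
    (algebraMap (Polynomial (ZMod 2)) (RatFunc (ZMod 2)) P)⁻¹ ∉ p.1

/-- The infinite place `𝔭_∞` of `𝔽₂(T)`: the place where `T` has a pole. -/
def IsInfinitePlace (p : Place (ZMod 2) (RatFunc (ZMod 2))) : Prop :=
  RatFunc.X ∉ p.1

end Rational

end CFF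

set_option linter.unusedSectionVars false

namespace CFF

open Polynomial
open scoped IntermediateField.algebraAdjoinAdjoin

section Degree

variable {K : Type} [Field K] [Algebra (ZMod 2) K]

/-- A family without nontrivial relations over `𝔽₂[x]`. -/
def PolyIndep (x : K) {m : ℕ} (b : Fin m → K) : Prop :=
  ∀ p : Fin m → (ZMod 2)[X], ∑ i, aeval x (p i) * b i = 0 → p = 0

/-- `x` is transcendental and `K` has degree `n` over `𝔽₂(x)`. -/
structure HasDeg (x : K) (n : ℕ) : Prop where
  trans : Transcendental (ZMod 2) x
  le : ∀ (m : ℕ) (b : Fin m → K), PolyIndep x b → m ≤ n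
  ex : ∃ u : Fin n → K, PolyIndep x u

open IntermediateField in
theorem polyIndep_iff {x : K} (hx : Transcendental (ZMod 2) x) {m : ℕ} (b : Fin m → K) :
    PolyIndep x b ↔ LinearIndependent (IntermediateField.adjoin (ZMod 2) {x}) b := by
  rw [← LinearIndependent.iff_fractionRing (Algebra.adjoin (ZMod 2) {x})
    (IntermediateField.adjoin (ZMod 2) {x}), Fintype.linearIndependent_iff]
  constructor
  · intro h g hg i
    have : ∀ i, ∃ p : (ZMod 2)[X], aeval x p = (g i : K) := fun i => by
      have h1 : (g i : K) ∈ Algebra.adjoin (ZMod 2) {x} := (g i).2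
      simpa only [Algebra.adjoin_singleton_eq_range_aeval, AlgHom.mem_range] using h1
    choose p hp using this
    have h0 := h p (by simpa [hp, Algebra.smul_def, Subalgebra.smul_def] using hg)
    ext
    rw [← hp i, h0]
    simp
  · intro h p hp
    have key := h (fun i => ⟨aeval x (p i), by
      rw [Algebra.adjoin_singleton_eq_range_aeval]; exact ⟨_, rfl⟩⟩)
      (by simpa [Subalgebra.smul_def] using hp)
    funext i
    have := congrArg Subtype.val (key i)
    exact (transcendental_iff.mp hx) _ this

theorem HasDeg.of_finite {x : K} (hx : Transcendental (ZMod 2) x)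
    [FiniteDimensional (IntermediateField.adjoin (ZMod 2) {x}) K] :
    HasDeg x (Module.finrank (IntermediateField.adjoin (ZMod 2) {x}) K) where
  trans := hx
  le m b hb := by
    rw [polyIndep_iff hx] at hb
    simpa using hb.fintype_card_le_finrank
  ex := ⟨Module.finBasis _ _, by
    rw [polyIndep_iff hx]
    exact (Module.finBasis _ _).linearIndependent⟩

theorem HasDeg.inv {x : K} {n : ℕ} (h : HasDeg x n) : HasDeg x⁻¹ n := by
  have hx : Transcendental (ZMod 2) x⁻¹ := fun h' => h.trans (by simpa using h'.inv)
  have e : IntermediateField.adjoin (ZMod 2) {x⁻¹} = IntermediateField.adjoin (ZMod 2) {x} := by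
    apply le_antisymm
    · rw [IntermediateField.adjoin_simple_le_iff]
      exact inv_mem (IntermediateField.mem_adjoin_simple_self _ _)
    · rw [IntermediateField.adjoin_simple_le_iff]
      have := inv_mem (IntermediateField.mem_adjoin_simple_self (ZMod 2) x⁻¹)
      rwa [inv_inv] at this
  have key : ∀ (m : ℕ) (b : Fin m → K), PolyIndep x⁻¹ b ↔ PolyIndep x b := by
    intro m b
    rw [polyIndep_iff hx, polyIndep_iff h.trans, e]
  exact ⟨hx, fun m b hb => h.le m b ((key m b).1 hb), h.ex.imp fun u hu => (key n u).2 hu⟩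

theorem finite_of_transcendental (hFF : IsFunctionField (ZMod 2) K) {x : K}
    (hx : Transcendental (ZMod 2) x) :
    FiniteDimensional (IntermediateField.adjoin (ZMod 2) {x}) K := by
  obtain ⟨y, hy, hfin⟩ := hFF
  have hess : Algebra.EssFiniteType (ZMod 2) K := by
    have : Algebra.EssFiniteType (ZMod 2) (IntermediateField.adjoin (ZMod 2) {y}) := by
      rw [IntermediateField.essFiniteType_iff]
      exact ⟨{y}, by simp⟩
    exact Algebra.EssFiniteType.comp (ZMod 2) (IntermediateField.adjoin (ZMod 2) {y}) K
  have h1 : Algebra.trdeg (ZMod 2) K ≤ Cardinal.mk ({y} : Set K) := by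
    have : Algebra.IsAlgebraic (Algebra.adjoin (ZMod 2) {y}) K :=
      Algebra.IsAlgebraic.trans _ (IntermediateField.adjoin (ZMod 2) {y}) _
    exact Algebra.IsAlgebraic.trdeg_le_cardinalMk (ZMod 2) {y}
  have h2 : AlgebraicIndependent (ZMod 2) (fun _ : Unit => x) :=
    algebraicIndependent_unique_type_iff.mpr hx
  have h3 := h2.isTranscendenceBasis_of_trdeg_le_of_finite (by simpa using h1)
  rw [isTranscendenceBasis_iff_algebraicIndependent_isAlgebraic] at h3
  have h4 := h3.2
  rw [Set.range_const] at h4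
  have : Algebra.IsAlgebraic (IntermediateField.adjoin (ZMod 2) {x}) K :=
    Algebra.IsAlgebraic.extendScalars (R := Algebra.adjoin (ZMod 2) {x})
      (FaithfulSMul.algebraMap_injective _ _)
  have : Algebra.EssFiniteType (IntermediateField.adjoin (ZMod 2) {x}) K :=
    Algebra.EssFiniteType.of_comp (ZMod 2) _ _
  exact Algebra.finite_of_essFiniteType_of_isAlgebraic

theorem exists_hasDeg (hFF : IsFunctionField (ZMod 2) K) {x : K}
    (hx : Transcendental (ZMod 2) x) : ∃ n, HasDeg x n :=
  have := finite_of_transcendental hFF hx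
  ⟨_, HasDeg.of_finite hx⟩

theorem transcendental_algebraMap_X [Algebra (RatFunc (ZMod 2)) K]
    [IsScalarTower (ZMod 2) (RatFunc (ZMod 2)) K] :
    Transcendental (ZMod 2) (algebraMap (RatFunc (ZMod 2)) K RatFunc.X) := by
  rw [transcendental_algebraMap_iff (algebraMap (RatFunc (ZMod 2)) K).injective]
  exact RatFunc.transcendental_X

theorem hasDeg_X [Algebra (RatFunc (ZMod 2)) K]
    [IsScalarTower (ZMod 2) (RatFunc (ZMod 2)) K] (hFF : IsFunctionField (ZMod 2) K) :
    HasDeg (algebraMap (RatFunc (ZMod 2)) K RatFunc.X) (Module.finrank (RatFunc (ZMod 2)) K) := by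
  set T : K := algebraMap (RatFunc (ZMod 2)) K RatFunc.X
  have hT : Transcendental (ZMod 2) T := transcendental_algebraMap_X
  have := finite_of_transcendental hFF hT
  have hc : (algebraMap (RatFunc (ZMod 2)) K) =
      (algebraMap (IntermediateField.adjoin (ZMod 2) {T}) K).comp
        (RatFunc.algEquivOfTranscendental T hT).toRingEquiv.toRingHom := by
    apply IsLocalization.ringHom_ext (nonZeroDivisors (ZMod 2)[X])
    apply Polynomial.ringHom_ext'
    · exact Subsingleton.elim _ _
    · simp [T]
  have e := Algebra.finrank_eq_of_equiv_equiv
    (RatFunc.algEquivOfTranscendental T hT).toRingEquiv (RingEquiv.refl K) (by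
      rw [hc]; rfl)
  rw [e]
  exact HasDeg.of_finite hT

theorem aeval_mem_subring (B : Subring K) {x : K} (hx : x ∈ B) (p : (ZMod 2)[X]) :
    aeval x p ∈ B := by
  induction p using Polynomial.induction_on' with
  | add p q hp hq => rw [map_add]; exact add_mem hp hq
  | monomial n a =>
    rw [aeval_monomial]
    refine mul_mem ?_ (pow_mem hx n)
    have ha : a = 0 ∨ a = 1 := by revert a; decide
    rcases ha with rfl | rfl
    · simp
    · simp

/-- A family in a subring `B ∋ x` that is independent modulo `xB` is independent over
`𝔽₂[x]`. -/
theorem polyIndep_of_quot (B : Subring K) {x : K} (hx : x ∈ B) (hx0 : x ≠ 0)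
    {m : ℕ} (b : Fin m → K) (hb : ∀ i, b i ∈ B)
    (h : ∀ c : Fin m → ZMod 2, (∃ y ∈ B, ∑ i, algebraMap (ZMod 2) K (c i) * b i = x * y) → c = 0) :
    PolyIndep x b := by
  have key : ∀ d : ℕ, ∀ p : Fin m → (ZMod 2)[X], (∀ i, ∀ j ≥ d, (p i).coeff j = 0) →
      ∑ i, aeval x (p i) * b i = 0 → p = 0 := by
    intro d
    induction d with
    | zero =>
      intro p hp _
      funext i
      ext j
      simpa using hp i j (Nat.zero_le _)
    | succ d ih =>
      intro p hp hrel
      have e : ∀ i, aeval x (p i) = aeval x (p i).divX * x + algebraMap (ZMod 2) K ((p i).coeff 0) := by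
        intro i
        conv_lhs => rw [← divX_mul_X_add (p i)]
        simp
      have hc := h (fun i => (p i).coeff 0) ⟨- ∑ i, aeval x (p i).divX * b i,
        neg_mem (sum_mem fun i _ => mul_mem (aeval_mem_subring B hx _) (hb i)), by
          have : ∑ i, (aeval x (p i).divX * x + algebraMap (ZMod 2) K ((p i).coeff 0)) * b i = 0 := by
            simpa only [e] using hrel
          simp only [add_mul, Finset.sum_add_distrib] at this
          rw [mul_neg, Finset.mul_sum]
          rw [eq_neg_iff_add_eq_zero, add_comm, ← this]
          congr 1
          exact Finset.sum_congr rfl fun i _ => by ring⟩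
      have hc' : ∀ i, (p i).coeff 0 = 0 := fun i => congrFun hc i
      have h2 := ih (fun i => (p i).divX)
        (fun i j hj => by rw [coeff_divX]; exact hp i _ (by omega)) (by
        have : x * ∑ i, aeval x (p i).divX * b i = 0 := by
          rw [← hrel, Finset.mul_sum]
          refine Finset.sum_congr rfl fun i _ => ?_
          rw [e, hc' i]
          simp only [map_zero]
          ring
        exact (mul_eq_zero.mp this).resolve_left hx0)
      funext i
      have h3 : (p i).divX = 0 := congrFun h2 i
      rw [← divX_mul_X_add (p i), hc' i, h3]
      simp
  intro p hp
  refine key (Finset.univ.sup (fun i => (p i).natDegree) + 1) p (fun i j hj => ?_) hp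
  refine coeff_eq_zero_of_natDegree_lt (lt_of_lt_of_le (Nat.lt_succ_of_le ?_) hj)
  exact Finset.le_sup (f := fun i => (p i).natDegree) (Finset.mem_univ i)

end Degree
end CFF

namespace CFF

open Polynomial IsLocalRing

section Places

variable {K : Type} [Field K] [Algebra (ZMod 2) K]

theorem zmod_two_cases (a : ZMod 2) : a = 0 ∨ a = 1 := by
  revert a; decide

theorem HasDeg.finite_of_surjective {x : K} {n : ℕ} (hx : HasDeg x n) (B : Subring K) (hxB : x ∈ B)
    {M : Type} [AddCommGroup M] (h2 : ∀ m : M, 2 • m = 0) (π : B →+ M)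
    (hπ : Function.Surjective π) (hker : ∀ y : B, π (⟨x, hxB⟩ * y) = 0) :
    Finite M ∧ Nat.card M ≤ 2 ^ n := by
  let _ : Module (ZMod 2) M := AddCommGroup.zmodModule h2
  have hx0 : x ≠ 0 := fun h => hx.trans (h ▸ isAlgebraic_zero)
  have hsmul : ∀ (a : ZMod 2) (b : B) (hb : algebraMap (ZMod 2) K a * b ∈ B),
      π ⟨algebraMap (ZMod 2) K a * b, hb⟩ = a • π b := by
    intro a b hb
    have ha := zmod_two_cases a
    rcases ha with rfl | rfl
    · simp only [map_zero, zero_mul, zero_smul]; exact map_zero π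
    · simp only [map_one, one_mul, one_smul]
  have hmemB : ∀ (a : ZMod 2) (b : B), algebraMap (ZMod 2) K a * b ∈ B := by
    intro a b
    have ha := zmod_two_cases a
    rcases ha with rfl | rfl <;> simp
  have hrank : Module.rank (ZMod 2) M ≤ n := by
    refine rank_le fun s hs => ?_
    choose b hb using hπ
    have hs' : LinearIndependent (ZMod 2) fun i : Fin s.card => (s.equivFin.symm i : M) :=
      hs.comp _ s.equivFin.symm.injective
    refine hx.le s.card (fun i => (b (s.equivFin.symm i : M) : K)) ?_
    refine polyIndep_of_quot B hxB hx0 _ (fun i => (b _).2) fun c hc => ?_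
    obtain ⟨y, hy, hc⟩ := hc
    rw [Fintype.linearIndependent_iff] at hs'
    funext i
    refine hs' c ?_ i
    have h1 := hker ⟨y, hy⟩
    have h3 : (⟨x, hxB⟩ * ⟨y, hy⟩ : B) =
        ∑ i, ⟨algebraMap (ZMod 2) K (c i) * (b (s.equivFin.symm i : M) : K), hmemB _ _⟩ := by
      apply Subtype.ext
      simp [hc]
    rw [h3, map_sum] at h1
    rw [← h1]
    refine Finset.sum_congr rfl fun i _ => ?_
    rw [hsmul, hb]
  have hfin : Module.Finite (ZMod 2) M :=
    Module.rank_lt_aleph0_iff.mp (hrank.trans_lt (Cardinal.natCast_lt_aleph0))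
  have hfin' : Finite M := Module.finite_of_finite (ZMod 2)
  refine ⟨hfin', ?_⟩
  rw [Module.natCard_eq_pow_finrank (K := ZMod 2)]
  rw [Nat.card_zmod]
  exact Nat.pow_le_pow_right (by norm_num) (Module.finrank_le_of_rank_le hrank)

variable (K) in
/-- `K` is a function field in one variable with exact constant field `𝔽₂`. -/
class FunctionFieldTwo : Prop where
  ff : IsFunctionField (ZMod 2) K
  const : HasExactConstants (ZMod 2) K

instance : CharP K 2 := charP_of_injective_algebraMap (algebraMap (ZMod 2) K).injective 2

variable [FunctionFieldTwo K]

theorem transcendental_of_ne {x : K} (h0 : x ≠ 0) (h1 : x ≠ 1) : Transcendental (ZMod 2) x := by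
  intro h
  obtain ⟨a, rfl⟩ := FunctionFieldTwo.const x h
  have ha := zmod_two_cases a
  rcases ha with rfl | rfl
  · exact h0 (map_zero _)
  · exact h1 (map_one _)

theorem exists_deg {x : K} (h0 : x ≠ 0) (h1 : x ≠ 1) : ∃ n, HasDeg x n :=
  exists_hasDeg FunctionFieldTwo.ff (transcendental_of_ne h0 h1)

variable (P : Place (ZMod 2) K)

instance : IsNoetherianRing P.1 := by
  refine ⟨fun I => ?_⟩
  by_cases hI : I = ⊥
  · rw [hI]; exact Submodule.fg_bot
  obtain ⟨x, hxI, hx0⟩ := Submodule.exists_mem_ne_zero_of_ne_bot hI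
  by_cases hx1 : x = 1
  · rw [(Ideal.eq_top_iff_one I).mpr (hx1 ▸ hxI)]; exact Module.Finite.fg_top
  obtain ⟨n, hn⟩ := exists_deg (x := (x : K)) (by simpa using hx0) (by
    intro h; exact hx1 (Subtype.ext h))
  have hfin := (hn.finite_of_surjective P.1.toSubring x.2
    (M := P.1 ⧸ Ideal.span {x}) (fun m => by
      obtain ⟨m, rfl⟩ := Ideal.Quotient.mk_surjective m
      rw [← map_nsmul]
      rw [two_smul, Subtype.ext (CharTwo.add_self_eq_zero (m : K)) (a1 := m + m) (a2 := 0),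
        map_zero]) (Ideal.Quotient.mk (Ideal.span {x})).toAddMonoidHom
      Ideal.Quotient.mk_surjective (fun y => by
        refine Ideal.Quotient.eq_zero_iff_mem.mpr ?_
        exact Ideal.mul_mem_right _ _ (Ideal.mem_span_singleton_self x))).1
  refine Submodule.fg_of_fg_map_of_fg_inf_ker (Ideal.span {x}).mkQ ?_ ?_
  · have : IsNoetherian P.1 (P.1 ⧸ Ideal.span {x}) := isNoetherian_of_finite _ _
    exact IsNoetherian.noetherian _
  · rw [Submodule.ker_mkQ, inf_eq_right.mpr ((Ideal.span_singleton_le_iff_mem _).mpr hxI)]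
    exact ⟨{x}, by simp [Ideal.span]⟩

instance : IsDiscreteValuationRing P.1 where
  toIsPrincipalIdealRing := inferInstance
  not_a_field' := by
    intro h
    refine P.2.1 (top_le_iff.mp fun f _ => ?_)
    rcases P.1.mem_or_inv_mem f with hf | hf
    · exact hf
    · by_cases h0 : f = 0
      · rw [h0]; exact P.1.zero_mem
      have : IsField P.1 := IsLocalRing.isField_iff_maximalIdeal_eq.mpr h
      obtain ⟨g, hg⟩ := this.mul_inv_cancel (a := ⟨f⁻¹, hf⟩) (by
        intro h; exact h0 (by simpa using congrArg Subtype.val h))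
      have hg' : f⁻¹ * g = 1 := congrArg Subtype.val hg
      have : f = g := by field_simp at hg'; exact hg'.symm
      rw [this]
      exact g.2

end Places
end CFF

namespace CFF

open Polynomial IsLocalRing

section Order

variable {K : Type} [Field K] [Algebra (ZMod 2) K] [FunctionFieldTwo K] (P : Place (ZMod 2) K)

theorem ordAux_eq {ϖ : P.1} (hϖ : Irreducible ϖ) (n : ℕ) {u : P.1} (hu : IsUnit u) :
    ordAux P.1 (ϖ ^ n * u) = n := by
  have : {k : ℕ | ϖ ^ n * u ∈ maximalIdeal P.1 ^ k} = Set.Iic n := by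
    ext k
    rw [Set.mem_ofPred_eq, hϖ.maximalIdeal_eq, Ideal.span_singleton_pow, Ideal.mem_span_singleton,
      hu.dvd_mul_right, pow_dvd_pow_iff hϖ.ne_zero hϖ.not_isUnit]
    rfl
  rw [ordAux, this]
  exact csSup_Iic

/-- Units of the valuation ring of a place. -/
def IsU (u : K) : Prop := u ≠ 0 ∧ u ∈ P.1 ∧ u⁻¹ ∈ P.1

variable {P} in
theorem IsU.mul {u v : K} (hu : IsU P u) (hv : IsU P v) : IsU P (u * v) :=
  ⟨mul_ne_zero hu.1 hv.1, mul_mem hu.2.1 hv.2.1, by rw [mul_inv]; exact mul_mem hu.2.2 hv.2.2⟩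

variable {P} in
theorem IsU.inv {u : K} (hu : IsU P u) : IsU P u⁻¹ :=
  ⟨inv_ne_zero hu.1, hu.2.2, by rw [inv_inv]; exact hu.2.1⟩

theorem exists_unif : ∃ t : K, t ≠ 0 ∧ t ∈ P.1 ∧ t⁻¹ ∉ P.1 ∧
    (∀ (n : ℤ) (u : K), IsU P u → ordAt P.1 (t ^ n * u) = n) ∧
    ∀ f : K, f ≠ 0 → ∃ (n : ℤ) (u : K), IsU P u ∧ f = t ^ n * u := by
  obtain ⟨ϖ, hϖ⟩ := IsDiscreteValuationRing.exists_irreducible P.1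
  have h0 : (ϖ : K) ≠ 0 := fun h => hϖ.ne_zero (Subtype.ext h)
  have hinv : (ϖ : K)⁻¹ ∉ P.1 := by
    intro h
    refine hϖ.not_isUnit (isUnit_iff_exists_inv.mpr ⟨⟨_, h⟩, Subtype.ext ?_⟩)
    exact mul_inv_cancel₀ h0
  have hunit : ∀ u (hu : IsU P u), IsUnit (⟨u, hu.2.1⟩ : P.1) := fun u hu =>
    isUnit_iff_exists_inv.mpr ⟨⟨_, hu.2.2⟩, Subtype.ext (mul_inv_cancel₀ hu.1)⟩
  have hpow : ∀ (n : ℕ) u, IsU P u → ∀ h : (ϖ : K) ^ n * u ∈ P.1, ordAux P.1 ⟨_, h⟩ = n := by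
    intro n u hu h
    exact ordAux_eq P hϖ n (hunit u hu)
  have hdecomp : ∀ f ∈ P.1, f ≠ 0 → ∃ (n : ℕ) (u : K), IsU P u ∧ f = (ϖ : K) ^ n * u := by
    intro f hf hf0
    obtain ⟨n, u, hu⟩ := IsDiscreteValuationRing.eq_unit_mul_pow_irreducible
      (x := (⟨f, hf⟩ : P.1)) (fun h => hf0 (congrArg Subtype.val h)) hϖ
    refine ⟨n, ((u : P.1) : K), ⟨?_, (u : P.1).2, ?_⟩, ?_⟩
    · intro h; exact u.ne_zero (Subtype.ext h)
    · have h1 : ((u : P.1) : K) * ((u⁻¹ : P.1ˣ) : P.1) = 1 := congrArg Subtype.val u.mul_inv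
      rw [← eq_inv_of_mul_eq_one_right h1]
      exact ((u⁻¹ : P.1ˣ) : P.1).2
    · rw [mul_comm]; exact congrArg Subtype.val hu
  refine ⟨ϖ, h0, ϖ.2, hinv, ?_, ?_⟩
  · intro n u hu
    rcases Int.le_total 0 n with hn | hn
    · obtain ⟨k, rfl⟩ := Int.eq_ofNat_of_zero_le hn
      have hm : (ϖ : K) ^ ((k : ℕ) : ℤ) * u ∈ P.1 := by
        rw [zpow_natCast]; exact mul_mem (pow_mem ϖ.2 k) hu.2.1
      rw [ordAt, dif_pos hm]
      simp only [zpow_natCast]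
      rw [hpow k u hu]
    · obtain ⟨k, hk⟩ := Int.eq_ofNat_of_zero_le (a := -n) (by omega)
      obtain rfl : n = -(k : ℤ) := by omega
      by_cases hk0 : k = 0
      · subst hk0
        have hm : (ϖ : K) ^ (-((0 : ℕ) : ℤ)) * u ∈ P.1 := by simpa using hu.2.1
        rw [ordAt, dif_pos hm]
        have := hpow 0 u hu (by simpa using hu.2.1)
        simpa using this
      have hm : (ϖ : K) ^ (-(k : ℤ)) * u ∉ P.1 := by
        intro hm
        apply hinv
        have : (ϖ : K)⁻¹ = ((ϖ : K) ^ (-(k : ℤ)) * u) * u⁻¹ * ϖ ^ (k - 1) := by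
          obtain ⟨j, rfl⟩ := Nat.exists_eq_succ_of_ne_zero hk0
          have := hu.1
          rw [zpow_neg, zpow_natCast]
          simp only [Nat.succ_eq_add_one, Nat.add_sub_cancel]
          field_simp
          rw [pow_succ']
        rw [this]
        exact mul_mem (mul_mem hm hu.2.2) (pow_mem ϖ.2 _)
      rw [ordAt, dif_neg hm]
      have hi : ((ϖ : K) ^ (-(k : ℤ)) * u)⁻¹ = ϖ ^ k * u⁻¹ := by
        rw [mul_inv, zpow_neg, inv_inv, zpow_natCast]
      simp only [hi]
      rw [hpow k _ hu.inv]
  · intro f hf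
    rcases P.1.mem_or_inv_mem f with h | h
    · obtain ⟨n, u, hu, rfl⟩ := hdecomp f h hf
      exact ⟨n, u, hu, by rw [zpow_natCast]⟩
    · obtain ⟨n, u, hu, e⟩ := hdecomp f⁻¹ h (inv_ne_zero hf)
      refine ⟨-n, u⁻¹, hu.inv, ?_⟩
      rw [← inv_inv f, e, mul_inv, zpow_neg, zpow_natCast]

theorem ordAt_zero : ordAt P.1 0 = 0 := by
  rw [ordAt, dif_pos P.1.zero_mem]
  have : {k : ℕ | (⟨0, P.1.zero_mem⟩ : P.1) ∈ maximalIdeal P.1 ^ k} = Set.univ := by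
    ext k
    exact ⟨fun _ => trivial, fun _ => (maximalIdeal P.1 ^ k).zero_mem⟩
  rw [ordAux, this]
  simp

theorem isU_of_ordAt {u : K} (hu : IsU P u) : ordAt P.1 u = 0 := by
  obtain ⟨t, -, -, -, h, -⟩ := exists_unif P
  simpa using h 0 u hu

theorem ordAt_mul {f g : K} (hf : f ≠ 0) (hg : g ≠ 0) :
    ordAt P.1 (f * g) = ordAt P.1 f + ordAt P.1 g := by
  obtain ⟨t, ht, -, -, h1, h2⟩ := exists_unif P
  obtain ⟨n, u, hu, rfl⟩ := h2 f hf
  obtain ⟨m, v, hv, rfl⟩ := h2 g hg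
  rw [h1 n u hu, h1 m v hv, ← h1 (n + m) _ (hu.mul hv), zpow_add₀ ht]
  congr 1
  ring

theorem ordAt_one : ordAt P.1 1 = 0 :=
  isU_of_ordAt P ⟨one_ne_zero, P.1.one_mem, by simp⟩

theorem ordAt_inv (f : K) : ordAt P.1 f⁻¹ = - ordAt P.1 f := by
  by_cases hf : f = 0
  · simp [hf, ordAt_zero]
  have := ordAt_mul P hf (inv_ne_zero hf)
  rw [mul_inv_cancel₀ hf, ordAt_one] at this
  omega

theorem ordAt_pow (f : K) (n : ℕ) : ordAt P.1 (f ^ n) = n * ordAt P.1 f := by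
  by_cases hf : f = 0
  · rcases n with _ | n
    · simp [ordAt_one]
    · simp [hf, ordAt_zero]
  induction n with
  | zero => simp [ordAt_one]
  | succ n ih => rw [pow_succ, ordAt_mul P (pow_ne_zero n hf) hf, ih]; push_cast; ring

theorem ordAt_div {f g : K} (hf : f ≠ 0) (hg : g ≠ 0) :
    ordAt P.1 (f / g) = ordAt P.1 f - ordAt P.1 g := by
  rw [div_eq_mul_inv, ordAt_mul P hf (inv_ne_zero hg), ordAt_inv]; ring

theorem ordAt_nonneg_iff (f : K) : 0 ≤ ordAt P.1 f ↔ f ∈ P.1 := by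
  by_cases hf : f = 0
  · simp [hf, ordAt_zero]
  by_cases h : f ∈ P.1
  · rw [ordAt, dif_pos h]; simp [h]
  · obtain ⟨t, ht, htm, -, h1, h2⟩ := exists_unif P
    simp only [h, iff_false, not_le]
    obtain ⟨n, u, hu, rfl⟩ := h2 f hf
    rw [h1 n u hu]
    by_contra hn
    obtain ⟨k, rfl⟩ := Int.eq_ofNat_of_zero_le (not_lt.mp hn)
    refine h ?_
    rw [zpow_natCast]
    exact mul_mem (pow_mem htm k) hu.2.1

theorem exists_ordAt_eq (n : ℤ) : ∃ f : K, f ≠ 0 ∧ ordAt P.1 f = n := by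
  obtain ⟨t, ht, -, -, h1, -⟩ := exists_unif P
  refine ⟨t ^ n, zpow_ne_zero n ht, ?_⟩
  have := h1 n 1 ⟨one_ne_zero, P.1.one_mem, by simp⟩
  rwa [mul_one] at this

theorem le_ordAt_iff {n : ℤ} {f t : K} (ht : t ≠ 0) (htn : ordAt P.1 t = n) :
    f = 0 ∨ n ≤ ordAt P.1 f ↔ f / t ∈ P.1 := by
  rw [← ordAt_nonneg_iff]
  by_cases hf : f = 0
  · simp [hf, ordAt_zero]
  · rw [ordAt_div P hf ht]
    simp only [hf, false_or]
    omega

/-- Functions of order at least `n` at `P`. -/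
def fil (n : ℤ) : AddSubgroup K where
  carrier := {f | f = 0 ∨ n ≤ ordAt P.1 f}
  zero_mem' := Or.inl rfl
  add_mem' := by
    intro f g hf hg
    obtain ⟨t, ht, htn⟩ := exists_ordAt_eq P n
    simp only [Set.mem_ofPred_eq, le_ordAt_iff P ht htn] at *
    rw [add_div]
    exact add_mem hf hg
  neg_mem' := by
    intro f hf
    obtain ⟨t, ht, htn⟩ := exists_ordAt_eq P n
    simp only [Set.mem_ofPred_eq, le_ordAt_iff P ht htn] at *
    rw [neg_div]
    exact neg_mem hf

variable {P}

theorem mem_fil {n : ℤ} {f : K} : f ∈ fil P n ↔ f = 0 ∨ n ≤ ordAt P.1 f := Iff.rfl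

theorem mem_fil_of_ne {n : ℤ} {f : K} (hf : f ≠ 0) : f ∈ fil P n ↔ n ≤ ordAt P.1 f := by
  simp [mem_fil, hf]

theorem mem_fil_of_le {n : ℤ} {f : K} (h : n ≤ ordAt P.1 f) : f ∈ fil P n := Or.inr h

theorem mem_fil_zero {f : K} : f ∈ fil P 0 ↔ f ∈ P.1 := by
  rw [mem_fil, ordAt_nonneg_iff]
  exact ⟨fun h => h.elim (fun h => h ▸ P.1.zero_mem) id, Or.inr⟩

theorem fil_mono {m n : ℤ} (h : m ≤ n) : fil P n ≤ fil P m := fun _ hf => hf.imp id h.trans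

theorem mul_mem_fil {m n : ℤ} {f g : K} (hf : f ∈ fil P m) (hg : g ∈ fil P n) :
    f * g ∈ fil P (m + n) := by
  by_cases hf0 : f = 0
  · simp [hf0]
  by_cases hg0 : g = 0
  · simp [hg0]
  rw [mem_fil_of_ne hf0] at hf
  rw [mem_fil_of_ne hg0] at hg
  rw [mem_fil_of_ne (mul_ne_zero hf0 hg0), ordAt_mul P hf0 hg0]
  omega

theorem pow_mem_fil {m : ℤ} {f : K} (hf : f ∈ fil P m) (k : ℕ) :
    f ^ k ∈ fil P (k * m) := by
  induction k with
  | zero => exact mem_fil_of_le (by simp [ordAt_one])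
  | succ k ih =>
    rw [pow_succ]
    convert mul_mem_fil ih hf using 2
    push_cast; ring

theorem ordAt_add_eq {f g : K} (hf : f ≠ 0) (hg : g ∈ fil P (ordAt P.1 f + 1)) :
    f + g ≠ 0 ∧ ordAt P.1 (f + g) = ordAt P.1 f := by
  have h0 : f ∉ fil P (ordAt P.1 f + 1) := by rw [mem_fil_of_ne hf]; omega
  have h1 : f + g ∉ fil P (ordAt P.1 f + 1) := fun h => h0 (by simpa using sub_mem h hg)
  have h2 : f + g ∈ fil P (ordAt P.1 f) :=
    add_mem (mem_fil_of_le le_rfl) (fil_mono (by omega) hg)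
  have h3 : f + g ≠ 0 := fun h => h1 (h ▸ zero_mem _)
  rw [mem_fil_of_ne h3] at h1 h2
  exact ⟨h3, by omega⟩

theorem ordAt_pos_iff {f : K} (_hf : f ≠ 0) : 0 < ordAt P.1 f ↔ f⁻¹ ∉ P.1 := by
  rw [← ordAt_nonneg_iff, ordAt_inv]; omega

variable (P)

/-- The residue field of a place. -/
abbrev Res : Type := ResidueField P.1

/-- The residue of a function at a place (zero at poles). -/
def resAt (f : K) : Res P := if h : f ∈ P.1 then residue P.1 ⟨f, h⟩ else 0

variable {P}

theorem resAt_of_mem {f : K} (h : f ∈ P.1) : resAt P f = residue P.1 ⟨f, h⟩ := dif_pos h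

theorem resAt_add {f g : K} (hf : f ∈ P.1) (hg : g ∈ P.1) :
    resAt P (f + g) = resAt P f + resAt P g := by
  rw [resAt_of_mem hf, resAt_of_mem hg, resAt_of_mem (add_mem hf hg), ← map_add]; rfl

theorem resAt_mul {f g : K} (hf : f ∈ P.1) (hg : g ∈ P.1) :
    resAt P (f * g) = resAt P f * resAt P g := by
  rw [resAt_of_mem hf, resAt_of_mem hg, resAt_of_mem (mul_mem hf hg), ← map_mul]; rfl

@[simp] theorem resAt_one : resAt P (1 : K) = 1 := by
  rw [resAt_of_mem P.1.one_mem]; exact map_one _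

@[simp] theorem resAt_zero : resAt P (0 : K) = 0 := by
  rw [resAt_of_mem P.1.zero_mem]; exact map_zero _

theorem resAt_pow {f : K} (hf : f ∈ P.1) (n : ℕ) : resAt P (f ^ n) = resAt P f ^ n := by
  induction n with
  | zero => simp
  | succ n ih => rw [pow_succ, resAt_mul (pow_mem hf n) hf, ih, pow_succ]

theorem resAt_eq_zero_iff {f : K} (hf : f ∈ P.1) : resAt P f = 0 ↔ f ∈ fil P 1 := by
  by_cases h0 : f = 0
  · simp [h0]
  rw [resAt_of_mem hf, residue_eq_zero_iff, mem_maximalIdeal, mem_nonunits_iff,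
    mem_fil_of_ne h0, show (1 ≤ ordAt P.1 f ↔ 0 < ordAt P.1 f) from Iff.rfl,
    ordAt_pos_iff h0, not_iff_not]
  constructor
  · intro h
    obtain ⟨b, hb⟩ := isUnit_iff_exists_inv.mp h
    have hb' : f * b = 1 := congrArg Subtype.val hb
    rw [← eq_inv_of_mul_eq_one_right hb']
    exact b.2
  · intro h
    exact isUnit_iff_exists_inv.mpr ⟨⟨_, h⟩, Subtype.ext (mul_inv_cancel₀ h0)⟩

theorem resAt_surjective (a : Res P) : ∃ f ∈ P.1, resAt P f = a := by
  obtain ⟨⟨f, hf⟩, rfl⟩ := residue_surjective a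
  exact ⟨f, hf, resAt_of_mem hf⟩

end Order
end CFF

namespace CFF

open Polynomial IsLocalRing

section Steps

variable {K : Type} [Field K] [Algebra (ZMod 2) K] [FunctionFieldTwo K] (P : Place (ZMod 2) K)

instance : CharP (Res P) 2 := charP_of_injective_ringHom (residueHom (ZMod 2) P).injective 2

theorem exists_ordAt_pos : ∃ t : K, t ≠ 0 ∧ t ≠ 1 ∧ 0 < ordAt P.1 t := by
  obtain ⟨t, h0, h1⟩ := exists_ordAt_eq P 1
  refine ⟨t, h0, ?_, by omega⟩
  rintro rfl
  rw [ordAt_one] at h1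
  omega

theorem finite_res_card {x : K} {n : ℕ} (hx : HasDeg x n) (hP : x ∈ fil P 1) :
    Finite (Res P) ∧ Nat.card (Res P) ≤ 2 ^ n := by
  have hxP : x ∈ P.1 := mem_fil_zero.mp (fil_mono (by norm_num) hP)
  let π : P.1 →+ Res P := (residue P.1).toAddMonoidHom
  have hπ : Function.Surjective π := residue_surjective
  refine hx.finite_of_surjective P.1.toSubring hxP (M := Res P)
    (fun m => by rw [two_smul]; exact CharTwo.add_self_eq_zero m)
    π hπ fun (y : P.1) => ?_
  change residue P.1 (⟨x, hxP⟩ * y) = 0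
  rw [map_mul, ← resAt_of_mem hxP, (resAt_eq_zero_iff hxP).mpr hP, zero_mul]

instance : Finite (Res P) := by
  obtain ⟨t, h0, h1, ht⟩ := exists_ordAt_pos P
  obtain ⟨n, hn⟩ := exists_deg h0 h1
  exact (finite_res_card P hn (mem_fil_of_le ht)).1

theorem card_res : Nat.card (Res P) = 2 ^ placeDegree (ZMod 2) P := by
  let _ := (residueHom (ZMod 2) P).toAlgebra
  have : Module.Finite (ZMod 2) (Res P) := Module.Finite.of_finite
  have := Module.natCard_eq_pow_finrank (K := ZMod 2) (V := Res P)
  rwa [Nat.card_zmod] at this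

theorem placeDegree_pos : 0 < placeDegree (ZMod 2) P := by
  by_contra h
  have h1 := card_res P
  rw [Nat.eq_zero_of_not_pos h, pow_zero] at h1
  have := Finite.one_lt_card (α := Res P)
  omega

/-- Leading coefficient at `P`, measured against a function `g` of exact order `n`. -/
def leadHom {n : ℤ} {g : K} (hg : g ≠ 0) (hn : ordAt P.1 g = n) : fil P n →+ Res P where
  toFun f := resAt P (f / g)
  map_zero' := by simp
  map_add' f h := by
    have h1 := (le_ordAt_iff P hg hn).mp f.2
    have h2 := (le_ordAt_iff P hg hn).mp h.2
    rw [AddSubgroup.coe_add, add_div, resAt_add h1 h2]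

theorem div_mem_fil_one_iff {n : ℤ} {f g : K} (hg : g ≠ 0) (hn : ordAt P.1 g = n) (k : ℤ) :
    f / g ∈ fil P k ↔ f ∈ fil P (n + k) := by
  by_cases hf : f = 0
  · simp [hf]
  rw [mem_fil_of_ne (div_ne_zero hf hg), mem_fil_of_ne hf, ordAt_div P hf hg]
  omega

theorem leadHom_ker {n : ℤ} {g : K} (hg : g ≠ 0) (hn : ordAt P.1 g = n) :
    (leadHom P hg hn).ker = (fil P (n + 1)).addSubgroupOf (fil P n) := by
  ext f
  rw [AddMonoidHom.mem_ker, AddSubgroup.mem_addSubgroupOf, ← div_mem_fil_one_iff P hg hn]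
  exact resAt_eq_zero_iff ((le_ordAt_iff P hg hn).mp f.2)

theorem relIndex_fil_of_le {n : ℤ} {X : AddSubgroup K} (hX : X ≤ fil P n) {g : K} (hg : g ≠ 0)
    (hn : ordAt P.1 g = n) :
    (fil P (n + 1)).relIndex X =
      Nat.card ((X.addSubgroupOf (fil P n)).map (leadHom P hg hn)) := by
  rw [← AddSubgroup.relIndex_addSubgroupOf hX, ← leadHom_ker P hg hn, AddSubgroup.relIndex_ker]

theorem relIndex_fil (n : ℤ) :
    (fil P (n + 1)).relIndex (fil P n) = 2 ^ placeDegree (ZMod 2) P := by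
  obtain ⟨g, hg, hn⟩ := exists_ordAt_eq P n
  rw [relIndex_fil_of_le P le_rfl hg hn, ← card_res]
  rw [AddSubgroup.addSubgroupOf_self, ← AddMonoidHom.range_eq_map,
    AddMonoidHom.range_eq_top.mpr, AddSubgroup.card_top]
  intro a
  obtain ⟨f, hf, rfl⟩ := resAt_surjective a
  refine ⟨⟨f * g, ?_⟩, ?_⟩
  · have := mul_mem_fil (mem_fil_zero.mpr hf) (mem_fil_of_le hn.ge)
    rwa [zero_add] at this
  · simp [leadHom, hg]

theorem card_eq_card_inf_mul (X Y : AddSubgroup K) :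
    Nat.card X = Nat.card (X ⊓ Y : AddSubgroup K) * Y.relIndex X := by
  rw [← AddSubgroup.relIndex_bot_left, ← AddSubgroup.relIndex_bot_left, inf_comm X Y,
    AddSubgroup.relIndex_inf_mul_relIndex, bot_inf_eq]

theorem relIndex_fil_le {n : ℤ} {X : AddSubgroup K} (hX : X ≤ fil P n) :
    (fil P (n + 1)).relIndex X ≤ 2 ^ placeDegree (ZMod 2) P := by
  rw [← relIndex_fil P n]
  exact AddSubgroup.relIndex_le_of_le_right hX (by rw [relIndex_fil]; positivity)

theorem relIndex_fil_ne_zero {n : ℤ} {X : AddSubgroup K} (hX : X ≤ fil P n) :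
    (fil P (n + 1)).relIndex X ≠ 0 := fun h => by
  have := AddSubgroup.relIndex_eq_zero_of_le_right hX h
  rw [relIndex_fil] at this
  exact absurd this (by positivity)

theorem card_step_le {n : ℤ} {X : AddSubgroup K} (hX : X ≤ fil P n) (E : Set (Res P))
    (h0 : (0 : Res P) ∈ E)
    (hE : ∀ f ∈ X, ∀ g ∈ X, f ∉ fil P (n + 1) → g ∉ fil P (n + 1) → resAt P (f / g) ∈ E) :
    Nat.card X ≤ Nat.card (X ⊓ fil P (n + 1) : AddSubgroup K) * Nat.card E := by
  rw [card_eq_card_inf_mul X (fil P (n + 1))]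
  refine Nat.mul_le_mul_left _ ?_
  by_cases h : X ≤ fil P (n + 1)
  · rw [AddSubgroup.relIndex_eq_one.mpr h]
    have : Nonempty E := ⟨⟨0, h0⟩⟩
    exact Nat.card_pos
  obtain ⟨g, hgX, hg⟩ := SetLike.not_le_iff_exists.mp h
  have hg0 : g ≠ 0 := fun h => hg (h ▸ zero_mem _)
  have hgn : ordAt P.1 g = n := by
    have h1 := hX hgX
    rw [mem_fil_of_ne hg0] at h1 hg
    omega
  rw [relIndex_fil_of_le P hX hg0 hgn]
  refine Nat.card_mono (Set.toFinite E) ?_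
  rintro _ ⟨⟨f, hf⟩, hfX, rfl⟩
  change resAt P (f / g) ∈ E
  by_cases hf1 : f ∈ fil P (n + 1)
  · have h1 : f / g ∈ fil P 1 := (div_mem_fil_one_iff P hg0 hgn 1).mpr hf1
    rw [(resAt_eq_zero_iff (mem_fil_zero.mp (fil_mono (by norm_num) h1))).mpr h1]
    exact h0
  · exact hE f hfX g hgX hf1 hg

end Steps
end CFF

namespace CFF

open Polynomial IsLocalRing

section Approx

variable {K : Type} [Field K] [Algebra (ZMod 2) K] [FunctionFieldTwo K] (P : Place (ZMod 2) K)

/-- The real absolute value attached to a place. -/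
def absP : AbsoluteValue K ℝ where
  toFun f := if f = 0 then 0 else (2 : ℝ) ^ (-ordAt P.1 f)
  map_mul' f g := by
    by_cases hf : f = 0
    · simp [hf]
    by_cases hg : g = 0
    · simp [hg]
    simp only [hf, hg, mul_eq_zero, or_self, if_false]
    rw [ordAt_mul P hf hg, neg_add, zpow_add₀ two_ne_zero]
  nonneg' f := by
    split_ifs <;> positivity
  eq_zero' f := by
    by_cases hf : f = 0
    · simp [hf]
    · simp only [hf, if_false, iff_false]; positivity
  add_le' f g := by
    by_cases hf : f = 0
    · simp [hf]
    by_cases hg : g = 0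
    · simp [hg]
    by_cases hfg : f + g = 0
    · simp only [hfg, hf, hg, if_true, if_false]; positivity
    simp only [hfg, hf, hg, if_false]
    have h1 : f + g ∈ fil P (min (ordAt P.1 f) (ordAt P.1 g)) :=
      add_mem (mem_fil_of_le (min_le_left _ _)) (mem_fil_of_le (min_le_right _ _))
    rw [mem_fil_of_ne hfg, min_le_iff] at h1
    have p1 : (0 : ℝ) < 2 ^ (-ordAt P.1 f) := by positivity
    have p2 : (0 : ℝ) < 2 ^ (-ordAt P.1 g) := by positivity
    rcases h1 with h1 | h1
    · have : (2 : ℝ) ^ (-ordAt P.1 (f + g)) ≤ 2 ^ (-ordAt P.1 f) :=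
        zpow_le_zpow_right₀ one_le_two (neg_le_neg h1)
      linarith
    · have : (2 : ℝ) ^ (-ordAt P.1 (f + g)) ≤ 2 ^ (-ordAt P.1 g) :=
        zpow_le_zpow_right₀ one_le_two (neg_le_neg h1)
      linarith

theorem absP_apply {f : K} (hf : f ≠ 0) : absP P f = (2 : ℝ) ^ (-ordAt P.1 f) := if_neg hf

theorem one_lt_absP {f : K} (hf : f ≠ 0) : 1 < absP P f ↔ ordAt P.1 f < 0 := by
  rw [absP_apply P hf, one_lt_zpow_iff_right₀ one_lt_two, neg_pos]

theorem absP_lt_one {f : K} (hf : f ≠ 0) : absP P f < 1 ↔ 0 < ordAt P.1 f := by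
  rw [absP_apply P hf, zpow_lt_one_iff_right₀ one_lt_two, neg_lt_zero]

theorem not_mem_iff_absP {f : K} : f ∉ P.1 ↔ 1 < absP P f := by
  by_cases hf : f = 0
  · simp [hf, P.1.zero_mem]
  · rw [one_lt_absP P hf, ← not_le, ordAt_nonneg_iff]

theorem exists_separating (S : Finset (Place (ZMod 2) K)) {P : Place (ZMod 2) K} (hP : P ∈ S) :
    ∃ a : K, a ≠ 0 ∧ ordAt P.1 a < 0 ∧ ∀ Q ∈ S, Q ≠ P → 0 < ordAt Q.1 a ∨ a = 0 := by
  have h := AbsoluteValue.exists_one_lt_lt_one_pi_of_not_isEquiv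
    (v := fun Q : S => absP Q.1) (fun Q => by
      obtain ⟨t, h0, h1⟩ := exists_ordAt_eq Q.1 1
      refine ⟨t, h0, ?_⟩
      exact ((absP_lt_one Q.1 h0).mpr (by omega)).ne)
    (fun Q R hQR he => hQR (by
      apply Subtype.ext
      apply Subtype.ext
      ext f
      rw [← not_iff_not, not_mem_iff_absP, not_mem_iff_absP]
      exact (AbsoluteValue.IsEquiv.one_lt_iff he)))
  obtain ⟨a, ha, hb⟩ := h ⟨P, hP⟩
  have ha0 : a ≠ 0 := by rintro rfl; simp at ha; linarith
  refine ⟨a, ha0, (one_lt_absP P ha0).mp ha, fun Q hQ hQP => Or.inl ?_⟩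
  exact (absP_lt_one Q ha0).mp (hb ⟨Q, hQ⟩ (by simpa [Subtype.ext_iff] using hQP))

theorem exists_idem (S : Finset (Place (ZMod 2) K)) {P : Place (ZMod 2) K} (hP : P ∈ S) (N : ℕ) :
    ∃ e : K, e - 1 ∈ fil P N ∧ ∀ Q ∈ S, Q ≠ P → e ∈ fil Q N := by
  obtain ⟨a, ha, hP1, hQ1⟩ := exists_separating S hP
  have hpow : a ^ (N + 1) ≠ 0 := pow_ne_zero _ ha
  have h1 : ordAt P.1 (a ^ (N + 1)) < 0 := by
    rw [ordAt_pow]; push_cast; nlinarith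
  obtain ⟨h2, h3⟩ := ordAt_add_eq (P := P) (g := 1) hpow
    (mem_fil_of_le (by rw [ordAt_one]; omega))
  refine ⟨a ^ (N + 1) / (a ^ (N + 1) + 1), ?_, fun Q hQ hQP => ?_⟩
  · have : a ^ (N + 1) / (a ^ (N + 1) + 1) - 1 = -(a ^ (N + 1) + 1)⁻¹ := by
      field_simp; ring
    rw [this]
    refine neg_mem (mem_fil_of_le ?_)
    rw [ordAt_inv, h3, ordAt_pow]
    push_cast
    nlinarith
  · have h4 := (hQ1 Q hQ hQP).resolve_right ha
    obtain ⟨h5, h6⟩ := ordAt_add_eq (P := Q) (f := 1) (g := a ^ (N + 1)) one_ne_zero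
      (mem_fil_of_le (by rw [ordAt_one, ordAt_pow]; push_cast; nlinarith))
    rw [add_comm] at h5 h6
    refine mem_fil_of_le ?_
    rw [ordAt_div Q hpow h5, h6, ordAt_one, ordAt_pow]
    push_cast
    nlinarith

theorem approx (S : Finset (Place (ZMod 2) K)) (a : Place (ZMod 2) K → K) (N : ℤ) :
    ∃ f : K, ∀ P ∈ S, f - a P ∈ fil P N := by
  let M : ℕ := N.natAbs + ∑ P ∈ S, ∑ Q ∈ S, (ordAt P.1 (a Q)).natAbs
  have hM : ∀ P ∈ S, ∀ Q ∈ S, N ≤ M + ordAt P.1 (a Q) := by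
    intro P hP Q hQ
    have h1 : (ordAt P.1 (a Q)).natAbs ≤ ∑ Q ∈ S, (ordAt P.1 (a Q)).natAbs :=
      Finset.single_le_sum (f := fun Q => (ordAt P.1 (a Q)).natAbs) (fun _ _ => Nat.zero_le _) hQ
    have h2 := Finset.single_le_sum (f := fun P => ∑ Q ∈ S, (ordAt P.1 (a Q)).natAbs)
      (fun _ _ => Nat.zero_le _) hP
    change ∑ Q ∈ S, (ordAt P.1 (a Q)).natAbs ≤ _ at h2
    rw [Nat.cast_add]
    omega
  choose e he1 he2 using fun P : S => exists_idem S P.2 M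
  refine ⟨∑ P : S, a P.1 * e P, fun P hP => ?_⟩
  rw [← Finset.add_sum_erase _ _ (Finset.mem_univ (⟨P, hP⟩ : S)), add_sub_right_comm]
  refine add_mem ?_ (sum_mem fun Q hQ => ?_)
  · have : a P * e ⟨P, hP⟩ - a P = (e ⟨P, hP⟩ - 1) * a P := by ring
    rw [this]
    exact fil_mono (hM P hP P hP) (mul_mem_fil (he1 ⟨P, hP⟩) (mem_fil_of_le le_rfl))
  · rw [mul_comm]
    refine fil_mono (hM P hP Q.1 Q.2) (mul_mem_fil (he2 Q P hP ?_) (mem_fil_of_le le_rfl))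
    rintro rfl
    simp at hQ

theorem relIndex_fil_nat (n : ℕ) (m : ℤ) :
    (fil P (m + n)).relIndex (fil P m) = 2 ^ (n * placeDegree (ZMod 2) P) := by
  induction n with
  | zero => simp
  | succ n ih =>
    have h1 : fil P (m + n + 1) ≤ fil P (m + n) := fil_mono (by omega)
    have h2 : fil P (m + n) ≤ fil P m := fil_mono (by omega)
    push_cast
    rw [← add_assoc, ← AddSubgroup.relIndex_mul_relIndex _ _ _ h1 h2, ih, relIndex_fil]
    ring

theorem sum_zeros_le {x : K} {n : ℕ} (hx : HasDeg x n)
    (S : Finset (Place (ZMod 2) K)) (hS : ∀ P ∈ S, 0 ≤ ordAt P.1 x) :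
    ∑ P ∈ S, ordAt P.1 x * placeDegree (ZMod 2) P ≤ n := by
  let B : Subring K := ⨅ P : S, P.1.1.toSubring
  have memB : ∀ {y : K}, y ∈ B ↔ ∀ P : S, y ∈ P.1.1 := by
    intro y; simp only [B, Subring.mem_iInf]; rfl
  have hxB : x ∈ B := memB.mpr fun P => (ordAt_nonneg_iff P.1 x).mp (hS P.1 P.2)
  let M : ∀ P : S, Type := fun P => fil P.1 0 ⧸ (fil P.1 (ordAt P.1.1 x)).addSubgroupOf (fil P.1 0)
  let ι : ∀ P : S, B →+ fil P.1 0 := fun P =>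
    { toFun := fun y => ⟨y.1, mem_fil_zero.mpr (memB.mp y.2 P)⟩
      map_zero' := rfl
      map_add' := fun _ _ => rfl }
  let π : B →+ (∀ P : S, M P) := AddMonoidHom.mk' (fun y P => QuotientAddGroup.mk (ι P y))
    (fun a b => rfl)
  have hcard : ∀ P : S, Nat.card (M P) = 2 ^ ((ordAt P.1.1 x).toNat * placeDegree (ZMod 2) P.1) := by
    intro P
    have h := relIndex_fil_nat P.1 (ordAt P.1.1 x).toNat 0
    rw [zero_add, Int.toNat_of_nonneg (hS P.1 P.2)] at h
    exact h
  have hπ : Function.Surjective π := by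
    intro m
    choose c hc using fun P : S => QuotientAddGroup.mk_surjective (m P)
    obtain ⟨f, hf⟩ := approx S (fun P => if h : P ∈ S then (c ⟨P, h⟩ : K) else 0)
      (∑ P : S, (ordAt P.1.1 x))
    have hN : ∀ P : S, ordAt P.1.1 x ≤ ∑ P : S, (ordAt P.1.1 x) := fun P =>
      Finset.single_le_sum (f := fun P : S => ordAt P.1.1 x) (fun P _ => hS P.1 P.2)
        (Finset.mem_univ P)
    have hf' : ∀ P : S, f - c P ∈ fil P.1 (ordAt P.1.1 x) := by
      intro P
      have := hf P.1 P.2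
      rw [dif_pos P.2] at this
      exact fil_mono (hN P) this
    have hfB : f ∈ B := memB.mpr fun P => by
      rw [← mem_fil_zero, ← sub_add_cancel f (c P : K)]
      exact add_mem (fil_mono (hS P.1 P.2) (hf' P)) (c P).2
    refine ⟨⟨f, hfB⟩, funext fun P => ?_⟩
    rw [← hc P]
    refine (QuotientAddGroup.eq_iff_sub_mem).mpr ?_
    exact AddSubgroup.mem_addSubgroupOf.mpr (hf' P)
  obtain ⟨hfin, hle⟩ := hx.finite_of_surjective B hxB (M := ∀ P : S, M P) (fun m => by
      obtain ⟨y, rfl⟩ := hπ m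
      have : (2 : ℕ) • y = 0 := by
        apply Subtype.ext
        change (2 : ℕ) • (y : K) = 0
        rw [two_smul, CharTwo.add_self_eq_zero]
      rw [← map_nsmul, this, map_zero]) π hπ (fun y => by
      funext P
      refine (QuotientAddGroup.eq_zero_iff _).mpr ?_
      refine AddSubgroup.mem_addSubgroupOf.mpr ?_
      have := mul_mem_fil (P := P.1) (mem_fil_of_le (le_refl (ordAt P.1.1 x)))
        (mem_fil_zero.mpr (memB.mp y.2 P))
      rwa [add_zero] at this)
  rw [Nat.card_pi, Finset.prod_congr rfl (fun P _ => hcard P), Finset.prod_pow_eq_pow_sum,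
    Nat.pow_le_pow_iff_right one_lt_two] at hle
  rw [← Finset.sum_coe_sort S]
  calc _ = ((∑ P : S, (ordAt P.1.1 x).toNat * placeDegree (ZMod 2) P.1 : ℕ) : ℤ) := by
        push_cast
        exact Finset.sum_congr rfl fun P _ => by rw [Int.toNat_of_nonneg (hS P.1 P.2)]
    _ ≤ n := by exact_mod_cast hle

theorem finite_zeros {x : K} (hx0 : x ≠ 0) : {P : Place (ZMod 2) K | 0 < ordAt P.1 x}.Finite := by
  by_cases hx1 : x = 1
  · simp [hx1, ordAt_one]
  obtain ⟨n, hn⟩ := exists_deg hx0 hx1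
  by_contra h
  obtain ⟨S, hS, hcard⟩ := Set.Infinite.exists_subset_card_eq h (n + 1)
  have h1 := sum_zeros_le hn S fun P hP => le_of_lt (hS hP)
  have h2 : ∑ P ∈ S, (1 : ℤ) ≤ ∑ P ∈ S, ordAt P.1 x * placeDegree (ZMod 2) P := by
    refine Finset.sum_le_sum fun P hP => ?_
    have h3 : 0 < ordAt P.1 x := hS hP
    have h4 := placeDegree_pos P
    have : (1 : ℤ) ≤ placeDegree (ZMod 2) P := by exact_mod_cast h4
    nlinarith
  simp [hcard] at h2
  omega

theorem finite_ordAt_ne {x : K} (hx0 : x ≠ 0) :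
    {P : Place (ZMod 2) K | ordAt P.1 x ≠ 0}.Finite := by
  refine ((finite_zeros hx0).union (finite_zeros (inv_ne_zero hx0))).subset fun P hP => ?_
  simp only [Set.mem_union, Set.mem_ofPred_eq, ordAt_inv] at hP ⊢
  omega

end Approx
end CFF

namespace CFF

open Polynomial IsLocalRing

section Divisors

variable {K : Type} [Field K] [Algebra (ZMod 2) K]

variable (K) in
abbrev Div := Divisor (ZMod 2) K

def deg : Div K →+ ℤ := degHom (ZMod 2) K

/-- The prime divisor attached to a place. -/
abbrev pt (P : Place (ZMod 2) K) : Div K := Finsupp.single P 1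

abbrev pdeg (P : Place (ZMod 2) K) : ℕ := placeDegree (ZMod 2) P

theorem deg_eq_sum (D : Div K) : deg D = D.sum fun P m => m * (pdeg P : ℤ) := rfl

@[simp] theorem deg_single (P : Place (ZMod 2) K) (n : ℤ) :
    deg (Finsupp.single P n) = n * pdeg P := by
  rw [deg_eq_sum, Finsupp.sum_single_index (by simp)]

variable [FunctionFieldTwo K]

theorem exists_pole {x : K} (h0 : x ≠ 0) (h1 : x ≠ 1) : ∃ P : Place (ZMod 2) K, ordAt P.1 x < 0 := by
  let R : Subring K := (integralClosure (ZMod 2) K).toSubring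
  have hx : x ∉ R := fun h => transcendental_of_ne h0 h1 (IsIntegral.isAlgebraic h)
  have hR : IsIntegrallyClosedIn R K := inferInstanceAs (IsIntegrallyClosedIn (integralClosure (ZMod 2) K) K)
  obtain ⟨V, hV, hxV⟩ := Subring.exists_le_valuationSubring_of_isIntegrallyClosedIn hx
  have hconst : ∀ c : ZMod 2, algebraMap (ZMod 2) K c ∈ V := fun c => hV (by
    exact isIntegral_algebraMap)
  have hV : IsPlace (ZMod 2) K V := ⟨fun h => hxV (h ▸ ValuationSubring.mem_top x), hconst⟩
  let P : Place (ZMod 2) K := ⟨V, hV⟩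
  exact ⟨P, not_le.mp fun h => hxV ((ordAt_nonneg_iff P x).mp h)⟩

theorem eff_induction {motive : Div K → Prop} (zero : motive 0)
    (add : ∀ E P, 0 ≤ E → motive E → motive (E + pt P)) (E : Div K) (hE : 0 ≤ E) : motive E := by
  have key : ∀ (n : ℕ) (E : Div K), 0 ≤ E → (deg E).toNat = n → motive E := by
    intro n
    induction n using Nat.strong_induction_on with
    | _ n ih =>
      intro E hE hn
      by_cases h : E = 0
      · rw [h]; exact zero
      obtain ⟨P, hP⟩ := Finsupp.ne_iff.mp h
      have hP0 : 0 < E P := lt_of_le_of_ne (hE P) (Ne.symm hP)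
      have hE' : 0 ≤ E - pt P := by
        intro Q
        rw [Finsupp.sub_apply, Finsupp.single_apply]
        have := hE Q
        rw [Finsupp.coe_zero, Pi.zero_apply] at this ⊢
        split_ifs with hQ
        · subst hQ; omega
        · omega
      have hdeg : deg (E - pt P) = deg E - pdeg P := by rw [map_sub, deg_single, one_mul]
      have hpos : 0 < pdeg P := placeDegree_pos P
      have hnn : ∀ G : Div K, 0 ≤ G → 0 ≤ deg G := fun G hG =>
        Finset.sum_nonneg fun Q _ => mul_nonneg (hG Q) (Int.natCast_nonneg _)
      have h1 := hnn _ hE'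
      have := add _ P hE' (ih (deg (E - pt P)).toNat (by omega) _ hE' rfl)
      rwa [sub_add_cancel] at this
  exact key _ E hE rfl

theorem deg_nonneg {E : Div K} (hE : 0 ≤ E) : 0 ≤ deg E :=
  Finset.sum_nonneg fun Q _ => mul_nonneg (hE Q) (Int.natCast_nonneg _)

theorem deg_mono {D E : Div K} (h : D ≤ E) : deg D ≤ deg E := by
  have := deg_nonneg (sub_nonneg.mpr h)
  rw [map_sub] at this
  omega

theorem exists_pos_of_ne {E : Div K} (hE : 0 ≤ E) (h : E ≠ 0) : ∃ P, pt P ≤ E := by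
  revert h
  refine eff_induction (motive := fun E => E ≠ 0 → ∃ P, pt P ≤ E) (fun h => absurd rfl h)
    (fun E P hE _ _ => ⟨P, le_add_of_nonneg_left hE⟩) E hE

theorem eq_zero_of_deg {E : Div K} (hE : 0 ≤ E) (h : deg E ≤ 0) : E = 0 := by
  by_contra h0
  obtain ⟨P, hP⟩ := exists_pos_of_ne hE h0
  have h1 := deg_mono hP
  rw [deg_single] at h1
  have : 0 < pdeg P := placeDegree_pos P
  omega

/-- The principal divisor of a function (zero for the zero function). -/
def dv (f : K) : Div K := if h : f = 0 then 0 else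
  Finsupp.ofSupportFinite (fun P => ordAt P.1 f) (finite_ordAt_ne h)

theorem dv_apply (f : K) (P : Place (ZMod 2) K) : dv f P = ordAt P.1 f := by
  by_cases h : f = 0
  · simp [dv, h, ordAt_zero]
  · rw [dv, dif_neg h]; rfl

theorem dv_zero : dv (0 : K) = 0 := dif_pos rfl

@[simp] theorem dv_one : dv (1 : K) = 0 := by
  ext P; rw [dv_apply, ordAt_one]; rfl

theorem dv_mul {f g : K} (hf : f ≠ 0) (hg : g ≠ 0) : dv (f * g) = dv f + dv g := by
  ext P; rw [Finsupp.add_apply, dv_apply, dv_apply, dv_apply, ordAt_mul P hf hg]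

theorem dv_inv (f : K) : dv f⁻¹ = - dv f := by
  ext P; rw [Finsupp.neg_apply, dv_apply, dv_apply, ordAt_inv]

theorem dv_div {f g : K} (hf : f ≠ 0) (hg : g ≠ 0) : dv (f / g) = dv f - dv g := by
  ext P; rw [Finsupp.sub_apply, dv_apply, dv_apply, dv_apply, ordAt_div P hf hg]

theorem dv_pow (f : K) (n : ℕ) : dv (f ^ n) = n • dv f := by
  ext P; rw [Finsupp.smul_apply, dv_apply, dv_apply, ordAt_pow]; simp

/-- The Riemann–Roch space as an additive subgroup. -/
def L (D : Div K) : AddSubgroup K := ⨅ P : Place (ZMod 2) K, fil P (-D P)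

theorem mem_L {D : Div K} {f : K} : f ∈ L D ↔ ∀ P, f ∈ fil P (-D P) := by
  simp [L, AddSubgroup.mem_iInf]

theorem mem_L_of_ne {D : Div K} {f : K} (hf : f ≠ 0) : f ∈ L D ↔ 0 ≤ D + dv f := by
  rw [mem_L]
  refine forall_congr' fun P => ?_
  rw [mem_fil_of_ne hf, Finsupp.add_apply, dv_apply, Finsupp.coe_zero, Pi.zero_apply]
  omega

theorem mem_L_neg_dv {f : K} : f ∈ L (-dv f) := by
  by_cases hf : f = 0
  · rw [hf]; exact zero_mem _
  · rw [mem_L_of_ne hf, neg_add_cancel]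

theorem L_mono {D E : Div K} (h : D ≤ E) : L D ≤ L E := fun _ hf =>
  mem_L.mpr fun P => fil_mono (neg_le_neg (h P)) (mem_L.mp hf P)

theorem mul_mem_L {D E : Div K} {f g : K} (hf : f ∈ L D) (hg : g ∈ L E) : f * g ∈ L (D + E) :=
  mem_L.mpr fun P => by
    have := mul_mem_fil (mem_L.mp hf P) (mem_L.mp hg P)
    rwa [Finsupp.add_apply, neg_add]

theorem pow_mem_L {D : Div K} {f : K} (hf : f ∈ L D) (n : ℕ) : f ^ n ∈ L (n • D) :=
  mem_L.mpr fun P => by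
    have := pow_mem_fil (mem_L.mp hf P) n
    simpa using this

theorem one_mem_L {D : Div K} (h : 0 ≤ D) : (1 : K) ∈ L D :=
  (mem_L_of_ne one_ne_zero).mpr (by rwa [dv_one, add_zero])

theorem mem_L_zero {f : K} : f ∈ L (0 : Div K) ↔ f = 0 ∨ f = 1 := by
  refine ⟨fun h => ?_, ?_⟩
  · by_contra! h1
    obtain ⟨P, hP⟩ := exists_pole h1.1 h1.2
    have := (mem_L_of_ne h1.1).mp h P
    rw [zero_add, dv_apply, Finsupp.coe_zero, Pi.zero_apply] at this
    omega
  · rintro (rfl | rfl)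
    · exact zero_mem _
    · exact one_mem_L le_rfl

theorem L_inf_fil (D : Div K) (P : Place (ZMod 2) K) (n : ℕ) :
    L D ⊓ fil P (-D P + n) = L (D - Finsupp.single P (n : ℤ)) := by
  ext f
  rw [AddSubgroup.mem_inf, mem_L, mem_L]
  refine ⟨fun ⟨h1, h2⟩ Q => ?_, fun h => ⟨fun Q => fil_mono ?_ (h Q), ?_⟩⟩
  · rw [Finsupp.sub_apply, Finsupp.single_apply]
    split_ifs with hQ
    · subst hQ; convert h2 using 2; ring
    · rw [sub_zero]; exact h1 Q
  · rw [Finsupp.sub_apply, Finsupp.single_apply]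
    split_ifs <;> omega
  · convert h P using 2
    rw [Finsupp.sub_apply, Finsupp.single_eq_same]; ring

theorem L_add_pt_inf (D : Div K) (P : Place (ZMod 2) K) :
    L (D + pt P) ⊓ fil P (-(D + pt P) P + 1) = L D := by
  have := L_inf_fil (D + pt P) P 1
  simpa using this

theorem L_le_fil (D : Div K) (P : Place (ZMod 2) K) : L D ≤ fil P (-D P) := fun _ hf => mem_L.mp hf P

theorem card_L_add_pt_le (D : Div K) (P : Place (ZMod 2) K) :
    Nat.card (L (D + pt P)) ≤ Nat.card (L D) * 2 ^ pdeg P := by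
  rw [card_eq_card_inf_mul (L (D + pt P)) (fil P (-(D + pt P) P + 1)), L_add_pt_inf]
  exact Nat.mul_le_mul_left _ (relIndex_fil_le P (L_le_fil _ P))

theorem card_L_add_pt_ne_zero (D : Div K) (P : Place (ZMod 2) K) (h : Nat.card (L D) ≠ 0) :
    Nat.card (L (D + pt P)) ≠ 0 := by
  rw [card_eq_card_inf_mul (L (D + pt P)) (fil P (-(D + pt P) P + 1)), L_add_pt_inf]
  exact mul_ne_zero h (relIndex_fil_ne_zero P (L_le_fil _ P))

theorem card_L_zero : Nat.card (L (0 : Div K)) = 2 := by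
  have : (L (0 : Div K) : Set K) = {0, 1} := by
    ext f; simp [mem_L_zero]
  change Nat.card ((L (0 : Div K) : Set K)) = 2
  rw [this, Nat.card_coe_set_eq, Set.ncard_pair zero_ne_one]

theorem card_L_eff {E : Div K} (hE : 0 ≤ E) :
    Nat.card (L E) ≠ 0 ∧ Nat.card (L E) ≤ 2 ^ (deg E + 1).toNat := by
  refine eff_induction (motive := fun E => Nat.card (L E) ≠ 0 ∧
    Nat.card (L E) ≤ 2 ^ (deg E + 1).toNat) ?_ (fun E P hE ih => ?_) E hE
  · simp [card_L_zero]
  · refine ⟨card_L_add_pt_ne_zero E P ih.1, (card_L_add_pt_le E P).trans ?_⟩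
    refine (Nat.mul_le_mul_right _ ih.2).trans ?_
    rw [← pow_add]
    refine Nat.pow_le_pow_right two_pos ?_
    have := deg_nonneg hE
    rw [map_add, deg_single]
    omega

instance finite_L (D : Div K) : Finite (L D) := by
  have h0 := (card_L_eff (E := D ⊔ 0) le_sup_right).1
  have : Finite (L (D ⊔ 0)) := Nat.finite_of_card_ne_zero h0
  exact Finite.Set.subset (L (D ⊔ 0) : Set K) (L_mono le_sup_left)

theorem card_L (D : Div K) : Nat.card (L D) = 2 ^ ell (ZMod 2) D := by
  have h : ((RRspace (ZMod 2) D : Submodule (ZMod 2) K) : Set K) = L D := by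
    let LS : Submodule (ZMod 2) K :=
      { (L D).toAddSubmonoid with
        smul_mem' := fun c x hx => by
          rcases zmod_two_cases c with rfl | rfl
          · rw [zero_smul]; exact zero_mem (L D)
          · rw [one_smul]; exact hx }
    have : RRspace (ZMod 2) D = LS := by
      refine le_antisymm (Submodule.span_le.mpr fun f hf => ?_) fun f hf => ?_
      · exact mem_L.mpr fun P => mem_fil_of_le (by have := hf P; omega)
      · by_cases h0 : f = 0
        · rw [h0]; exact zero_mem _
        · refine Submodule.subset_span fun P => ?_
          have := (mem_fil_of_ne h0).mp (mem_L.mp hf P)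
          omega
    rw [this]; rfl
  have hfin : Finite (RRspace (ZMod 2) D) := by
    change Finite ((RRspace (ZMod 2) D : Submodule (ZMod 2) K) : Set K)
    rw [h]; exact finite_L D
  have h2 := Module.natCard_eq_pow_finrank (K := ZMod 2) (V := RRspace (ZMod 2) D)
  rw [Nat.card_zmod] at h2
  rw [ell, ← h2]
  change Nat.card ((L D : Set K)) = Nat.card ((RRspace (ZMod 2) D : Submodule (ZMod 2) K) : Set K)
  rw [h]

end Divisors
end CFF

namespace CFF

open Polynomial IsLocalRing

section Degrees

variable {K : Type} [Field K] [Algebra (ZMod 2) K] [FunctionFieldTwo K]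

theorem posPart_apply (D : Div K) (P : Place (ZMod 2) K) : D⁺ P = max (D P) 0 := rfl

theorem deg_posPart_dv_le {x : K} {n : ℕ} (hx : HasDeg x n) : deg (dv x)⁺ ≤ n := by
  refine le_trans (le_of_eq ?_) (sum_zeros_le hx ((dv x)⁺).support fun P hP => ?_)
  · rw [deg_eq_sum, Finsupp.sum]
    refine Finset.sum_congr rfl fun P hP => ?_
    rw [Finsupp.mem_support_iff, posPart_apply, dv_apply] at hP
    rw [posPart_apply, dv_apply, max_eq_left (by omega)]
  · rw [Finsupp.mem_support_iff, posPart_apply, dv_apply] at hP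
    omega

theorem deg_negPart_dv_le {x : K} {n : ℕ} (hx : HasDeg x n) : deg (dv x)⁻ ≤ n := by
  have := deg_posPart_dv_le hx.inv
  rwa [dv_inv, posPart_neg] at this

theorem mem_L_negPart (x : K) : x ∈ L (dv x)⁻ :=
  L_mono (neg_le_negPart _) mem_L_neg_dv

theorem poly_mem_L {x : K} {B : Div K} (hB : 0 ≤ B) (hx : x ∈ L B) (l : ℕ) {p : (ZMod 2)[X]}
    (hp : p.natDegree ≤ l) : aeval x p ∈ L (l • B) := by
  rw [aeval_eq_sum_range' (n := l + 1) (by omega)]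
  refine sum_mem fun i hi => ?_
  have h1 : x ^ i ∈ L (l • B) := L_mono (nsmul_le_nsmul_left hB (by
    have := Finset.mem_range.mp hi; omega)) (pow_mem_L hx i)
  rcases zmod_two_cases (p.coeff i) with h | h <;> rw [h]
  · rw [zero_smul]; exact zero_mem _
  · rwa [one_smul]

theorem exists_eff_mem {ι : Type} [Fintype ι] (u : ι → K) : ∃ C : Div K, 0 ≤ C ∧ ∀ i, u i ∈ L C := by
  refine ⟨∑ i, (dv (u i))⁻, Finset.sum_nonneg fun i _ => negPart_nonneg _, fun i => ?_⟩
  exact L_mono (Finset.single_le_sum (f := fun i => (dv (u i))⁻) (fun i _ => negPart_nonneg _)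
    (Finset.mem_univ i)) (mem_L_negPart (u i))

theorem le_deg_negPart {x : K} {n : ℕ} (hx : HasDeg x n) : (n : ℤ) ≤ deg (dv x)⁻ := by
  obtain ⟨u, hu⟩ := hx.ex
  obtain ⟨C, hC, huC⟩ := exists_eff_mem u
  set B := (dv x)⁻ with hBdef
  have hB : 0 ≤ B := negPart_nonneg _
  have key : ∀ l : ℕ, (n : ℤ) * (l + 1) ≤ l * deg B + deg C + 1 := by
    intro l
    let φ : (Fin n → degreeLT (ZMod 2) (l + 1)) → L (l • B + C) := fun p =>
      ⟨∑ i, aeval x (p i : (ZMod 2)[X]) * u i, sum_mem fun i _ => mul_mem_L (poly_mem_L hB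
        (mem_L_negPart x) l (by
          have := mem_degreeLT.mp (p i).2
          rw [← Nat.lt_succ_iff]
          by_cases h0 : (p i : (ZMod 2)[X]) = 0
          · rw [h0]; simp
          · exact (natDegree_lt_iff_degree_lt h0).mpr this)) (huC i)⟩
    have hφ : Function.Injective φ := by
      intro p q hpq
      have h1 : ∑ i, aeval x (p i : (ZMod 2)[X]) * u i = ∑ i, aeval x (q i : (ZMod 2)[X]) * u i :=
        congrArg Subtype.val hpq
      have h2 := hu (fun i => (p i : (ZMod 2)[X]) - q i) (by
        simp only [map_sub, sub_mul, Finset.sum_sub_distrib, h1, sub_self])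
      funext i
      apply Subtype.ext
      have := congrFun h2 i
      exact sub_eq_zero.mp this
    have hc := Nat.card_le_card_of_injective φ hφ
    have h3 : Nat.card (degreeLT (ZMod 2) (l + 1)) = 2 ^ (l + 1) := by
      rw [Nat.card_congr (degreeLTEquiv (ZMod 2) (l + 1)).toEquiv]
      simp
    have hnn : 0 ≤ l • B + C := add_nonneg (nsmul_nonneg hB l) hC
    have h4 := hc.trans (card_L_eff hnn).2
    rw [Nat.card_fun, h3, Nat.card_fin, ← pow_mul, Nat.pow_le_pow_iff_right one_lt_two] at h4
    have h5 := deg_nonneg hnn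
    have h6 : deg (l • B + C) = l * deg B + deg C := by rw [map_add, map_nsmul]; simp
    zify at h4
    rw [Int.toNat_of_nonneg (by omega), h6] at h4
    linarith
  by_contra! h
  have h1 := key (deg C + 1).toNat
  have h2 := deg_nonneg hC
  rw [Int.toNat_of_nonneg (by omega)] at h1
  have h3 := deg_nonneg hB
  have h4 : (deg B + 1) * (deg C + 1 + 1) ≤ n * (deg C + 1 + 1) :=
    mul_le_mul_of_nonneg_right (by omega) (by omega)
  linarith

theorem HasDeg.deg_poles {x : K} {n : ℕ} (hx : HasDeg x n) : deg (dv x)⁻ = n :=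
  le_antisymm (deg_negPart_dv_le hx) (le_deg_negPart hx)

theorem HasDeg.deg_zeros {x : K} {n : ℕ} (hx : HasDeg x n) : deg (dv x)⁺ = n := by
  have := hx.inv.deg_poles
  rwa [dv_inv, negPart_neg] at this

@[simp] theorem deg_dv (x : K) : deg (dv x) = 0 := by
  by_cases h0 : x = 0
  · rw [h0, dv_zero, map_zero]
  by_cases h1 : x = 1
  · rw [h1, dv_one, map_zero]
  obtain ⟨n, hn⟩ := exists_deg h0 h1
  rw [← posPart_sub_negPart (dv x), map_sub, hn.deg_poles, hn.deg_zeros, sub_self]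

theorem eq_zero_of_mem_L {D : Div K} (hD : deg D < 0) {f : K} (hf : f ∈ L D) : f = 0 := by
  by_contra h
  have := deg_nonneg ((mem_L_of_ne h).mp hf)
  rw [map_add, deg_dv] at this
  omega

theorem L_eq_bot {D : Div K} (hD : deg D < 0) : L D = ⊥ :=
  (AddSubgroup.eq_bot_iff_forall _).mpr fun _ hf => eq_zero_of_mem_L hD hf

theorem dv_injective {f g : K} (hf : f ≠ 0) (hg : g ≠ 0) (h : dv f = dv g) : f = g := by
  have h1 : f / g ∈ L (0 : Div K) := by
    rw [mem_L_of_ne (div_ne_zero hf hg), dv_div hf hg, h, sub_self, add_zero]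
  rcases mem_L_zero.mp h1 with h1 | h1
  · exact absurd h1 (div_ne_zero hf hg)
  · rwa [div_eq_one_iff_eq hg] at h1

theorem card_L_add_dv (D : Div K) {f : K} (h0 : f ≠ 0) :
    Nat.card (L (D + dv f)) = Nat.card (L D) := by
  refine (Nat.card_congr (α := L D) ?_).symm
  exact
      { toFun := fun g => ⟨g * f⁻¹, by
          have := mul_mem_L g.2 (mem_L_neg_dv (f := f⁻¹))
          rwa [dv_inv, neg_neg] at this⟩
        invFun := fun g => ⟨g * f, by
          have := mul_mem_L g.2 (mem_L_neg_dv (f := f))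
          rwa [add_neg_cancel_right] at this⟩
        left_inv := fun g => Subtype.ext (by simp [h0])
        right_inv := fun g => Subtype.ext (by simp [h0]) }

theorem ell_add_dv (D : Div K) {f : K} (h0 : f ≠ 0) :
    ell (ZMod 2) (D + dv f) = ell (ZMod 2) D := by
  have := card_L_add_dv D h0
  rw [card_L, card_L] at this
  exact Nat.pow_right_injective le_rfl this

end Degrees
end CFF

namespace CFF

open Polynomial IsLocalRing

section ClassOne

variable (K : Type) [Field K] [Algebra (ZMod 2) K]

/-- Function fields over `𝔽₂` of genus `4` and class number one. -/
class GenusFour : Prop extends FunctionFieldTwo K where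
  genus_eq : genus (ZMod 2) K = 4
  classNumber_eq : classNumber (ZMod 2) K = 1

variable {K} [GenusFour K]

theorem exists_dv_eq {D : Div K} (hD : deg D = 0) : ∃ f : K, f ≠ 0 ∧ dv f = D := by
  have h1 : D ∈ zeroDivisors (ZMod 2) K := hD
  have h2 : ((principalDivisors (ZMod 2) K).addSubgroupOf (zeroDivisors (ZMod 2) K)).index = 1 :=
    GenusFour.classNumber_eq (K := K)
  rw [AddSubgroup.index_eq_one] at h2
  have h3 : D ∈ principalDivisors (ZMod 2) K := by
    have : (⟨D, h1⟩ : zeroDivisors (ZMod 2) K) ∈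
      (principalDivisors (ZMod 2) K).addSubgroupOf (zeroDivisors (ZMod 2) K) := by
        rw [h2]; trivial
    exact this
  refine AddSubgroup.closure_induction (p := fun D _ => ∃ f : K, f ≠ 0 ∧ dv f = D)
    ?_ ?_ ?_ ?_ h3
  · rintro D ⟨f, hf, h⟩
    exact ⟨f, hf, Finsupp.ext fun P => by rw [dv_apply, h]⟩
  · exact ⟨1, one_ne_zero, dv_one⟩
  · rintro _ _ _ _ ⟨f, hf, rfl⟩ ⟨g, hg, rfl⟩
    exact ⟨f * g, mul_ne_zero hf hg, dv_mul hf hg⟩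
  · rintro _ _ ⟨f, hf, rfl⟩
    exact ⟨f⁻¹, inv_ne_zero hf, dv_inv f⟩

theorem genus_set_bdd : BddAbove {g : ℕ | ∃ D : Div K, (g : ℤ) = deg D + 1 - ell (ZMod 2) D} := by
  by_contra h
  have h1 : genus (ZMod 2) K = 0 := Nat.sSup_of_not_bddAbove h
  rw [GenusFour.genus_eq] at h1
  omega

theorem riemann (D : Div K) : deg D ≤ ell (ZMod 2) D + 3 := by
  by_contra! h
  have h1 : (deg D + 1 - ell (ZMod 2) D).toNat ≤ genus (ZMod 2) K :=
    le_csSup genus_set_bdd ⟨D, by change _ = deg D + 1 - _; omega⟩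
  rw [GenusFour.genus_eq] at h1
  omega

variable (K) in
theorem exists_riemann_eq : ∃ D : Div K, deg D = ell (ZMod 2) D + 3 := by
  have h : genus (ZMod 2) K ∈ {g : ℕ | ∃ D : Div K, (g : ℤ) = deg D + 1 - ell (ZMod 2) D} := by
    refine Nat.sSup_mem ?_ genus_set_bdd
    by_contra h
    rw [Set.not_nonempty_iff_eq_empty] at h
    have h1 : genus (ZMod 2) K = sSup ∅ := congrArg sSup h
    rw [GenusFour.genus_eq, csSup_empty] at h1
    exact absurd h1 (by norm_num)
  obtain ⟨D, hD⟩ := h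
  rw [GenusFour.genus_eq] at hD
  change _ = deg D + 1 - _ at hD
  exact ⟨D, by push_cast at hD; omega⟩

end ClassOne

theorem relIndex_modular {V : Type*} [AddCommGroup V] {X Y : AddSubgroup V} (h : X ≤ Y)
    (Z : AddSubgroup V) :
    X.relIndex Y = (X ⊔ Z).relIndex (Y ⊔ Z) * (X ⊓ Z).relIndex (Y ⊓ Z) := by
  have h1 : X ≤ X ⊔ Y ⊓ Z := le_sup_left
  have h2 : X ⊔ Y ⊓ Z ≤ Y := sup_le h inf_le_left
  have h3 : X ⊔ Y ⊓ Z = (X ⊔ Z) ⊓ Y := by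
    rw [inf_comm Y Z]; exact (sup_inf_assoc_of_le Z h).symm
  have h4 : X ⊓ (Y ⊓ Z) = X ⊓ Z := by rw [← inf_assoc, inf_eq_left.mpr h]
  have h5 : Y ⊔ Z = Y ⊔ (X ⊔ Z) := by rw [← sup_assoc, sup_eq_left.mpr h]
  rw [← AddSubgroup.relIndex_mul_relIndex _ _ _ h1 h2, mul_comm]
  congr 1
  · rw [h3, AddSubgroup.inf_relIndex_right, h5, AddSubgroup.relIndex_sup_right]
  · rw [sup_comm, AddSubgroup.relIndex_sup_right, ← AddSubgroup.inf_relIndex_right, h4]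

section Adeles

variable {K : Type} [Field K] [Algebra (ZMod 2) K] [FunctionFieldTwo K]

/-- Adeles bounded by a divisor. -/
def AD (D : Div K) : AddSubgroup (Place (ZMod 2) K → K) :=
  AddSubgroup.pi Set.univ fun P => fil P (-D P)

theorem mem_AD {D : Div K} {α : Place (ZMod 2) K → K} : α ∈ AD D ↔ ∀ P, α P ∈ fil P (-D P) := by
  simp [AD, AddSubgroup.mem_pi]

theorem AD_mono {D E : Div K} (h : D ≤ E) : AD D ≤ AD E := fun _ hα =>
  mem_AD.mpr fun P => fil_mono (neg_le_neg (h P)) (mem_AD.mp hα P)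

/-- The constant adeles. -/
def diag : K →+ (Place (ZMod 2) K → K) := Pi.constAddMonoidHom _ _

@[simp] theorem diag_apply (x : K) (P : Place (ZMod 2) K) : diag x P = x := rfl

theorem diag_mem_AD {D : Div K} {x : K} : diag x ∈ AD D ↔ x ∈ L D := by
  rw [mem_AD, mem_L]; rfl

theorem relIndex_AD_pt (D : Div K) (P : Place (ZMod 2) K) :
    (AD D).relIndex (AD (D + pt P)) = 2 ^ pdeg P := by
  let ev : (Place (ZMod 2) K → K) →+ K := Pi.evalAddMonoidHom _ P
  have h1 : AD D = (fil P (-D P)).comap ev ⊓ AD (D + pt P) := by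
    ext α
    rw [AddSubgroup.mem_inf, AddSubgroup.mem_comap, mem_AD, mem_AD]
    refine ⟨fun h => ⟨h P, fun Q => fil_mono ?_ (h Q)⟩, fun ⟨h1, h2⟩ Q => ?_⟩
    · rw [Finsupp.add_apply, Finsupp.single_apply]; split_ifs <;> omega
    · by_cases hQ : P = Q
      · subst hQ; exact h1
      · have := h2 Q
        rwa [Finsupp.add_apply, Finsupp.single_apply, if_neg hQ, add_zero] at this
  have h2 : (AD (D + pt P)).map ev = fil P (-D P - 1) := by
    ext f
    rw [AddSubgroup.mem_map]
    constructor
    · rintro ⟨α, hα, rfl⟩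
      have := mem_AD.mp hα P
      rw [Finsupp.add_apply, Finsupp.single_eq_same, neg_add] at this
      exact this
    · intro hf
      refine ⟨Pi.single P f, mem_AD.mpr fun Q => ?_,
        Pi.single_eq_same (M := fun _ : Place (ZMod 2) K => K) P f⟩
      by_cases hQ : Q = P
      · subst hQ
        rw [Finsupp.add_apply, Finsupp.single_eq_same, neg_add, Pi.single_eq_same]
        exact hf
      · rw [Pi.single_eq_of_ne hQ]; exact zero_mem _
  rw [h1, AddSubgroup.inf_relIndex_right, AddSubgroup.relIndex_comap, h2]
  have := relIndex_fil P (-D P - 1)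
  rwa [sub_add_cancel] at this

theorem relIndex_AD {D E : Div K} (h : D ≤ E) :
    (AD D).relIndex (AD E) = 2 ^ (deg E - deg D).toNat := by
  have := eff_induction (motive := fun G => (AD D).relIndex (AD (D + G)) = 2 ^ (deg G).toNat)
    (by simp) (fun G P hG ih => ?_) (E - D) (sub_nonneg.mpr h)
  · rwa [add_sub_cancel, map_sub] at this
  · have h1 : AD D ≤ AD (D + G) := AD_mono (le_add_of_nonneg_right hG)
    have h2 : AD (D + G) ≤ AD (D + G + pt P) := AD_mono (le_add_of_nonneg_right (by simp))
    rw [← add_assoc, ← AddSubgroup.relIndex_mul_relIndex _ _ _ h1 h2, ih, relIndex_AD_pt,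
      ← pow_add, map_add, deg_single]
    have := deg_nonneg hG
    congr 1; omega

theorem AD_inf_diag (D : Div K) : AD D ⊓ diag.range = (L D).map diag := by
  ext α
  rw [AddSubgroup.mem_inf, AddSubgroup.mem_map]
  constructor
  · rintro ⟨h, x, rfl⟩; exact ⟨x, diag_mem_AD.mp h, rfl⟩
  · rintro ⟨x, hx, rfl⟩; exact ⟨diag_mem_AD.mpr hx, x, rfl⟩

theorem diag_injective : Function.Injective (diag : K →+ (Place (ZMod 2) K → K)) := by
  obtain ⟨P, -⟩ : ∃ P : Place (ZMod 2) K, True := by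
    obtain ⟨x, hx, -⟩ := FunctionFieldTwo.ff (K := K)
    obtain ⟨P, -⟩ := exists_pole (x := x) (by rintro rfl; exact hx isAlgebraic_zero)
      (by rintro rfl; exact hx isAlgebraic_one)
    exact ⟨P, trivial⟩
  exact fun x y h => congrFun h P

theorem relIndex_L {D E : Div K} (h : D ≤ E) :
    2 ^ ell (ZMod 2) D * (L D).relIndex (L E) = 2 ^ ell (ZMod 2) E := by
  rw [← card_L, ← card_L, card_eq_card_inf_mul (L E) (L D), inf_eq_right.mpr (L_mono h)]

theorem relIndex_AD_sup {D E : Div K} (h : D ≤ E) :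
    (AD D ⊔ diag.range).relIndex (AD E ⊔ diag.range) * 2 ^ ell (ZMod 2) E =
      2 ^ (deg E - deg D).toNat * 2 ^ ell (ZMod 2) D := by
  rw [← relIndex_AD h, relIndex_modular (AD_mono h) diag.range, AD_inf_diag, AD_inf_diag,
    AddSubgroup.relIndex_map_map_of_injective _ _ diag_injective, ← relIndex_L h]
  ring

/-- The adele space. -/
def adele : Submodule K (Place (ZMod 2) K → K) where
  carrier := {α | ∃ D : Div K, α ∈ AD D}
  zero_mem' := ⟨0, zero_mem _⟩
  add_mem' := by
    rintro α β ⟨D, hD⟩ ⟨E, hE⟩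
    exact ⟨D ⊔ E, add_mem (AD_mono le_sup_left hD) (AD_mono le_sup_right hE)⟩
  smul_mem' := by
    rintro f α ⟨D, hD⟩
    refine ⟨D - dv f, mem_AD.mpr fun P => ?_⟩
    have := mul_mem_fil (mem_fil_of_le (P := P) (le_refl (ordAt P.1 f))) (mem_AD.mp hD P)
    rwa [Finsupp.sub_apply, dv_apply, neg_sub, sub_eq_add_neg]

end Adeles
end CFF

namespace CFF

theorem card_addMonoidHom_zmod_two {Q : Type*} [AddCommGroup Q] [Finite Q]
    (h2 : ∀ q : Q, 2 • q = 0) : Nat.card (Q →+ ZMod 2) = Nat.card Q := by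
  let _ : Module (ZMod 2) Q := AddCommGroup.zmodModule h2
  have e : (Q →+ ZMod 2) ≃ (Module.Dual (ZMod 2) Q) :=
    { toFun := fun f => f.toZModLinearMap 2
      invFun := fun f => f.toAddMonoidHom
      left_inv := fun f => by ext; rfl
      right_inv := fun f => by ext; rfl }
  have : Finite (Module.Dual (ZMod 2) Q) := by
    have : Finite (Q →+ ZMod 2) := Finite.of_injective _ DFunLike.coe_injective
    exact Finite.of_equiv _ e
  rw [Nat.card_congr e, Module.natCard_eq_pow_finrank (K := ZMod 2) (V := Q),
    Module.natCard_eq_pow_finrank (K := ZMod 2) (V := Module.Dual (ZMod 2) Q),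
    Subspace.dual_finrank_eq]

theorem exists_nonconst (K : Type) [Field K] [Algebra (ZMod 2) K] [FunctionFieldTwo K] :
    ∃ x : K, x ≠ 0 ∧ x ≠ 1 := by
  obtain ⟨x, hx, -⟩ := FunctionFieldTwo.ff (K := K)
  exact ⟨x, by rintro rfl; exact hx isAlgebraic_zero, by rintro rfl; exact hx isAlgebraic_one⟩

section Differentials

variable {K : Type} [Field K] [Algebra (ZMod 2) K] [GenusFour K]

variable (K) in
theorem exists_saturated : ∃ D₀ : Div K, ∀ E, D₀ ≤ E →
    AD E ⊔ diag.range = AD D₀ ⊔ diag.range ∧ deg E = ell (ZMod 2) E + 3 := by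
  obtain ⟨D₀, h₀⟩ := exists_riemann_eq K
  refine ⟨D₀, fun E hE => ?_⟩
  have h1 := relIndex_AD_sup hE
  have h2 := riemann E
  have h3 := deg_mono hE
  rw [← pow_add] at h1
  have h4 : (AD D₀ ⊔ diag.range).relIndex (AD E ⊔ diag.range) ≠ 0 := by
    intro h; rw [h, zero_mul] at h1; exact absurd h1.symm (by positivity)
  have h5 : 2 ^ ell (ZMod 2) E ≤ 2 ^ ((deg E - deg D₀).toNat + ell (ZMod 2) D₀) := by
    rw [← h1]; exact Nat.le_mul_of_pos_left _ (Nat.pos_of_ne_zero h4)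
  rw [Nat.pow_le_pow_iff_right one_lt_two] at h5
  have h6 : (deg E - deg D₀).toNat + ell (ZMod 2) D₀ = ell (ZMod 2) E := by omega
  rw [h6] at h1
  have h7 := Nat.eq_of_mul_eq_mul_right (by positivity) (h1.trans (one_mul _).symm)
  rw [AddSubgroup.relIndex_eq_one] at h7
  exact ⟨le_antisymm h7 (sup_le_sup_right (AD_mono hE) _), by omega⟩

theorem adele_eq {D₀ : Div K} (h : ∀ E, D₀ ≤ E → AD E ⊔ diag.range = AD D₀ ⊔ diag.range) :
    (adele (K := K)).toAddSubgroup = AD D₀ ⊔ diag.range := by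
  refine le_antisymm ?_ (sup_le (fun α hα => ⟨D₀, hα⟩) ?_)
  · rintro α ⟨D, hD⟩
    rw [← h (D ⊔ D₀) le_sup_right]
    exact AddSubgroup.mem_sup_left (AD_mono le_sup_left hD)
  · rintro _ ⟨x, rfl⟩
    exact ⟨(dv x)⁻, diag_mem_AD.mpr (mem_L_negPart x)⟩

theorem relIndex_adele (D : Div K) :
    (AD D ⊔ diag.range).relIndex (adele (K := K)).toAddSubgroup =
      2 ^ (ell (ZMod 2) D - deg D + 3).toNat := by
  obtain ⟨D₀, h₀⟩ := exists_saturated K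
  have h1 := relIndex_AD_sup (D := D) (E := D ⊔ D₀) le_sup_left
  obtain ⟨h2, h3⟩ := h₀ (D ⊔ D₀) le_sup_right
  rw [adele_eq fun E hE => (h₀ E hE).1, ← h2]
  have h4 := riemann D
  have h5 := deg_mono (D := D) (E := D ⊔ D₀) le_sup_left
  refine Nat.eq_of_mul_eq_mul_right (show 0 < 2 ^ ell (ZMod 2) (D ⊔ D₀) by positivity) ?_
  rw [h1, ← pow_add, ← pow_add]
  congr 1; omega

abbrev Functional (K : Type) [Field K] [Algebra (ZMod 2) K] [FunctionFieldTwo K] :=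
  (adele (K := K)) →+ ZMod 2

/-- Weil differentials bounded by `D`. -/
def Om (D : Div K) : AddSubgroup (Functional K) where
  carrier := {w | ∀ α : adele (K := K), (α : Place (ZMod 2) K → K) ∈ AD D ⊔ diag.range → w α = 0}
  zero_mem' := fun _ _ => rfl
  add_mem' := fun {a b} ha hb α h => by rw [AddMonoidHom.add_apply, ha α h, hb α h, add_zero]
  neg_mem' := fun {a} ha α h => by rw [AddMonoidHom.neg_apply, ha α h, neg_zero]

theorem card_Om (D : Div K) : Nat.card (Om D) = 2 ^ (ell (ZMod 2) D - deg D + 3).toNat := by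
  let U : AddSubgroup (adele (K := K)) :=
    (AD D ⊔ diag.range).addSubgroupOf (adele (K := K)).toAddSubgroup
  have hU : Nat.card (adele (K := K) ⧸ U) = 2 ^ (ell (ZMod 2) D - deg D + 3).toNat :=
    relIndex_adele D
  have : Finite (adele (K := K) ⧸ U) := Nat.finite_of_card_ne_zero (by rw [hU]; positivity)
  rw [← hU, ← card_addMonoidHom_zmod_two (Q := adele (K := K) ⧸ U) (fun q => by
    obtain ⟨α, rfl⟩ := QuotientAddGroup.mk_surjective q
    have : (2 : ℕ) • α = 0 := by
      ext P
      change (2 : ℕ) • (α.1 P) = 0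
      rw [two_smul, CharTwo.add_self_eq_zero]
    rw [← QuotientAddGroup.mk_nsmul, this, QuotientAddGroup.mk_zero])]
  refine Nat.card_congr
    { toFun := fun w => QuotientAddGroup.lift U w.1 fun α hα => w.2 α hα
      invFun := fun v => ⟨v.comp (QuotientAddGroup.mk' U), fun α hα => ?_⟩
      left_inv := fun w => Subtype.ext (by ext; rfl)
      right_inv := fun v => by ext; rfl }
  have : (QuotientAddGroup.mk' U) α = 0 := (QuotientAddGroup.eq_zero_iff α).mpr hα
  rw [AddMonoidHom.comp_apply, this, map_zero]

theorem Om_anti {D E : Div K} (h : D ≤ E) : Om E ≤ Om D := fun _ hw α hα =>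
  hw α (sup_le_sup_right (AD_mono h) _ hα)

theorem Om_sup {D E : Div K} {w : Functional K} (hD : w ∈ Om D) (hE : w ∈ Om E) : w ∈ Om (D ⊔ E) := by
  have h1 : AD (D ⊔ E) ≤ AD D ⊔ AD E := by
    intro α hα
    have : α = (fun P => if E P ≤ D P then α P else 0) + (fun P => if E P ≤ D P then 0 else α P) := by
      funext P; simp only [Pi.add_apply]; split_ifs <;> simp
    rw [this]
    refine AddSubgroup.add_mem_sup (mem_AD.mpr fun P => ?_) (mem_AD.mpr fun P => ?_)
    · have := mem_AD.mp hα P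
      rw [Finsupp.sup_apply] at this
      split_ifs with h
      · rwa [sup_eq_left.mpr h] at this
      · exact zero_mem _
    · have := mem_AD.mp hα P
      rw [Finsupp.sup_apply] at this
      split_ifs with h
      · exact zero_mem _
      · rwa [sup_eq_right.mpr (le_of_not_ge h)] at this
  intro α hα
  obtain ⟨β, hβ, δ, hδ, h⟩ := AddSubgroup.mem_sup.mp hα
  obtain ⟨b1, hb1, b2, hb2, h'⟩ := AddSubgroup.mem_sup.mp (h1 hβ)
  have e : α = ⟨b1, D, hb1⟩ + (⟨b2, E, hb2⟩ + ⟨δ, (by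
      obtain ⟨x, rfl⟩ := hδ
      exact ⟨(dv x)⁻, diag_mem_AD.mpr (mem_L_negPart x)⟩)⟩) := by
    apply Subtype.ext
    change α.1 = b1 + (b2 + δ)
    rw [← h, ← h', add_assoc]
  rw [e, map_add, map_add, hD _ (AddSubgroup.mem_sup_left hb1), hE _ (AddSubgroup.mem_sup_left hb2),
    hD _ (AddSubgroup.mem_sup_right hδ)]
  simp

/-- Multiplication of a functional by a function. -/
def tw (f : K) (w : Functional K) : Functional K :=
  w.comp (DistribSMul.toAddMonoidHom (adele (K := K)) f)

theorem tw_apply (f : K) (w : Functional K) (α : adele (K := K)) : tw f w α = w (f • α) := rfl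

theorem tw_tw (f g : K) (w : Functional K) : tw f (tw g w) = tw (f * g) w := by
  ext α; rw [tw_apply, tw_apply, tw_apply, smul_smul, mul_comm]

theorem tw_one (w : Functional K) : tw 1 w = w := by ext α; rw [tw_apply, one_smul]

theorem tw_zero (w : Functional K) : tw 0 w = 0 := by ext α; rw [tw_apply, zero_smul, map_zero]; rfl

theorem tw_add (f g : K) (w : Functional K) : tw (f + g) w = tw f w + tw g w := by
  ext α; rw [AddMonoidHom.add_apply, tw_apply, tw_apply, tw_apply, add_smul, map_add]

theorem tw_neg (f : K) (w : Functional K) : tw (-f) w = - tw f w := by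
  rw [eq_neg_iff_add_eq_zero, ← tw_add, neg_add_cancel, tw_zero]

theorem tw_map_neg (f : K) (w : Functional K) : tw f (-w) = - tw f w := rfl

theorem tw_eq_zero {f : K} (hf : f ≠ 0) {w : Functional K} (h : tw f w = 0) : w = 0 := by
  rw [← tw_one w, ← inv_mul_cancel₀ hf, ← tw_tw, h]; rfl

theorem tw_mem {D : Div K} {f : K} {w : Functional K} (h : w ∈ Om (D - dv f)) :
    tw f w ∈ Om D := by
  intro α hα
  rw [tw_apply]
  refine h _ ?_
  obtain ⟨β, hβ, _, ⟨x, rfl⟩, h⟩ := AddSubgroup.mem_sup.mp hα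
  change f • α.1 ∈ _
  rw [← h, smul_add]
  refine AddSubgroup.add_mem_sup (mem_AD.mpr fun P => ?_) ⟨f * x, rfl⟩
  have := mul_mem_fil (mem_fil_of_le (P := P) (le_refl (ordAt P.1 f))) (mem_AD.mp hβ P)
  rwa [Finsupp.sub_apply, dv_apply, neg_sub, sub_eq_add_neg]

theorem mem_of_tw_mem {D : Div K} {f : K} (hf : f ≠ 0) {w : Functional K} (h : tw f w ∈ Om D) :
    w ∈ Om (D - dv f) := by
  rw [← tw_one w, ← inv_mul_cancel₀ hf, ← tw_tw]
  refine tw_mem ?_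
  rwa [dv_inv, sub_neg_eq_add, sub_add_cancel]

theorem deg_le_of_mem_Om : ∃ N : ℤ, ∀ (D : Div K) (w : Functional K), w ≠ 0 → w ∈ Om D → deg D ≤ N := by
  obtain ⟨D₀, h₀⟩ := exists_saturated K
  refine ⟨deg D₀ + 3, fun D w hw hD => ?_⟩
  by_contra! h
  have h1 := riemann (D - D₀)
  rw [map_sub] at h1
  have h2 : L (D - D₀) ≠ ⊥ := by
    intro hb
    have := card_L (D - D₀)
    rw [hb, AddSubgroup.card_bot] at this
    have := Nat.one_lt_two_pow (n := ell (ZMod 2) (D - D₀)) (by omega)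
    omega
  obtain ⟨f, hf⟩ := AddSubgroup.ne_bot_iff_exists_ne_zero.mp h2
  have h0 : (f : K) ≠ 0 := fun h => hf (Subtype.ext h)
  have h3 := (mem_L_of_ne h0).mp f.2
  have h4 : D₀ ≤ D + dv f.1 := by
    rw [← sub_nonneg]; convert h3 using 1; abel
  have h5 := (h₀ _ h4).2
  rw [map_add, deg_dv, ell_add_dv D h0] at h5
  have h6 := card_Om D
  rw [show (ell (ZMod 2) D - deg D + 3).toNat = 0 by omega, pow_zero] at h6
  have := AddSubgroup.eq_bot_of_card_eq _ h6
  rw [this] at hD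
  exact hw hD

theorem Om_ne_bot_of_ell {D : Div K} (h : 0 < ell (ZMod 2) D - deg D + 3) :
    ∃ w ∈ Om D, w ≠ 0 := by
  have h1 := card_Om D
  have : Om D ≠ ⊥ := by
    intro hb
    rw [hb, AddSubgroup.card_bot] at h1
    have := Nat.one_lt_two_pow (n := (ell (ZMod 2) D - deg D + 3).toNat) (by omega)
    omega
  obtain ⟨w, hw⟩ := AddSubgroup.ne_bot_iff_exists_ne_zero.mp this
  exact ⟨w, w.2, fun h => hw (Subtype.ext h)⟩

theorem ell_zero : ell (ZMod 2) (0 : Div K) = 1 := by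
  have := card_L (0 : Div K)
  rw [card_L_zero] at this
  exact (Nat.pow_right_injective le_rfl (this.symm.trans (pow_one 2).symm))

theorem ell_neg {D : Div K} (h : deg D < 0) : ell (ZMod 2) D = 0 := by
  have h1 := card_L D
  rw [L_eq_bot h, AddSubgroup.card_bot] at h1
  by_contra h2
  have := Nat.one_lt_two_pow h2
  omega

variable (K) in
theorem exists_maximal_differential : ∃ (W : Div K) (w : Functional K), w ≠ 0 ∧ w ∈ Om W ∧
    ∀ D : Div K, w ∈ Om D → D ≤ W := by
  obtain ⟨N, hN⟩ := deg_le_of_mem_Om (K := K)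
  obtain ⟨w₀, hw₀, h₀⟩ := Om_ne_bot_of_ell (D := (0 : Div K)) (by rw [map_zero]; omega)
  obtain ⟨_, ⟨W, hW, rfl⟩, hmax⟩ := Int.exists_greatest_of_bdd
    (P := fun n => ∃ W : Div K, w₀ ∈ Om W ∧ deg W = n)
    ⟨N, by rintro _ ⟨W, hW, rfl⟩; exact hN W w₀ h₀ hW⟩ ⟨_, 0, hw₀, rfl⟩
  refine ⟨W, w₀, h₀, hW, fun D hD => ?_⟩
  have h1 := hmax _ ⟨_, Om_sup hW hD, rfl⟩
  have h2 := eq_zero_of_deg (E := W ⊔ D - W) (sub_nonneg.mpr le_sup_left) (by rw [map_sub]; omega)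
  rw [← sub_eq_zero.mp h2]
  exact le_sup_right

theorem exists_tw_eq {W W' : Div K} {w w' : Functional K} (h0 : w ≠ 0) (hw : w ∈ Om W)
    (hw' : w' ∈ Om W') : ∃ h : K, w' = tw h w := by
  obtain ⟨P, -⟩ := exists_pole (x := (exists_nonconst K).choose) (exists_nonconst K).choose_spec.1
    (exists_nonconst K).choose_spec.2
  have hP : (0 : ℤ) < pdeg P := by exact_mod_cast placeDegree_pos P
  obtain ⟨m, hm1, hm2⟩ : ∃ m : ℤ, 0 < m ∧ 9 - deg W - deg W' < m * pdeg P := by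
    refine ⟨max 1 (10 - deg W - deg W'), by positivity, ?_⟩
    have h1 : max 1 (10 - deg W - deg W') ≤ max 1 (10 - deg W - deg W') * pdeg P :=
      le_mul_of_one_le_right (by positivity) hP
    have := le_max_right 1 (10 - deg W - deg W')
    omega
  set B : Div K := Finsupp.single P m with hB
  have hdB : deg B = m * pdeg P := deg_single P m
  have hBpos : 0 < deg B := by rw [hdB]; positivity
  have mem : ∀ {V : Div K} {v : Functional K}, v ∈ Om V → ∀ f ∈ L (V + B), tw f v ∈ Om (-B) := by
    intro V v hv f hf
    by_cases hf0 : f = 0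
    · rw [hf0, tw_zero]; exact zero_mem _
    refine tw_mem (Om_anti ?_ hv)
    have := (mem_L_of_ne hf0).mp hf
    rw [← sub_nonneg]; convert this using 1; abel
  let φ : L (W + B) × L (W' + B) →+ Om (-B) :=
    { toFun := fun p => ⟨tw p.1.1 w + tw p.2.1 w', add_mem (mem hw _ p.1.2) (mem hw' _ p.2.2)⟩
      map_zero' := Subtype.ext (by simp [tw_zero])
      map_add' := fun p q => Subtype.ext (by
        change tw (p.1.1 + q.1.1) w + tw (p.2.1 + q.2.1) w' = _
        rw [tw_add, tw_add]
        change _ = (tw p.1.1 w + tw p.2.1 w') + (tw q.1.1 w + tw q.2.1 w')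
        abel) }
  have hfin : Finite (Om (-B)) := Nat.finite_of_card_ne_zero (by rw [card_Om]; positivity)
  have hnot : ¬ Function.Injective φ := by
    intro hinj
    have h1 := Nat.card_le_card_of_injective φ hinj
    rw [Nat.card_prod, card_L, card_L, card_Om, ← pow_add,
      Nat.pow_le_pow_iff_right one_lt_two, ell_neg (D := -B) (by rw [map_neg]; omega)] at h1
    have h2 := riemann (W + B)
    have h3 := riemann (W' + B)
    rw [map_add] at h2 h3
    rw [map_neg] at h1
    push_cast at h1
    omega
  rw [injective_iff_map_eq_zero] at hnot
  push Not at hnot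
  obtain ⟨⟨f, g⟩, hfg, hne⟩ := hnot
  have h1 : tw f.1 w + tw g.1 w' = 0 := congrArg Subtype.val hfg
  by_cases hg : g.1 = 0
  · rw [hg, tw_zero, add_zero] at h1
    by_cases hf : f.1 = 0
    · exact absurd (Prod.ext (Subtype.ext hf) (Subtype.ext hg)) hne
    · exact absurd (tw_eq_zero hf h1) h0
  · refine ⟨-(g.1⁻¹ * f.1), ?_⟩
    rw [← tw_one w', ← inv_mul_cancel₀ hg, ← tw_tw, eq_neg_of_add_eq_zero_right h1, tw_map_neg,
      tw_tw, tw_neg]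

variable (K) in
theorem riemann_roch : ∃ W : Div K, deg W = 6 ∧
    ∀ D : Div K, (ell (ZMod 2) D : ℤ) = deg D - 3 + ell (ZMod 2) (W - D) := by
  obtain ⟨W, w, h0, hw, hmax⟩ := exists_maximal_differential K
  have key : ∀ D : Div K, (ell (ZMod 2) D : ℤ) = deg D - 3 + ell (ZMod 2) (W - D) := by
    intro D
    have h1 : Nat.card (L (W - D)) = Nat.card (Om D) := by
      refine Nat.card_congr (Equiv.ofBijective (fun f => ⟨tw f.1 w, ?_⟩) ⟨?_, ?_⟩)
      · by_cases hf0 : f.1 = 0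
        · rw [hf0, tw_zero]; exact zero_mem _
        refine tw_mem (Om_anti ?_ hw)
        have := (mem_L_of_ne hf0).mp f.2
        rw [← sub_nonneg]; convert this using 1; abel
      · intro f g hfg
        have h1 : tw f.1 w = tw g.1 w := congrArg Subtype.val hfg
        by_contra hne
        have h2 : tw (f.1 - g.1) w = 0 := by
          rw [sub_eq_add_neg, tw_add, tw_neg, h1, add_neg_cancel]
        exact h0 (tw_eq_zero (fun h => hne (Subtype.ext (sub_eq_zero.mp h))) h2)
      · rintro ⟨w', hw'⟩
        obtain ⟨h, rfl⟩ := exists_tw_eq h0 hw hw'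
        refine ⟨⟨h, ?_⟩, rfl⟩
        by_cases hh : h = 0
        · rw [hh]; exact zero_mem _
        rw [mem_L_of_ne hh]
        have := hmax _ (mem_of_tw_mem hh hw')
        rw [← sub_nonneg] at this; convert this using 1; abel
    rw [card_L, card_Om] at h1
    have h2 := Nat.pow_right_injective le_rfl h1
    have := riemann D
    omega
  refine ⟨W, ?_, key⟩
  have h1 := key W
  have h2 := key 0
  rw [sub_self, ell_zero] at h1
  rw [sub_zero, ell_zero, map_zero] at h2
  omega

end Differentials
end CFF

namespace CFF

open Polynomial

/-- Function fields as in `GenusFour` possessing a function of degree five. -/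
class FiveGonal (K : Type) [Field K] [Algebra (ZMod 2) K] : Prop extends GenusFour K where
  exists_five : ∃ T : K, HasDeg T 5

section ClassFunction

variable {K : Type} [Field K] [Algebra (ZMod 2) K] [FiveGonal K]

variable (K) in
theorem exists_deg_eq (n : ℤ) : ∃ D : Div K, deg D = n := by
  obtain ⟨T, hT⟩ := FiveGonal.exists_five (K := K)
  obtain ⟨W, hW, -⟩ := riemann_roch K
  refine ⟨n • (W - (dv T)⁻), ?_⟩
  rw [map_zsmul, map_sub, hW, hT.deg_poles]
  simp

theorem exists_dv_of_deg_eq {D E : Div K} (h : deg D = deg E) : ∃ f : K, f ≠ 0 ∧ E = D + dv f := by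
  obtain ⟨f, hf, h1⟩ := exists_dv_eq (D := E - D) (by rw [map_sub, h, sub_self])
  exact ⟨f, hf, by rw [h1, add_sub_cancel]⟩

variable (K) in
/-- The common dimension of the Riemann–Roch spaces of degree `n`. -/
def e (n : ℤ) : ℕ := ell (ZMod 2) (exists_deg_eq K n).choose

theorem ell_eq {D : Div K} {n : ℤ} (h : deg D = n) : ell (ZMod 2) D = e K n := by
  obtain ⟨f, hf, h1⟩ := exists_dv_of_deg_eq (h.trans (exists_deg_eq K n).choose_spec.symm)
  rw [e, h1, ell_add_dv _ hf]

theorem card_L_eq {D : Div K} {n : ℤ} (h : deg D = n) : Nat.card (L D) = 2 ^ e K n := by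
  rw [card_L, ell_eq h]

theorem e_rr (n : ℤ) : (e K n : ℤ) = n - 3 + e K (6 - n) := by
  obtain ⟨W, hW, h⟩ := riemann_roch K
  obtain ⟨D, hD⟩ := exists_deg_eq K n
  rw [← ell_eq hD, h, hD, ell_eq (D := W - D) (n := 6 - n) (by rw [map_sub, hW, hD])]

theorem e_neg {n : ℤ} (h : n < 0) : e K n = 0 := by
  obtain ⟨D, hD⟩ := exists_deg_eq K n
  rw [← ell_eq hD, ell_neg (by omega)]

theorem e_zero : e K 0 = 1 := by rw [← ell_eq (map_zero deg), ell_zero]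

theorem e_large {n : ℤ} (h : 7 ≤ n) : (e K n : ℤ) = n - 3 := by
  rw [e_rr, e_neg (n := 6 - n) (by omega)]; simp

theorem e_six : e K 6 = 4 := by
  have := e_rr (K := K) 6
  rw [sub_self, e_zero] at this
  omega

theorem e_five : e K 5 = 2 + e K 1 := by
  have := e_rr (K := K) 5
  norm_num at this
  omega

theorem e_four : e K 4 = 1 + e K 2 := by
  have := e_rr (K := K) 4
  norm_num at this
  omega

theorem exists_mem_ne_zero {D : Div K} {n : ℤ} (hD : deg D = n) (h : e K n ≠ 0) :
    ∃ f ∈ L D, f ≠ 0 := by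
  have h1 : L D ≠ ⊥ := by
    intro hb
    have := card_L_eq hD
    rw [hb, AddSubgroup.card_bot] at this
    have := Nat.one_lt_two_pow h
    omega
  obtain ⟨f, hf⟩ := AddSubgroup.ne_bot_iff_exists_ne_zero.mp h1
  exact ⟨f, f.2, fun h => hf (Subtype.ext h)⟩

theorem exists_eff {n : ℤ} (h : e K n ≠ 0) : ∃ E : Div K, 0 ≤ E ∧ deg E = n := by
  obtain ⟨D, hD⟩ := exists_deg_eq K n
  obtain ⟨f, hf, h0⟩ := exists_mem_ne_zero hD h
  exact ⟨D + dv f, (mem_L_of_ne h0).mp hf, by rw [map_add, deg_dv, hD, add_zero]⟩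

theorem e_pos {E : Div K} (hE : 0 ≤ E) {n : ℤ} (h : deg E = n) : 1 ≤ e K n := by
  rw [← ell_eq h, Nat.one_le_iff_ne_zero]
  intro h0
  have h1 := card_L E
  rw [h0, pow_zero] at h1
  have := AddSubgroup.eq_bot_of_card_eq _ h1
  have h2 := one_mem_L hE
  rw [this] at h2
  exact one_ne_zero h2

theorem eff_eq_add_dv {D E : Div K} (hE : 0 ≤ E) (h : deg D = deg E) :
    ∃ f ∈ L D, f ≠ 0 ∧ E = D + dv f := by
  obtain ⟨f, h0, h1⟩ := exists_dv_of_deg_eq h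
  exact ⟨f, (mem_L_of_ne h0).mpr (h1 ▸ hE), h0, h1⟩

/-- There is at most one effective divisor in a one-dimensional class. -/
theorem eff_unique {D E : Div K} {n : ℤ} (hn : e K n = 1) (hD : 0 ≤ D) (hE : 0 ≤ E)
    (h1 : deg D = n) (h2 : deg E = n) : D = E := by
  obtain ⟨f, hf, h0, h⟩ := eff_eq_add_dv hE (h1.trans h2.symm)
  have hc := card_L_eq h1
  rw [hn, pow_one] at hc
  have h3 : L (0 : Div K) = L D := by
    have : Finite (L D) := finite_L D
    exact AddSubgroup.eq_of_le_of_card_ge (L_mono hD) (by rw [hc, card_L_zero])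
  rw [← h3, mem_L_zero] at hf
  rcases hf with rfl | rfl
  · exact absurd rfl h0
  · rw [h, dv_one, add_zero]

theorem e_le_add {E : Div K} (hE : 0 ≤ E) {m : ℤ} (hm : deg E = m) (n : ℤ) : e K n ≤ e K (n + m) := by
  obtain ⟨D, hD⟩ := exists_deg_eq K n
  rw [← ell_eq hD, ← ell_eq (D := D + E) (n := n + m) (by rw [map_add, hD, hm])]
  have h1 : Nat.card (L D) ≤ Nat.card (L (D + E)) := by
    have : Finite (L (D + E)) := finite_L _
    exact Nat.card_mono (Set.toFinite _) (L_mono (le_add_of_nonneg_right hE))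
  rwa [card_L, card_L, Nat.pow_le_pow_iff_right one_lt_two] at h1

theorem e_le_add_pdeg (P : Place (ZMod 2) K) (n : ℤ) : e K (n + pdeg P) ≤ e K n + pdeg P := by
  obtain ⟨D, hD⟩ := exists_deg_eq K n
  have := card_L_add_pt_le D P
  rwa [card_L_eq hD, card_L_eq (n := n + pdeg P) (by rw [map_add, hD, deg_single, one_mul]),
    ← pow_add, Nat.pow_le_pow_iff_right one_lt_two] at this

theorem deg_poles_pos {x : K} (h0 : x ≠ 0) (h1 : x ≠ 1) : 0 < deg (dv x)⁻ := by
  obtain ⟨P, hP⟩ := exists_pole h0 h1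
  by_contra! h
  have h2 := eq_zero_of_deg (negPart_nonneg (dv x)) h
  have h3 : (dv x)⁻ P = max (-(dv x) P) 0 := rfl
  rw [h2, dv_apply, Finsupp.coe_zero, Pi.zero_apply] at h3
  omega

theorem negPart_le_of_mem {D : Div K} (hD : 0 ≤ D) {x : K} (hx : x ∈ L D) : (dv x)⁻ ≤ D := by
  by_cases h0 : x = 0
  · rw [h0, dv_zero, negPart_zero]; exact hD
  refine sup_le ?_ hD
  have := (mem_L_of_ne h0).mp hx
  rw [← sub_nonneg, sub_neg_eq_add]; exact this

theorem exists_nonconst_mem {D : Div K} {n : ℤ} (hD : deg D = n) (h : 2 ≤ e K n) :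
    ∃ f ∈ L D, f ≠ 0 ∧ f ≠ 1 := by
  by_contra! h1
  have h2 : L D ≤ L 0 := fun f hf => mem_L_zero.mpr (by
    by_cases h0 : f = 0
    · exact Or.inl h0
    · exact Or.inr (h1 f hf h0))
  have : Finite (L (0 : Div K)) := finite_L _
  have h3 : Nat.card (L D) ≤ Nat.card (L (0 : Div K)) := Nat.card_mono (Set.toFinite _) h2
  rw [card_L_eq hD, card_L_zero] at h3
  have : 2 ^ 2 ≤ 2 ^ e K n := Nat.pow_le_pow_right two_pos h
  omega

theorem two_le_e {D : Div K} {n : ℤ} (hD : deg D = n) (h : 0 ≤ D) {f : K} (hf : f ∈ L D)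
    (h0 : f ≠ 0) (h1 : f ≠ 1) : 2 ≤ e K n := by
  by_contra! h2
  have h3 := e_pos h hD
  have hc := card_L_eq hD
  rw [show e K n = 1 by omega, pow_one] at hc
  have h3 : L (0 : Div K) = L D :=
    AddSubgroup.eq_of_le_of_card_ge (L_mono h) (by rw [hc, card_L_zero])
  rw [← h3, mem_L_zero] at hf
  exact hf.elim h0 h1

theorem succ_le_e {B : Div K} (hB : 0 ≤ B) {x : K} (hx : x ∈ L B) (h0 : x ≠ 0) (h1 : x ≠ 1) (l : ℕ) :
    l + 1 ≤ e K (l * deg B) := by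
  have hd : deg (l • B) = l * deg B := by rw [map_nsmul]; simp
  let φ : degreeLT (ZMod 2) (l + 1) → L (l • B) := fun p => ⟨aeval x (p : (ZMod 2)[X]),
    poly_mem_L hB hx l (by
      have := mem_degreeLT.mp p.2
      rw [← Nat.lt_succ_iff]
      by_cases h0 : (p : (ZMod 2)[X]) = 0
      · rw [h0]; simp
      · exact (natDegree_lt_iff_degree_lt h0).mpr this)⟩
  have hφ : Function.Injective φ := fun p q h => Subtype.ext
    (transcendental_iff_injective.mp (transcendental_of_ne h0 h1) (congrArg Subtype.val h))
  have h2 := Nat.card_le_card_of_injective φ hφ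
  have h3 : Nat.card (degreeLT (ZMod 2) (l + 1)) = 2 ^ (l + 1) := by
    rw [Nat.card_congr (degreeLTEquiv (ZMod 2) (l + 1)).toEquiv]
    simp
  rwa [h3, card_L_eq hd, Nat.pow_le_pow_iff_right one_lt_two] at h2

theorem e_one_le : e K 1 ≤ 1 := by
  by_contra! h
  obtain ⟨E, hE, hd⟩ := exists_eff (K := K) (n := 1) (by omega)
  obtain ⟨x, hx, h0, h1⟩ := exists_nonconst_mem hd h
  have h2 := succ_le_e hE hx h0 h1 7
  rw [hd] at h2
  have := e_large (K := K) (n := (7 : ℕ) * 1) (by norm_num)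
  push_cast at *
  omega

theorem e_two_le : e K 2 ≤ 2 := by
  by_contra! h
  obtain ⟨E, hE, hd⟩ := exists_eff (K := K) (n := 2) (by omega)
  obtain ⟨x, hx, h0, h1⟩ := exists_nonconst_mem hd (by omega)
  have h4 : 4 ≤ e K 4 := by rw [e_four]; omega
  have hE2 : deg ((2 : ℕ) • E) = 4 := by rw [map_nsmul, hd]; rfl
  have hE3 : deg ((3 : ℕ) • E) = 6 := by rw [map_nsmul, hd]; rfl
  have h5 : L ((2 : ℕ) • E) = L ((3 : ℕ) • E) := by
    refine AddSubgroup.eq_of_le_of_card_ge (L_mono (nsmul_le_nsmul_left hE (by norm_num))) ?_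
    rw [card_L_eq hE2, card_L_eq hE3, e_six]
    exact Nat.pow_le_pow_right two_pos h4
  have h6 := pow_mem_L hx 3
  rw [← h5] at h6
  have h7 := deg_mono (negPart_le_of_mem (nsmul_nonneg hE 2) h6)
  have h8 : (dv (x ^ 3))⁻ = (3 : ℕ) • (dv x)⁻ := by
    rw [dv_pow]
    ext P
    change max (-(((3 : ℕ) • dv x) P)) 0 = (3 : ℕ) • max (-(dv x P)) 0
    rw [Finsupp.smul_apply]
    simp only [nsmul_eq_mul]
    push_cast
    omega
  rw [h8, hE2, map_nsmul] at h7
  have h9 := deg_poles_pos h0 h1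
  have h10 : deg (dv x)⁻ = 1 := by
    rw [nsmul_eq_mul] at h7; push_cast at h7; omega
  have := two_le_e h10 (negPart_nonneg _) (mem_L_negPart x) h0 h1
  have := e_one_le (K := K)
  omega

end ClassFunction
end CFF

namespace CFF

open Polynomial IsLocalRing

section RationalPlace

variable {K : Type} [Field K] [Algebra (ZMod 2) K] [FunctionFieldTwo K]

theorem eq_zero_of_sum_eq_zero (P : Place (ZMod 2) K) {ι : Type*} (s : Finset ι) (f : ι → K)
    (hf : ∀ i ∈ s, ∀ j ∈ s, f i ≠ 0 → f j ≠ 0 → ordAt P.1 (f i) = ordAt P.1 (f j) → i = j)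
    (h : ∑ i ∈ s, f i = 0) : ∀ i ∈ s, f i = 0 := by
  by_contra! hne
  obtain ⟨i₀, hi₀, hne⟩ := hne
  obtain ⟨i, hi, hmin⟩ := (s.filter fun i => f i ≠ 0).exists_min_image (fun i => ordAt P.1 (f i))
    ⟨i₀, Finset.mem_filter.mpr ⟨hi₀, hne⟩⟩
  rw [Finset.mem_filter] at hi
  rw [← Finset.add_sum_erase s f hi.1] at h
  refine (ordAt_add_eq (P := P) hi.2 (sum_mem fun j hj => ?_)).1 h
  rw [Finset.mem_erase] at hj
  by_cases h0 : f j = 0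
  · rw [h0]; exact zero_mem _
  rw [mem_fil_of_ne h0]
  have h1 := hmin j (Finset.mem_filter.mpr ⟨hj.2, h0⟩)
  have h2 : ordAt P.1 (f i) ≠ ordAt P.1 (f j) := fun h => hj.1 (hf i hi.1 j hj.2 hi.2 h0 h).symm
  omega

theorem algebraMap_mem_fil_zero (P : Place (ZMod 2) K) (c : ZMod 2) :
    algebraMap (ZMod 2) K c ∈ fil P 0 := (mem_fil_zero).mpr (P.2.2 c)

/-- The order at a pole `P` of `x` of a polynomial in `x`. -/
theorem ordAt_aeval (P : Place (ZMod 2) K) {x : K} (hx : ordAt P.1 x < 0) {g : (ZMod 2)[X]}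
    (hg : g ≠ 0) : aeval x g ≠ 0 ∧ ordAt P.1 (aeval x g) = g.natDegree * ordAt P.1 x := by
  have hx0 : x ≠ 0 := by rintro rfl; rw [ordAt_zero] at hx; omega
  have hl : algebraMap (ZMod 2) K g.leadingCoeff = 1 := by
    rcases zmod_two_cases g.leadingCoeff with h | h
    · exact absurd (leadingCoeff_eq_zero.mp h) hg
    · rw [h, map_one]
  rw [aeval_eq_sum_range, Finset.sum_range_succ, add_comm, coeff_natDegree, Algebra.smul_def, hl,
    one_mul, ← ordAt_pow]
  refine ordAt_add_eq (pow_ne_zero _ hx0) (sum_mem fun i hi => ?_)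
  rw [Algebra.smul_def]
  refine fil_mono ?_ (mul_mem_fil (algebraMap_mem_fil_zero P _)
    (pow_mem_fil (mem_fil_of_le le_rfl) i))
  rw [ordAt_pow, zero_add]
  have := Finset.mem_range.mp hi
  have : (i : ℤ) + 1 ≤ g.natDegree := by exact_mod_cast this
  nlinarith

/-- The space of functions whose only pole is at `P`, of order at most `n`. -/
abbrev Lp (P : Place (ZMod 2) K) (n : ℤ) : AddSubgroup K := L (Finsupp.single P n)

theorem Lp_mono (P : Place (ZMod 2) K) {m n : ℤ} (h : m ≤ n) : Lp P m ≤ Lp P n :=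
  L_mono (Finsupp.single_mono h)

theorem mul_mem_Lp {P : Place (ZMod 2) K} {m n : ℤ} {f g : K} (hf : f ∈ Lp P m) (hg : g ∈ Lp P n) :
    f * g ∈ Lp P (m + n) := by
  rw [Lp, Finsupp.single_add]; exact mul_mem_L hf hg

theorem pow_mem_Lp {P : Place (ZMod 2) K} {m : ℤ} {f : K} (hf : f ∈ Lp P m) (n : ℕ) :
    f ^ n ∈ Lp P (n * m) := by
  have := pow_mem_L hf n
  rwa [Finsupp.smul_single, nsmul_eq_mul] at this

theorem Lp_inf (P : Place (ZMod 2) K) (n : ℤ) : Lp P n ⊓ fil P (-n + 1) = Lp P (n - 1) := by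
  have := L_inf_fil (Finsupp.single P n) P 1
  rwa [Finsupp.single_eq_same, ← Finsupp.single_sub, Nat.cast_one] at this

theorem Lp_le_fil (P : Place (ZMod 2) K) (n : ℤ) : Lp P n ≤ fil P (-n) := by
  simpa using L_le_fil (Finsupp.single P n) P

theorem mem_Lp_of_not_mem {P : Place (ZMod 2) K} {n : ℤ} {f : K} (hf : f ∈ Lp P n)
    (h : f ∉ Lp P (n - 1)) : f ≠ 0 ∧ ordAt P.1 f = -n := by
  have h0 : f ≠ 0 := fun h1 => h (h1 ▸ zero_mem _)
  have h1 := Lp_le_fil P n hf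
  have h2 : f ∉ fil P (-n + 1) := fun h2 => h (Lp_inf P n ▸ ⟨hf, h2⟩)
  rw [mem_fil_of_ne h0] at h1 h2
  exact ⟨h0, by omega⟩

theorem eq_or_eq_one {P : Place (ZMod 2) K} (hP : placeDegree (ZMod 2) P = 1) (a : Res P) :
    a = 0 ∨ a = 1 := by
  by_contra! h
  have h1 := card_res P
  rw [hP, pow_one] at h1
  have h2 : ({0, 1, a} : Finset (Res P)).card ≤ Nat.card (Res P) := by
    have := Fintype.ofFinite (Res P)
    rw [Nat.card_eq_fintype_card]
    exact Finset.card_le_univ _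
  rw [Finset.card_eq_three.mpr ⟨0, 1, a, zero_ne_one, h.1.symm, h.2.symm, rfl⟩] at h2
  omega

theorem exists_add_mem_fil {P : Place (ZMod 2) K} (hP : placeDegree (ZMod 2) P = 1) {n : ℤ} {f m : K}
    (hf : f ∈ fil P n) (hm : m ≠ 0) (hn : ordAt P.1 m = n) :
    ∃ c : ZMod 2, f + algebraMap (ZMod 2) K c * m ∈ fil P (n + 1) := by
  have h1 : f / m ∈ P.1 := (le_ordAt_iff P hm hn).mp hf
  rcases eq_or_eq_one hP (resAt P (f / m)) with h | h
  · refine ⟨0, ?_⟩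
    rwa [map_zero, zero_mul, add_zero, ← div_mem_fil_one_iff P hm hn, ← resAt_eq_zero_iff h1]
  · refine ⟨1, ?_⟩
    rw [map_one, one_mul, ← div_mem_fil_one_iff P hm hn, add_div, div_self hm,
      ← resAt_eq_zero_iff (add_mem h1 (one_mem _)), resAt_add h1 (one_mem _), h, resAt_one,
      CharTwo.add_self_eq_zero]

theorem exists_add_mem_Lp {P : Place (ZMod 2) K} (hP : placeDegree (ZMod 2) P = 1) {n : ℤ} {f m : K}
    (hf : f ∈ Lp P n) (hm : m ∈ Lp P n) (hm' : m ∉ Lp P (n - 1)) :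
    ∃ c : ZMod 2, f + algebraMap (ZMod 2) K c * m ∈ Lp P (n - 1) := by
  obtain ⟨h0, h1⟩ := mem_Lp_of_not_mem hm hm'
  obtain ⟨c, hc⟩ := exists_add_mem_fil hP (Lp_le_fil P n hf) h0 h1
  refine ⟨c, Lp_inf P n ▸ ⟨add_mem hf ?_, hc⟩⟩
  rcases zmod_two_cases c with rfl | rfl
  · rw [map_zero, zero_mul]; exact zero_mem _
  · rw [map_one, one_mul]; exact hm

end RationalPlace

section Points

variable {K : Type} [Field K] [Algebra (ZMod 2) K] [GenusFour K]

/-- A point of an affine model with values in a finite ring produces a place. -/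
theorem exists_place_of_point {P : Place (ZMod 2) K} (hP : placeDegree (ZMod 2) P = 1)
    {F : Type} [CommRing F] [Nontrivial F] [Finite F] (Γ : Subring (K × F))
    (hΓ : ∀ s ∈ Γ, s.1 = 0 → s.2 = 0) (hL : ∀ n : ℕ, ∀ f ∈ Lp P n, ∃ a, (f, a) ∈ Γ) :
    ∃ Q : Place (ZMod 2) K, Q ≠ P ∧ 2 ^ placeDegree (ZMod 2) Q ≤ Nat.card F ∧
      ∀ s ∈ Γ, s.1 ∈ Q.1 ∧ (s.2 = 0 → s.1 ∈ fil Q 1) := by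
  have hbig : ∀ n : ℕ, 2 ^ (n - 3 : ℤ).toNat ≤ Nat.card (Lp P n) := by
    intro n
    rw [card_L]
    refine Nat.pow_le_pow_right two_pos ?_
    have := riemann (Finsupp.single P (n : ℤ))
    rw [deg_single, pdeg, hP] at this
    omega
  let S : Subring K := Γ.map (RingHom.fst K F)
  let π : Γ →+* S := ((RingHom.fst K F).comp Γ.subtype).codRestrict S fun s => ⟨s, s.2, rfl⟩
  have hπ : Function.Bijective π := by
    constructor
    · rw [injective_iff_map_eq_zero]
      intro s hs
      have h1 : s.1.1 = 0 := congrArg Subtype.val hs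
      exact Subtype.ext (Prod.ext h1 (hΓ s s.2 h1))
    · rintro ⟨_, s, hs, rfl⟩
      exact ⟨⟨s, hs⟩, rfl⟩
  let ψ : S ≃+* Γ := (RingEquiv.ofBijective π hπ).symm
  let φ : S →+* F := ((RingHom.snd K F).comp Γ.subtype).comp ψ
  have hψ : ∀ s (hs : s ∈ Γ), φ ⟨s.1, s, hs, rfl⟩ = s.2 := by
    intro s hs
    have : ψ ⟨s.1, s, hs, rfl⟩ = ⟨s, hs⟩ := (RingEquiv.symm_apply_eq _).mpr rfl
    change ((ψ ⟨s.1, s, hs, rfl⟩ : Γ) : K × F).2 = _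
    rw [this]
  obtain ⟨V, hSV, hV⟩ := Ideal.image_subset_nonunits_valuationSubring (RingHom.ker φ)
    (RingHom.ker_ne_top φ)
  have hmem : ∀ s ∈ Γ, s.1 ∈ V := fun s hs => hSV ⟨s, hs, rfl⟩
  have hnon : ∀ s ∈ Γ, s.2 = 0 → s.1 ∈ V.nonunits := fun s hs h =>
    hV ⟨⟨s.1, ⟨s, hs, rfl⟩⟩, by rw [SetLike.mem_coe, RingHom.mem_ker, hψ s hs, h], rfl⟩
  choose! a ha using hL
  have hinj : ∀ n : ℕ, ¬ Function.Injective fun f : Lp P (n + Nat.card F + 3 : ℕ) =>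
      a (n + Nat.card F + 3) f := by
    intro n h
    have h1 := Nat.card_le_card_of_injective _ h
    have h2 := hbig (n + Nat.card F + 3)
    have h3 : ((n + Nat.card F + 3 : ℕ) - 3 : ℤ).toNat = n + Nat.card F := by push_cast; omega
    rw [h3] at h2
    have h4 : Nat.card F < 2 ^ (n + Nat.card F) :=
      Nat.lt_of_le_of_lt (Nat.le_add_left _ _) Nat.lt_two_pow_self
    omega
  have hV1 : V ≠ ⊤ := by
    rintro rfl
    have := hinj 0
    rw [Function.not_injective_iff] at this
    obtain ⟨f, g, hfg, hne⟩ := this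
    have h1 := Γ.sub_mem (ha _ f f.2) (ha _ g g.2)
    have h2 := hnon _ h1 (by simpa using sub_eq_zero.mpr hfg)
    rw [ValuationSubring.mem_nonunits_iff_exists_mem_maximalIdeal] at h2
    obtain ⟨h3, h4⟩ := h2
    rw [IsLocalRing.mem_maximalIdeal, mem_nonunits_iff] at h4
    refine h4 (isUnit_iff_exists_inv.mpr ⟨⟨(f - g : K)⁻¹, trivial⟩, Subtype.ext ?_⟩)
    exact mul_inv_cancel₀ (sub_ne_zero.mpr fun h => hne (Subtype.ext h))
  let Q : Place (ZMod 2) K := ⟨V, hV1, fun c => by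
    rcases zmod_two_cases c with rfl | rfl
    · rw [map_zero]; exact zero_mem _
    · rw [map_one]; exact one_mem _⟩
  have hfil : ∀ s ∈ Γ, s.2 = 0 → s.1 ∈ fil Q 1 := by
    intro s hs h
    have h2 := hnon s hs h
    rw [ValuationSubring.mem_nonunits_iff_exists_mem_maximalIdeal] at h2
    obtain ⟨h3, h4⟩ := h2
    rw [← resAt_eq_zero_iff h3, resAt_of_mem h3]
    exact Ideal.Quotient.eq_zero_iff_mem.mpr h4
  have hsub : ∀ n : ℕ, Lp P n ≤ fil Q 0 := fun n f hf => (mem_fil_zero).mpr (hmem _ (ha n f hf))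
  have hQP : Q ≠ P := by
    intro h
    have h1 := hbig 5
    have h2 : Lp P (5 : ℕ) ≤ L 0 := by
      intro f hf
      rw [mem_L]
      intro R
      rw [Finsupp.coe_zero, Pi.zero_apply, neg_zero]
      by_cases hR : R = P
      · rw [hR, ← h]; exact hsub 5 hf
      · have := mem_L.mp hf R
        rwa [Finsupp.single_eq_of_ne hR, neg_zero] at this
    have : Finite (L (0 : Div K)) := finite_L _
    have h3 : Nat.card (Lp P (5 : ℕ)) ≤ Nat.card (L (0 : Div K)) := Nat.card_mono (Set.toFinite _) h2
    rw [card_L_zero] at h3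
    have h4 : 2 ^ (((5 : ℕ) : ℤ) - 3).toNat = 4 := rfl
    omega
  refine ⟨Q, hQP, ?_, fun s hs => ⟨hmem s hs, hfil s hs⟩⟩
  set d := placeDegree (ZMod 2) Q with hd
  set n := 10 + d with hn
  have hell : ∀ D : Div K, 7 ≤ deg D → Nat.card (L D) = 2 ^ (deg D - 3).toNat := by
    intro D hD
    obtain ⟨W, hW, h⟩ := riemann_roch K
    have h1 := h D
    rw [ell_neg (D := W - D) (by rw [map_sub, hW]; omega)] at h1
    rw [card_L]
    congr 1
    omega
  have hidx : (fil Q 1).relIndex (Lp P n) = 2 ^ d := by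
    have h1 := card_eq_card_inf_mul (Lp P n) (fil Q 1)
    have h2 := L_inf_fil (Finsupp.single P (n : ℤ)) Q 1
    rw [Finsupp.single_eq_of_ne hQP, Nat.cast_one, neg_zero, zero_add] at h2
    have h3 : deg (Finsupp.single P (n : ℤ)) = n := by rw [deg_single, pdeg, hP]; simp
    have h4 : deg (Finsupp.single P (n : ℤ) - Finsupp.single Q 1) = n - d := by
      rw [map_sub, h3, deg_single, one_mul]
    rw [h2, hell _ (by rw [h3]; omega), hell _ (by rw [h4]; omega), h3, h4,
      show ((n : ℤ) - 3).toNat = (n - d - 3 : ℤ).toNat + d by omega, pow_add] at h1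
    exact (Nat.eq_of_mul_eq_mul_left (by positivity) h1).symm
  rw [← hidx, AddSubgroup.relIndex, AddSubgroup.index]
  refine Nat.card_le_card_of_injective (fun q => a n (q.out : Lp P n)) fun p q hpq => ?_
  rw [← QuotientAddGroup.out_eq' p, ← QuotientAddGroup.out_eq' q, QuotientAddGroup.eq,
    AddSubgroup.mem_addSubgroupOf]
  have h1 := Γ.sub_mem (ha n _ (Quotient.out q).2) (ha n _ (Quotient.out p).2)
  have h2 := hfil _ h1 (sub_eq_zero.mpr hpq.symm)
  simpa [neg_add_eq_sub] using h2

end Points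
end CFF

namespace CFF

open Polynomial IsLocalRing

section AffineModel

variable {K : Type} [Field K] [Algebra (ZMod 2) K] [GenusFour K]

/-- `f` has a pole of exact order `n` at `P` and no other poles. -/
def Ex (P : Place (ZMod 2) K) (n : ℤ) (f : K) : Prop := f ∈ Lp P n ∧ f ∉ Lp P (n - 1)

variable {P : Place (ZMod 2) K}

theorem Ex.ne_zero {n : ℤ} {f : K} (h : Ex P n f) : f ≠ 0 := (mem_Lp_of_not_mem h.1 h.2).1

theorem Ex.ordAt_eq {n : ℤ} {f : K} (h : Ex P n f) : ordAt P.1 f = -n := (mem_Lp_of_not_mem h.1 h.2).2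

theorem Ex.of_ordAt {n : ℤ} {f : K} (h : f ∈ Lp P n) (h0 : f ≠ 0) (h1 : ordAt P.1 f = -n) : Ex P n f :=
  ⟨h, fun h2 => by
    have h3 := Lp_le_fil P _ h2
    rw [mem_fil_of_ne h0] at h3
    omega⟩

theorem Ex.mul {m n : ℤ} {f g : K} (hf : Ex P m f) (hg : Ex P n g) : Ex P (m + n) (f * g) :=
  Ex.of_ordAt (mul_mem_Lp hf.1 hg.1) (mul_ne_zero hf.ne_zero hg.ne_zero) (by
    rw [ordAt_mul P hf.ne_zero hg.ne_zero, hf.ordAt_eq, hg.ordAt_eq]; ring)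

theorem Ex.pow {m : ℤ} {f : K} (hf : Ex P m f) (k : ℕ) : Ex P (k * m) (f ^ k) :=
  Ex.of_ordAt (pow_mem_Lp hf.1 k) (pow_ne_zero _ hf.ne_zero) (by
    rw [ordAt_pow, hf.ordAt_eq]; ring)

theorem Ex.one : Ex P 0 (1 : K) :=
  Ex.of_ordAt (by rw [Lp, Finsupp.single_zero]; exact one_mem_L le_rfl) one_ne_zero (by
    rw [ordAt_one, neg_zero])

theorem Ex.step (hP : placeDegree (ZMod 2) P = 1) {n : ℤ} {f m : K} (hm : Ex P n m)
    (hf : f ∈ Lp P n) : ∃ c : ZMod 2, f + algebraMap (ZMod 2) K c * m ∈ Lp P (n - 1) :=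
  exists_add_mem_Lp hP hf hm.1 hm.2

/-- A point of the affine model given by a free basis over `𝔽₂[x]` with prescribed
multiplication table produces a place. -/
theorem exists_place_of_basis (hP : placeDegree (ZMod 2) P = 1) {F : Type} [CommRing F]
    [Nontrivial F] [Finite F] [Algebra (ZMod 2) F] {k N : ℕ} (hN : 0 < N) {X : K × F} (hx : Ex P N X.1)
    (u : Fin k → K × F) (r : Fin k → ℕ) (hu : ∀ i, Ex P (r i) (u i).1)
    (hr : ∀ i j, (r i : ℤ) ≡ r j [ZMOD N] → i = j)
    (hgen : ∀ n : ℕ, 0 < n → Lp P n = Lp P (n - 1) ∨ ∃ i j, n = N * j + r i)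
    (h1 : ∃ i, u i = 1)
    (hmul : ∀ i j, ∃ g : Fin k → (ZMod 2)[X], u i * u j = ∑ l, aeval X (g l) * u l) :
    ∃ Q : Place (ZMod 2) K, Q ≠ P ∧ 2 ^ placeDegree (ZMod 2) Q ≤ Nat.card F ∧
      ∀ g : (ZMod 2)[X], aeval X.1 g ∈ Q.1 ∧ (aeval X.2 g = 0 → aeval X.1 g ∈ fil Q 1) := by
  have hfst : ∀ g : (ZMod 2)[X], (aeval X g).1 = aeval X.1 g := fun g =>
    (aeval_algHom_apply (AlgHom.fst (ZMod 2) K F) X g).symm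
  have hsnd : ∀ g : (ZMod 2)[X], (aeval X g).2 = aeval X.2 g := fun g =>
    (aeval_algHom_apply (AlgHom.snd (ZMod 2) K F) X g).symm
  obtain ⟨i₁, hi₁⟩ := h1
  have key : ∀ i j (p q : (ZMod 2)[X]), ∃ g : Fin k → (ZMod 2)[X],
      (aeval X p * u i) * (aeval X q * u j) = ∑ l, aeval X (g l) * u l := by
    intro i j p q
    obtain ⟨g, hg⟩ := hmul i j
    refine ⟨fun l => p * q * g l, ?_⟩
    calc _ = aeval X p * aeval X q * (u i * u j) := by ring
      _ = _ := by
        rw [hg, Finset.mul_sum]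
        exact Finset.sum_congr rfl fun l _ => by rw [map_mul, map_mul]; ring
  let M : AddSubgroup (K × F) :=
    { carrier := {s | ∃ g : Fin k → (ZMod 2)[X], s = ∑ l, aeval X (g l) * u l}
      zero_mem' := ⟨0, by simp⟩
      add_mem' := by
        rintro _ _ ⟨g, rfl⟩ ⟨h, rfl⟩
        exact ⟨g + h, by simp [add_mul, Finset.sum_add_distrib]⟩
      neg_mem' := by
        rintro _ ⟨g, rfl⟩
        exact ⟨-g, by simp⟩ }
  have hone : ∀ g : (ZMod 2)[X], ∀ i, aeval X g * u i ∈ M := fun g i =>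
    ⟨Pi.single i g, by
      rw [Finset.sum_eq_single i]
      · rw [Pi.single_eq_same]
      · intro j _ hj; rw [Pi.single_eq_of_ne hj, map_zero, zero_mul]
      · intro h; exact absurd (Finset.mem_univ _) h⟩
  let Γ : Subring (K × F) :=
    { M with
      one_mem' := by simpa [hi₁] using hone 1 i₁
      mul_mem' := by
        rintro _ _ ⟨g, rfl⟩ ⟨h, rfl⟩
        change _ ∈ M
        rw [Finset.sum_mul_sum]
        exact sum_mem fun i _ => sum_mem fun j _ => key i j (g i) (h j) }
  have hΓ : ∀ s ∈ Γ, s.1 = 0 → s.2 = 0 := by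
    rintro _ ⟨g, rfl⟩ h
    have hneg : ordAt P.1 X.1 < 0 := by rw [hx.ordAt_eq]; omega
    rw [Prod.fst_sum] at h
    have h2 := eq_zero_of_sum_eq_zero P Finset.univ _ ?_ h
    · have h3 : ∀ i, g i = 0 := by
        intro i
        by_contra h0
        have := h2 i (Finset.mem_univ _)
        rw [Prod.fst_mul, hfst] at this
        exact mul_ne_zero (ordAt_aeval P hneg h0).1 (hu i).ne_zero this
      simp [h3]
    · intro i _ j _ hi hj hij
      have h3 : ∀ l, (aeval X (g l) * u l).1 ≠ 0 →
          ordAt P.1 (aeval X (g l) * u l).1 = -(N * (g l).natDegree) - r l := by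
        intro l hl
        rw [Prod.fst_mul, hfst] at hl ⊢
        have h4 : g l ≠ 0 := by
          rintro h; rw [h, map_zero, zero_mul] at hl; exact hl rfl
        obtain ⟨h5, h6⟩ := ordAt_aeval P hneg h4
        rw [ordAt_mul P h5 (hu l).ne_zero, h6, hx.ordAt_eq, (hu l).ordAt_eq]
        ring
      rw [h3 i hi, h3 j hj] at hij
      refine hr i j ?_
      rw [Int.modEq_iff_dvd]
      exact ⟨(g i).natDegree - (g j).natDegree, by linear_combination hij⟩
  have hL : ∀ n : ℕ, ∀ f ∈ Lp P n, ∃ a, (f, a) ∈ Γ := by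
    intro n
    induction n with
    | zero =>
      intro f hf
      rw [Nat.cast_zero, Lp, Finsupp.single_zero, mem_L_zero] at hf
      rcases hf with rfl | rfl
      · exact ⟨0, Γ.zero_mem⟩
      · exact ⟨1, Γ.one_mem⟩
    | succ n ih =>
      intro f hf
      have hn : ((n + 1 : ℕ) : ℤ) - 1 = n := by push_cast; ring
      rcases hgen (n + 1) n.succ_pos with h | ⟨i, j, hij⟩
      · rw [h, hn] at hf
        exact ih f hf
      · have hm : Ex P (n + 1 : ℕ) (X.1 ^ j * (u i).1) := by
          have := (hx.pow j).mul (hu i)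
          rwa [show (j * N + r i : ℤ) = (n + 1 : ℕ) by rw [hij]; push_cast; ring] at this
        obtain ⟨c, hc⟩ := hm.step hP hf
        rw [hn] at hc
        obtain ⟨a, ha⟩ := ih _ hc
        have h3 : aeval X (Polynomial.X ^ j) * u i ∈ Γ := hone _ _
        rw [map_pow, aeval_X] at h3
        rcases zmod_two_cases c with rfl | rfl
        · rw [map_zero, zero_mul, add_zero] at ha
          exact ⟨a, ha⟩
        · rw [map_one, one_mul] at ha
          refine ⟨a - (X ^ j * u i).2, ?_⟩
          convert Γ.sub_mem ha h3 using 1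
          exact Prod.ext (by simp) rfl
  obtain ⟨Q, hQ, hc, h⟩ := exists_place_of_point hP Γ hΓ hL
  refine ⟨Q, hQ, hc, fun g => ?_⟩
  have h1 : aeval X g ∈ Γ := by
    change _ ∈ M
    simpa [hi₁] using hone g i₁
  rw [← hfst, ← hsnd]
  exact h _ h1

end AffineModel

section RationalPoint

variable {K : Type} [Field K] [Algebra (ZMod 2) K] [FiveGonal K]

theorem exists_place_of_e_one (h : e K 1 = 1) : ∃ P : Place (ZMod 2) K, placeDegree (ZMod 2) P = 1 := by
  obtain ⟨E, hE, hd⟩ := exists_eff (K := K) (n := 1) (by omega)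
  obtain ⟨P, hP⟩ := exists_pos_of_ne hE (by rintro rfl; rw [map_zero] at hd; omega)
  refine ⟨P, ?_⟩
  have h1 := deg_mono hP
  have h2 := placeDegree_pos P
  rw [hd, deg_single, one_mul] at h1
  have : (placeDegree (ZMod 2) P : ℤ) ≤ 1 := h1
  omega

variable {P : Place (ZMod 2) K} (hP : placeDegree (ZMod 2) P = 1)
include hP

theorem deg_Lp (n : ℤ) : deg (Finsupp.single P n) = n := by rw [deg_single, pdeg, hP]; simp

theorem Lp_eq_of_e_eq {n : ℤ} (h : e K n = e K (n - 1)) : Lp P n = Lp P (n - 1) := by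
  have : Finite (Lp P n) := finite_L _
  refine (AddSubgroup.eq_of_le_of_card_ge (Lp_mono P (by omega)) ?_).symm
  rw [card_L_eq (deg_Lp hP n), card_L_eq (deg_Lp hP (n - 1)), h]

theorem exists_ex {n : ℤ} (h : e K (n - 1) < e K n) : ∃ f, Ex P n f := by
  by_contra! h1
  have h2 : Lp P n ≤ Lp P (n - 1) := fun f hf => by
    by_contra h3
    exact h1 f ⟨hf, h3⟩
  have : Finite (Lp P (n - 1)) := finite_L _
  have h3 : Nat.card (Lp P n) ≤ Nat.card (Lp P (n - 1)) := Nat.card_mono (Set.toFinite _) h2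
  rw [card_L_eq (deg_Lp hP n), card_L_eq (deg_Lp hP (n - 1)),
    Nat.pow_le_pow_iff_right one_lt_two] at h3
  omega

theorem mem_of_gap {n : ℤ} (h : e K n = e K (n - 1)) {E : Div K} (hE : 0 ≤ E) (hd : deg E = n) :
    pt P ≤ E := by
  obtain ⟨f, hf, h0, h1⟩ := eff_eq_add_dv (D := Finsupp.single P n) hE ((deg_Lp hP n).trans hd.symm)
  have h2 : f ∈ Lp P (n - 1) := Lp_eq_of_e_eq hP h ▸ hf
  have h3 := (mem_L_of_ne h0).mp h2
  rw [h1, ← sub_nonneg]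
  rwa [Finsupp.single_sub, sub_add_eq_add_sub] at h3

theorem eq_of_gap {n : ℤ} (h : e K n = e K (n - 1)) {Q : Place (ZMod 2) K}
    (hd : (placeDegree (ZMod 2) Q : ℤ) = n) : Q = P := by
  have h1 := mem_of_gap hP h (E := pt Q) (Finsupp.single_nonneg.mpr zero_le_one)
    (by rw [deg_single, one_mul]; exact hd) P
  by_contra h2
  rw [Finsupp.single_eq_same, Finsupp.single_eq_of_ne (Ne.symm h2)] at h1
  omega

theorem eq_of_placeDegree_eq_one {Q : Place (ZMod 2) K} (hd : placeDegree (ZMod 2) Q = 1) : Q = P := by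
  have h1 : e K 1 = 1 := le_antisymm e_one_le
    (e_pos (E := pt P) (Finsupp.single_nonneg.mpr zero_le_one) (deg_Lp hP 1))
  have := eff_unique h1 (D := pt Q) (E := pt P) (Finsupp.single_nonneg.mpr zero_le_one)
    (Finsupp.single_nonneg.mpr zero_le_one) (deg_Lp hd 1) (deg_Lp hP 1)
  exact (Finsupp.single_left_inj one_ne_zero).mp this

theorem e_two_eq_one : e K 2 = 1 := by
  have h1 : e K 1 = 1 := le_antisymm e_one_le
    (e_pos (E := pt P) (Finsupp.single_nonneg.mpr zero_le_one) (deg_Lp hP 1))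
  have h2 := e_le_add (E := pt P) (Finsupp.single_nonneg.mpr zero_le_one) (deg_Lp hP 1) 1
  by_contra h
  have h3 := e_two_le (K := K)
  rw [show (1 : ℤ) + 1 = 2 by norm_num] at h2
  have h4 : e K 2 = 2 := by omega
  have h5 : e K 5 = e K (5 - 1) := by
    rw [e_five, show (5 : ℤ) - 1 = 4 by norm_num, e_four]; omega
  obtain ⟨T, hT⟩ := FiveGonal.exists_five (K := K)
  have hpole : ∀ f : K, f ∈ L (dv T)⁻ → f ≠ 0 → pt P ≤ (dv T)⁻ + dv f := by
    intro f hf h0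
    refine mem_of_gap hP h5 ((mem_L_of_ne h0).mp hf) ?_
    rw [map_add, deg_dv, add_zero, hT.deg_poles]
    rfl
  have hne : T ≠ 0 := by
    rintro rfl
    have := hT.deg_poles
    rw [dv_zero, negPart_zero, map_zero] at this
    norm_num at this
  have h6 := hpole T (mem_L_negPart T) hne P
  have h7 := hpole 1 (one_mem_L (negPart_nonneg _)) one_ne_zero P
  have h8 : (dv T)⁻ P = max (-(dv T) P) 0 := rfl
  rw [Finsupp.add_apply, Finsupp.single_eq_same] at h6 h7
  rw [dv_one, Finsupp.coe_zero, Pi.zero_apply] at h7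
  omega

end RationalPoint
end CFF

namespace CFF

open Polynomial IsLocalRing

/-- The field with four elements. -/
abbrev F4 := QuadraticAlgebra (ZMod 2) 1 1

/-- The field with sixteen elements. -/
abbrev F16 := QuadraticAlgebra F4 ⟨0, 1⟩ 1

instance : Fintype F4 := Fintype.ofEquiv _ (QuadraticAlgebra.equivProd 1 1).symm

instance : Fintype F16 := Fintype.ofEquiv _ (QuadraticAlgebra.equivProd (⟨0, 1⟩ : F4) 1).symm

theorem card_F4 : Nat.card F4 = 4 := by rw [Nat.card_eq_fintype_card]; rfl

theorem card_F16 : Nat.card F16 = 16 := by rw [Nat.card_eq_fintype_card]; rfl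

section Trigonal

/-- The point `(t, q)` lies on the cubic cover
`y³ = (b₃x³ + b₂x² + b₁x + b₀)y + x⁵ + c₄x⁴ + c₃x³ + c₂x² + c₁x + c₀`. -/
def Cub {F : Type} [CommRing F] [Algebra (ZMod 2) F] (b₃ b₂ b₁ b₀ c₄ c₃ c₂ c₁ c₀ : ZMod 2) (t q : F) :
    Prop :=
  q ^ 3 = (algebraMap (ZMod 2) F b₃ * t ^ 3 + algebraMap (ZMod 2) F b₂ * t ^ 2 +
    algebraMap (ZMod 2) F b₁ * t + algebraMap (ZMod 2) F b₀) * q +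
    (t ^ 5 + algebraMap (ZMod 2) F c₄ * t ^ 4 + algebraMap (ZMod 2) F c₃ * t ^ 3 +
      algebraMap (ZMod 2) F c₂ * t ^ 2 + algebraMap (ZMod 2) F c₁ * t + algebraMap (ZMod 2) F c₀)

instance {F : Type} [CommRing F] [Algebra (ZMod 2) F] [DecidableEq F]
    (b₃ b₂ b₁ b₀ c₄ c₃ c₂ c₁ c₀ : ZMod 2) (t q : F) :
    Decidable (Cub b₃ b₂ b₁ b₀ c₄ c₃ c₂ c₁ c₀ t q) := inferInstanceAs (Decidable (_ = _))

theorem cub_mem_of_no_points : ∀ b₃ b₂ b₁ b₀ c₄ c₃ c₂ c₁ c₀ : ZMod 2,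
    (∀ t q : ZMod 2, ¬ Cub b₃ b₂ b₁ b₀ c₄ c₃ c₂ c₁ c₀ t q) →
    (∀ q : F4, ¬ Cub b₃ b₂ b₁ b₀ c₄ c₃ c₂ c₁ c₀ ⟨0, 1⟩ q) →
    [b₃, b₂, b₁, b₀, c₄, c₃, c₂, c₁, c₀] ∈ ([[0, 0, 0, 1, 0, 0, 1, 0, 1], [0, 0, 0, 1, 1, 0, 1, 1, 1],
      [0, 1, 1, 1, 0, 1, 0, 0, 1], [0, 1, 1, 1, 0, 1, 1, 1, 1], [0, 1, 1, 1, 1, 1, 0, 1, 1],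
      [0, 1, 1, 1, 1, 1, 1, 0, 1], [1, 0, 1, 1, 0, 0, 1, 0, 1], [1, 0, 1, 1, 1, 0, 1, 1, 1],
      [1, 1, 0, 1, 0, 0, 1, 0, 1], [1, 1, 0, 1, 1, 0, 1, 1, 1]] : List (List (ZMod 2))) := by
  decide +kernel

theorem cub_points_of_mem : ∀ l ∈ ([[0, 0, 0, 1, 0, 0, 1, 0, 1], [0, 0, 0, 1, 1, 0, 1, 1, 1],
      [0, 1, 1, 1, 0, 1, 0, 0, 1], [0, 1, 1, 1, 0, 1, 1, 1, 1], [0, 1, 1, 1, 1, 1, 0, 1, 1],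
      [0, 1, 1, 1, 1, 1, 1, 0, 1], [1, 0, 1, 1, 0, 0, 1, 0, 1], [1, 0, 1, 1, 1, 0, 1, 1, 1],
      [1, 1, 0, 1, 0, 0, 1, 0, 1], [1, 1, 0, 1, 1, 0, 1, 1, 1]] : List (List (ZMod 2))),
    ∃ t q : F16, (t ^ 8 + t) ^ 15 = 1 ∧ Cub (l.getD 0 0) (l.getD 1 0) (l.getD 2 0) (l.getD 3 0)
      (l.getD 4 0) (l.getD 5 0) (l.getD 6 0) (l.getD 7 0) (l.getD 8 0) t q := by
  decide +kernel

theorem cub_points (b₃ b₂ b₁ b₀ c₄ c₃ c₂ c₁ c₀ : ZMod 2) :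
    (∃ t q : ZMod 2, Cub b₃ b₂ b₁ b₀ c₄ c₃ c₂ c₁ c₀ t q) ∨
    (∃ t q : F4, Cub b₃ b₂ b₁ b₀ c₄ c₃ c₂ c₁ c₀ t q) ∨
    ∃ t q : F16, (t ^ 8 + t) ^ 15 = 1 ∧ Cub b₃ b₂ b₁ b₀ c₄ c₃ c₂ c₁ c₀ t q := by
  by_contra! h
  obtain ⟨h1, h2, h3⟩ := h
  obtain ⟨t, q, h4, h5⟩ := cub_points_of_mem _ (cub_mem_of_no_points _ _ _ _ _ _ _ _ _ h1 (h2 ⟨0, 1⟩))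
  exact h3 t q h4 h5

variable {K : Type} [Field K] [Algebra (ZMod 2) K] [FiveGonal K]

theorem Ex.mono {P : Place (ZMod 2) K} {m n : ℤ} {f : K} (h : Ex P m f) (hmn : m < n) (c : ZMod 2) :
    algebraMap (ZMod 2) K c * f ∈ Lp P (n - 1) := by
  have h1 : f ∈ Lp P (n - 1) := Lp_mono P (by omega) h.1
  rcases zmod_two_cases c with rfl | rfl
  · rw [map_zero, zero_mul]; exact zero_mem _
  · rwa [map_one, one_mul]

theorem Ex.add {P : Place (ZMod 2) K} {n : ℤ} {f g : K} (h : Ex P n f) (hg : g ∈ Lp P (n - 1)) :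
    Ex P n (f + g) :=
  ⟨add_mem h.1 (Lp_mono P (by omega) hg), fun h1 => h.2 (by simpa using sub_mem h1 hg)⟩

theorem exists_cub {P : Place (ZMod 2) K} (hP : placeDegree (ZMod 2) P = 1) (h3 : e K 3 = 2) :
    ∃ (x y : K) (b₃ b₂ b₁ b₀ c₄ c₃ c₂ c₁ c₀ : ZMod 2), Ex P 3 x ∧ Ex P 5 y ∧
      Cub b₃ b₂ b₁ b₀ c₄ c₃ c₂ c₁ c₀ x y := by
  have h1 : e K 1 = 1 := le_antisymm e_one_le
    (e_pos (E := pt P) (Finsupp.single_nonneg.mpr zero_le_one) (deg_Lp hP 1))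
  have h2 := e_two_eq_one hP
  have h4 : e K 4 = 2 := by rw [e_four, h2]
  have h5 : e K 5 = 3 := by rw [e_five, h1]
  have h6 := e_six (K := K)
  have h7 : e K 7 = 4 := by have := e_large (K := K) (n := 7) le_rfl; omega
  obtain ⟨x, hx⟩ := exists_ex hP (n := 3) (by norm_num; omega)
  obtain ⟨y, hy⟩ := exists_ex hP (n := 5) (by norm_num; omega)
  have gap7 : Lp P 7 = Lp P 6 := Lp_eq_of_e_eq hP (n := 7) (by norm_num; omega)
  have gap4 : Lp P 4 = Lp P 3 := Lp_eq_of_e_eq hP (n := 4) (by norm_num; omega)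
  have gap2 : Lp P 2 = Lp P 1 := Lp_eq_of_e_eq hP (n := 2) (by norm_num; omega)
  have gap1 : Lp P 1 = Lp P 0 := Lp_eq_of_e_eq hP (n := 1) (by norm_num; rw [e_zero]; omega)
  have f15 : y ^ 3 ∈ Lp P 15 := (hy.pow 3).1
  obtain ⟨c15, f14⟩ := Ex.step hP (hx.pow 5) f15
  obtain ⟨c14, f13⟩ := Ex.step hP ((hx.pow 3).mul hy) f14
  obtain ⟨c13, f12⟩ := Ex.step hP (hx.mul (hy.pow 2)) f13
  obtain ⟨c12, f11⟩ := Ex.step hP (hx.pow 4) f12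
  obtain ⟨c11, f10⟩ := Ex.step hP ((hx.pow 2).mul hy) f11
  obtain ⟨c10, f9⟩ := Ex.step hP (hy.pow 2) f10
  obtain ⟨c9, f8⟩ := Ex.step hP (hx.pow 3) f9
  obtain ⟨c8, f7⟩ := Ex.step hP (hx.mul hy) f8
  replace f6 := gap7.le f7
  obtain ⟨c6, f5⟩ := Ex.step hP (hx.pow 2) f6
  obtain ⟨c5, f4⟩ := Ex.step hP hy f5
  obtain ⟨c3, f2⟩ := Ex.step hP hx (gap4.le f4)
  obtain ⟨c0, f⟩ := Ex.step hP Ex.one (gap1.le (gap2.le f2))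
  have hc15 : c15 = 1 := by
    refine (zmod_two_cases c15).resolve_left ?_
    rintro rfl
    rw [map_zero, zero_mul, add_zero] at f14
    exact (hy.pow 3).2 f14
  have h0 : Lp P (0 - 1) = ⊥ := L_eq_bot (by rw [deg_Lp hP]; norm_num)
  rw [h0, AddSubgroup.mem_bot] at f
  set a := algebraMap (ZMod 2) K with ha
  rw [hc15, map_one] at f
  refine ⟨x, y + a c13 * x + a c10, c14, c11 + c13 ^ 2, c8, c5 + c10 ^ 2, c12 + c14 * c13,
    c9 + c14 * c10 + c11 * c13, c6 + c11 * c10 + c8 * c13, c3 + c8 * c10 + c5 * c13, c0 + c5 * c10, hx, ?_, ?_⟩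
  · refine (hy.add (hx.mono (by norm_num) c13)).add ?_
    simpa using Ex.one.mono (P := P) (n := 5) (by norm_num) c10
  · simp only [Cub, map_add, map_mul, map_pow, ← ha]
    grind


theorem exists_place_of_cub {P : Place (ZMod 2) K} (hP : placeDegree (ZMod 2) P = 1) (h3 : e K 3 = 2)
    {x y : K} {b₃ b₂ b₁ b₀ c₄ c₃ c₂ c₁ c₀ : ZMod 2} (hx : Ex P 3 x) (hy : Ex P 5 y)
    (hxy : Cub b₃ b₂ b₁ b₀ c₄ c₃ c₂ c₁ c₀ x y) {F : Type} [CommRing F] [Nontrivial F] [Finite F]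
    [Algebra (ZMod 2) F] {t q : F} (htq : Cub b₃ b₂ b₁ b₀ c₄ c₃ c₂ c₁ c₀ t q) :
    ∃ Q : Place (ZMod 2) K, Q ≠ P ∧ 2 ^ placeDegree (ZMod 2) Q ≤ Nat.card F ∧
      ∀ g : (ZMod 2)[X], aeval x g ∈ Q.1 ∧ (aeval t g = 0 → aeval x g ∈ fil Q 1) := by
  have h1 : e K 1 = 1 := le_antisymm e_one_le
    (e_pos (E := pt P) (Finsupp.single_nonneg.mpr zero_le_one) (deg_Lp hP 1))
  have h2 := e_two_eq_one hP
  have h4 : e K 4 = 2 := by rw [e_four, h2]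
  have h5 : e K 5 = 3 := by rw [e_five, h1]
  have h6 := e_six (K := K)
  have h7 : e K 7 = 4 := by have := e_large (K := K) (n := 7) le_rfl; omega
  have gap7 : Lp P 7 = Lp P 6 := Lp_eq_of_e_eq hP (n := 7) (by norm_num; omega)
  have gap4 : Lp P 4 = Lp P 3 := Lp_eq_of_e_eq hP (n := 4) (by norm_num; omega)
  have gap2 : Lp P 2 = Lp P 1 := Lp_eq_of_e_eq hP (n := 2) (by norm_num; omega)
  have gap1 : Lp P 1 = Lp P 0 := Lp_eq_of_e_eq hP (n := 1) (by norm_num; rw [e_zero]; omega)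
  let V : K × F := (x, t)
  let Y : K × F := (y, q)
  let B : (ZMod 2)[X] := C b₃ * X ^ 3 + C b₂ * X ^ 2 + C b₁ * X + C b₀
  let D : (ZMod 2)[X] := X ^ 5 + C c₄ * X ^ 4 + C c₃ * X ^ 3 + C c₂ * X ^ 2 + C c₁ * X + C c₀
  have hY : Y ^ 3 = aeval V B * Y + aeval V D := by
    refine Prod.ext ?_ ?_
    · rw [Prod.fst_add, Prod.fst_mul]
      simpa [V, Y, B, D, Cub] using hxy
    · simpa [V, Y, B, D, Cub] using htq
  refine exists_place_of_basis hP (N := 3) (by norm_num) (X := V) hx ![1, Y, Y ^ 2] ![0, 5, 10] ?_ ?_ ?_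
    ⟨0, rfl⟩ ?_
  · intro i
    fin_cases i
    · exact Ex.one
    · exact hy
    · exact hy.pow 2
  · decide
  · intro n hn
    by_cases hn8 : n < 8
    · interval_cases n
      · exact .inl (by simpa using gap1)
      · exact .inl (by simpa using gap2)
      · exact .inr ⟨0, 1, rfl⟩
      · exact .inl (by simpa using gap4)
      · exact .inr ⟨1, 0, rfl⟩
      · exact .inr ⟨0, 2, rfl⟩
      · exact .inl (by simpa using gap7)
    · right
      have : n % 3 = 0 ∨ n % 3 = 1 ∨ n % 3 = 2 := by omega
      rcases this with h | h | h
      · exact ⟨0, n / 3, by simp; omega⟩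
      · exact ⟨2, (n - 10) / 3, by simp; omega⟩
      · exact ⟨1, (n - 5) / 3, by simp; omega⟩
  · have h01 : ∀ k : Fin 3, ∃ g : Fin 3 → (ZMod 2)[X], ![1, Y, Y ^ 2] k = ∑ l, aeval V (g l) * ![1, Y, Y ^ 2] l :=
      fun k => ⟨Pi.single k 1, by fin_cases k <;> simp [Fin.sum_univ_three]⟩
    have h3 : ∃ g : Fin 3 → (ZMod 2)[X], Y * Y ^ 2 = ∑ l, aeval V (g l) * ![1, Y, Y ^ 2] l :=
      ⟨![D, B, 0], by simp [Fin.sum_univ_three]; linear_combination hY⟩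
    have h4 : ∃ g : Fin 3 → (ZMod 2)[X], Y ^ 2 * Y ^ 2 = ∑ l, aeval V (g l) * ![1, Y, Y ^ 2] l :=
      ⟨![0, D, B], by simp [Fin.sum_univ_three]; linear_combination Y * hY⟩
    intro i j
    fin_cases i <;> fin_cases j
    · simpa using h01 0
    · simpa using h01 1
    · simpa using h01 2
    · simpa using h01 1
    · simpa [sq] using h01 2
    · simpa using h3
    · simpa using h01 2
    · simpa [mul_comm] using h3
    · simpa using h4

theorem e_three_ne_two {P : Place (ZMod 2) K} (hP : placeDegree (ZMod 2) P = 1) : e K 3 ≠ 2 := by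
  intro h3
  obtain ⟨x, y, b₃, b₂, b₁, b₀, c₄, c₃, c₂, c₁, c₀, hx, hy, hxy⟩ := exists_cub hP h3
  have h1 : e K 1 = 1 := le_antisymm e_one_le
    (e_pos (E := pt P) (Finsupp.single_nonneg.mpr zero_le_one) (deg_Lp hP 1))
  have h2 := e_two_eq_one hP
  have h4 : e K 4 = 2 := by rw [e_four, h2]
  have gap : ∀ {Q : Place (ZMod 2) K}, Q ≠ P → placeDegree (ZMod 2) Q ≤ 4 → placeDegree (ZMod 2) Q = 3 := by
    intro Q hQ hd
    have := placeDegree_pos Q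
    interval_cases h : placeDegree (ZMod 2) Q
    · exact absurd (eq_of_placeDegree_eq_one hP h) hQ
    · exact absurd (eq_of_gap hP (n := 2) (by norm_num; omega) (by rw [h]; rfl)) hQ
    · rfl
    · exact absurd (eq_of_gap hP (n := 4) (by norm_num; omega) (by rw [h]; rfl)) hQ
  rcases cub_points b₃ b₂ b₁ b₀ c₄ c₃ c₂ c₁ c₀ with ⟨t, q, htq⟩ | ⟨t, q, htq⟩ | ⟨t, q, ht, htq⟩
  · obtain ⟨Q, hQ, hd, -⟩ := exists_place_of_cub hP h3 hx hy hxy htq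
    rw [Nat.card_zmod] at hd
    replace hd := (Nat.pow_le_pow_iff_right one_lt_two (m := 1)).mp hd
    have := gap hQ (by omega)
    omega
  · obtain ⟨Q, hQ, hd, -⟩ := exists_place_of_cub hP h3 hx hy hxy htq
    rw [card_F4, show 4 = 2 ^ 2 by norm_num, Nat.pow_le_pow_iff_right (by norm_num)] at hd
    have := gap hQ (by omega)
    omega
  · obtain ⟨Q, hQ, hd, hg⟩ := exists_place_of_cub hP h3 hx hy hxy htq
    rw [card_F16, show 16 = 2 ^ 4 by norm_num, Nat.pow_le_pow_iff_right (by norm_num)] at hd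
    have hQ3 := gap hQ hd
    have hx : x ∈ Q.1 := by simpa using (hg X).1
    have h8 : resAt Q x ^ 8 = resAt Q x := by
      have : Fintype (Res Q) := Fintype.ofFinite _
      have := FiniteField.pow_card (resAt Q x)
      rwa [← Nat.card_eq_fintype_card, card_res, hQ3] at this
    have h15 : (x ^ 8 + x) ^ 15 + 1 ∈ fil Q 1 := by
      have := (hg ((X ^ 8 + X) ^ 15 + 1)).2 (by
        simp only [map_add, map_pow, map_one, aeval_X]
        rw [ht]
        decide)
      simpa using this
    have hx8 : x ^ 8 + x ∈ Q.1 := add_mem (pow_mem hx 8) hx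
    rw [← resAt_eq_zero_iff (add_mem (pow_mem hx8 15) (one_mem _)), resAt_add (pow_mem hx8 15) (one_mem _),
      resAt_pow hx8, resAt_add (pow_mem hx 8) hx, resAt_pow hx, h8, CharTwo.add_self_eq_zero] at h15
    simp at h15

end Trigonal
end CFF

namespace CFF

open Polynomial IsLocalRing

section Tetragonal

/-- The point `(x, y, z)` lies on the space curve `y² = xz + a₅y + a₀`,
`z² = x³ + b₁₁yz + b₁₀xz + b₉xy + b₈x² + b₆z + b₅y + b₄x + b₀`. -/
def Qrt {F : Type} [CommRing F] [Algebra (ZMod 2) F] (a₅ a₀ b₁₁ b₁₀ b₉ b₈ b₆ b₅ b₄ b₀ : ZMod 2) (x y z : F) :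
    Prop :=
  y ^ 2 = x * z + algebraMap (ZMod 2) F a₅ * y + algebraMap (ZMod 2) F a₀ ∧
  z ^ 2 = x ^ 3 + algebraMap (ZMod 2) F b₁₁ * (y * z) + algebraMap (ZMod 2) F b₁₀ * (x * z) +
    algebraMap (ZMod 2) F b₉ * (x * y) + algebraMap (ZMod 2) F b₈ * x ^ 2 + algebraMap (ZMod 2) F b₆ * z +
    algebraMap (ZMod 2) F b₅ * y + algebraMap (ZMod 2) F b₄ * x + algebraMap (ZMod 2) F b₀

instance {F : Type} [CommRing F] [Algebra (ZMod 2) F] [DecidableEq F]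
    (a₅ a₀ b₁₁ b₁₀ b₉ b₈ b₆ b₅ b₄ b₀ : ZMod 2) (x y z : F) :
    Decidable (Qrt a₅ a₀ b₁₁ b₁₀ b₉ b₈ b₆ b₅ b₄ b₀ x y z) := inferInstanceAs (Decidable (_ ∧ _))

set_option synthInstance.maxSize 4096 in
theorem qrt_mem_of_no_points : ∀ a₅ a₀ b₁₁ b₁₀ b₉ b₈ b₆ b₅ b₄ b₀ : ZMod 2,
    (∀ x y z : ZMod 2, ¬ Qrt a₅ a₀ b₁₁ b₁₀ b₉ b₈ b₆ b₅ b₄ b₀ x y z) →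
    (∀ y z : F4, ¬ Qrt a₅ a₀ b₁₁ b₁₀ b₉ b₈ b₆ b₅ b₄ b₀ 0 y z) →
    (¬ Qrt a₅ a₀ b₁₁ b₁₀ b₉ b₈ b₆ b₅ b₄ b₀ (1 : F4) ⟨0, 1⟩ 0) →
    (∀ y z : F4, ¬ Qrt a₅ a₀ b₁₁ b₁₀ b₉ b₈ b₆ b₅ b₄ b₀ ⟨0, 1⟩ y z) →
    [a₅, a₀, b₁₁, b₁₀, b₉, b₈, b₆, b₅, b₄, b₀] ∈ ([[1, 1, 0, 0, 1, 1, 1, 1, 0, 1],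
      [1, 1, 0, 0, 1, 1, 1, 1, 1, 0], [1, 1, 1, 0, 1, 0, 0, 0, 0, 1], [1, 1, 1, 0, 1, 0, 1, 0, 1, 1],
      [1, 1, 1, 1, 0, 1, 0, 1, 1, 0], [1, 1, 1, 1, 0, 1, 1, 1, 1, 1]] : List (List (ZMod 2))) := by
  decide +kernel

/-- The field with eight elements. -/
abbrev F8 := AdjoinRoot (X ^ 3 + X + 1 : (ZMod 2)[X])

theorem monic_F8 : (X ^ 3 + X + 1 : (ZMod 2)[X]).Monic := by monicity!

theorem natDegree_F8 : (X ^ 3 + X + 1 : (ZMod 2)[X]).natDegree = 3 := by compute_degree!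

instance : Nontrivial F8 := AdjoinRoot.nontrivial _ (by
  rw [degree_eq_natDegree monic_F8.ne_zero, natDegree_F8]; norm_num)

instance : Finite F8 :=
  have := (AdjoinRoot.powerBasis' monic_F8).finite
  Module.finite_of_finite (ZMod 2)

theorem card_F8 : Nat.card F8 = 8 := by
  have := (AdjoinRoot.powerBasis' monic_F8).finite
  rw [Module.natCard_eq_pow_finrank (K := ZMod 2), (AdjoinRoot.powerBasis' monic_F8).finrank,
    AdjoinRoot.powerBasis'_dim, natDegree_F8, Nat.card_zmod]
  norm_num

theorem qrt_points_F8 {a₅ a₀ b₁₁ b₁₀ b₉ b₈ b₆ b₅ b₄ b₀ : ZMod 2}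
    (h : [a₅, a₀, b₁₁, b₁₀, b₉, b₈, b₆, b₅, b₄, b₀] ∈ ([[1, 1, 0, 0, 1, 1, 1, 1, 0, 1],
      [1, 1, 0, 0, 1, 1, 1, 1, 1, 0], [1, 1, 1, 0, 1, 0, 0, 0, 0, 1], [1, 1, 1, 0, 1, 0, 1, 0, 1, 1],
      [1, 1, 1, 1, 0, 1, 0, 1, 1, 0], [1, 1, 1, 1, 0, 1, 1, 1, 1, 1]] : List (List (ZMod 2)))) :
    ∃ x y z : F8, Qrt a₅ a₀ b₁₁ b₁₀ b₉ b₈ b₆ b₅ b₄ b₀ x y z := by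
  have : CharP F8 2 := charP_of_injective_algebraMap (algebraMap (ZMod 2) F8).injective 2
  obtain ⟨t, ht⟩ : ∃ t : F8, t ^ 3 + t + 1 = 0 := ⟨AdjoinRoot.root _, by
    have := AdjoinRoot.eval₂_root (X ^ 3 + X + 1 : (ZMod 2)[X])
    simpa using this⟩
  simp only [List.mem_cons, List.cons.injEq, List.not_mem_nil, or_false, and_true] at h
  rcases h with h | h | h | h | h | h <;>
    obtain ⟨rfl, rfl, rfl, rfl, rfl, rfl, rfl, rfl, rfl, rfl⟩ := h
  · exact ⟨t, t ^ 2 + 1, t ^ 2, by simp only [Qrt, map_zero, map_one]; constructor <;> grind⟩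
  · exact ⟨t, t ^ 2, t ^ 2, by simp only [Qrt, map_zero, map_one]; constructor <;> grind⟩
  · exact ⟨t + 1, t ^ 2 + t, t + 1, by simp only [Qrt, map_zero, map_one]; constructor <;> grind⟩
  · exact ⟨t + 1, t ^ 2 + t, t + 1, by simp only [Qrt, map_zero, map_one]; constructor <;> grind⟩
  · exact ⟨t + 1, t ^ 2, 1, by simp only [Qrt, map_zero, map_one]; constructor <;> grind⟩
  · exact ⟨t + 1, t ^ 2, 1, by simp only [Qrt, map_zero, map_one]; constructor <;> grind⟩

theorem qrt_points (a₅ a₀ b₁₁ b₁₀ b₉ b₈ b₆ b₅ b₄ b₀ : ZMod 2) :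
    (∃ x y z : ZMod 2, Qrt a₅ a₀ b₁₁ b₁₀ b₉ b₈ b₆ b₅ b₄ b₀ x y z) ∨
    (∃ x y z : F4, Qrt a₅ a₀ b₁₁ b₁₀ b₉ b₈ b₆ b₅ b₄ b₀ x y z) ∨
    ∃ x y z : F8, Qrt a₅ a₀ b₁₁ b₁₀ b₉ b₈ b₆ b₅ b₄ b₀ x y z := by
  by_contra! h
  obtain ⟨h1, h2, h3⟩ := h
  obtain ⟨x, y, z, h⟩ := qrt_points_F8
    (qrt_mem_of_no_points _ _ _ _ _ _ _ _ _ _ h1 (h2 0) (h2 _ _ _) (h2 _))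
  exact h3 x y z h

variable {K : Type} [Field K] [Algebra (ZMod 2) K] [FiveGonal K]

theorem qrt_identity {x y z c₀ c₄ c₅ c₆ c₈ c₉ : K} (h : c₆ ^ 2 = c₆)
    (f : y ^ 2 + 1 * (x * z) + c₉ * (x * y) + c₈ * x ^ 2 + c₆ * z + c₅ * y + c₄ * x + c₀ * 1 = 0) :
    y ^ 2 = (x + c₆) * (z + c₉ * y + c₈ * (x + c₆) + c₄) + (c₅ + c₆ * c₉) * y +
      (c₀ + c₄ * c₆ + c₈ * c₆) := by
  grind

theorem exists_qrt {P : Place (ZMod 2) K} (hP : placeDegree (ZMod 2) P = 1) (h3 : e K 3 = 1) :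
    ∃ (x y z : K) (a₅ a₀ b₁₁ b₁₀ b₉ b₈ b₆ b₅ b₄ b₀ : ZMod 2), Ex P 4 x ∧ Ex P 5 y ∧ Ex P 6 z ∧
      Qrt a₅ a₀ b₁₁ b₁₀ b₉ b₈ b₆ b₅ b₄ b₀ x y z := by
  have h1 : e K 1 = 1 := le_antisymm e_one_le
    (e_pos (E := pt P) (Finsupp.single_nonneg.mpr zero_le_one) (deg_Lp hP 1))
  have h2 := e_two_eq_one hP
  have h4 : e K 4 = 2 := by rw [e_four, h2]
  have h5 : e K 5 = 3 := by rw [e_five, h1]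
  have h6 := e_six (K := K)
  have h7 : e K 7 = 4 := by have := e_large (K := K) (n := 7) le_rfl; omega
  obtain ⟨x, hx⟩ := exists_ex hP (n := 4) (by norm_num; omega)
  obtain ⟨y, hy⟩ := exists_ex hP (n := 5) (by norm_num; omega)
  obtain ⟨z, hz⟩ := exists_ex hP (n := 6) (by norm_num; omega)
  have gap7 : Lp P 7 = Lp P 6 := Lp_eq_of_e_eq hP (n := 7) (by norm_num; omega)
  have gap3 : Lp P 3 = Lp P 2 := Lp_eq_of_e_eq hP (n := 3) (by norm_num; omega)
  have gap2 : Lp P 2 = Lp P 1 := Lp_eq_of_e_eq hP (n := 2) (by norm_num; omega)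
  have gap1 : Lp P 1 = Lp P 0 := Lp_eq_of_e_eq hP (n := 1) (by norm_num; rw [e_zero]; omega)
  have h0 : Lp P (0 - 1) = ⊥ := L_eq_bot (by rw [deg_Lp hP]; norm_num)
  set a := algebraMap (ZMod 2) K with ha
  obtain ⟨c10, f9⟩ := Ex.step hP (hx.mul hz) (hy.pow 2).1
  obtain ⟨c9, f8⟩ := Ex.step hP (hx.mul hy) f9
  obtain ⟨c8, f7⟩ := Ex.step hP (hx.pow 2) f8
  obtain ⟨c6, f5⟩ := Ex.step hP hz (gap7.le f7)
  obtain ⟨c5, f4⟩ := Ex.step hP hy f5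
  obtain ⟨c4, f3⟩ := Ex.step hP hx f4
  obtain ⟨c0, f⟩ := Ex.step hP Ex.one (gap1.le (gap2.le (gap3.le f3)))
  rw [h0, AddSubgroup.mem_bot] at f
  have hc10 : c10 = 1 := by
    refine (zmod_two_cases c10).resolve_left ?_
    rintro rfl
    rw [map_zero, zero_mul, add_zero] at f9
    exact (hy.pow 2).2 f9
  rw [hc10, map_one] at f
  obtain ⟨x', hx'⟩ : ∃ x', x' = x + a c6 := ⟨_, rfl⟩
  obtain ⟨z', hz'⟩ : ∃ z', z' = z + a c9 * y + a c8 * x' + a c4 := ⟨_, rfl⟩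
  have kx : Ex P 4 x' := by
    rw [hx']
    exact hx.add (by simpa using Ex.one.mono (P := P) (n := 4) (by norm_num) c6)
  have kz : Ex P 6 z' := by
    rw [hz']
    refine ((hz.add (hy.mono (by norm_num) c9)).add (kx.mono (by norm_num) c8)).add ?_
    simpa using Ex.one.mono (P := P) (n := 6) (by norm_num) c4
  obtain ⟨b12, g11⟩ := Ex.step hP (kx.pow 3) (kz.pow 2).1
  obtain ⟨b11, g10⟩ := Ex.step hP (hy.mul kz) g11
  obtain ⟨b10, g9⟩ := Ex.step hP (kx.mul kz) g10
  obtain ⟨b9, g8⟩ := Ex.step hP (kx.mul hy) g9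
  obtain ⟨b8, g7⟩ := Ex.step hP (kx.pow 2) g8
  obtain ⟨b6, g5⟩ := Ex.step hP kz (gap7.le g7)
  obtain ⟨b5, g4⟩ := Ex.step hP hy g5
  obtain ⟨b4, g3⟩ := Ex.step hP kx g4
  obtain ⟨b0, g⟩ := Ex.step hP Ex.one (gap1.le (gap2.le (gap3.le g3)))
  rw [h0, AddSubgroup.mem_bot] at g
  have hb12 : b12 = 1 := by
    refine (zmod_two_cases b12).resolve_left ?_
    rintro rfl
    rw [map_zero, zero_mul, add_zero] at g11
    exact (kz.pow 2).2 g11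
  rw [hb12, map_one] at g
  refine ⟨x', y, z', c5 + c6 * c9, c0 + c4 * c6 + c8 * c6, b11, b10, b9, b8, b6, b5, b4, b0, kx, hy, kz, ?_, ?_⟩
  · have hq : ∀ c : ZMod 2, a c ^ 2 = a c := fun c => by
      rcases zmod_two_cases c with rfl | rfl <;> simp
    have q6 := hq c6
    simp only [map_add, map_mul, ← ha]
    rw [hz', hx']
    exact qrt_identity q6 f
  · clear_value a
    grind

theorem exists_place_of_qrt {P : Place (ZMod 2) K} (hP : placeDegree (ZMod 2) P = 1) (h3 : e K 3 = 1)
    {x y z : K} {a₅ a₀ b₁₁ b₁₀ b₉ b₈ b₆ b₅ b₄ b₀ : ZMod 2} (hx : Ex P 4 x) (hy : Ex P 5 y) (hz : Ex P 6 z)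
    (hxyz : Qrt a₅ a₀ b₁₁ b₁₀ b₉ b₈ b₆ b₅ b₄ b₀ x y z) {F : Type} [CommRing F] [Nontrivial F] [Finite F]
    [Algebra (ZMod 2) F] {x' y' z' : F} (hF : Qrt a₅ a₀ b₁₁ b₁₀ b₉ b₈ b₆ b₅ b₄ b₀ x' y' z') :
    ∃ Q : Place (ZMod 2) K, Q ≠ P ∧ 2 ^ placeDegree (ZMod 2) Q ≤ Nat.card F := by
  have h1 : e K 1 = 1 := le_antisymm e_one_le
    (e_pos (E := pt P) (Finsupp.single_nonneg.mpr zero_le_one) (deg_Lp hP 1))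
  have h2 := e_two_eq_one hP
  have h4 : e K 4 = 2 := by rw [e_four, h2]
  have h5 : e K 5 = 3 := by rw [e_five, h1]
  have h6 := e_six (K := K)
  have h7 : e K 7 = 4 := by have := e_large (K := K) (n := 7) le_rfl; omega
  have gap7 : Lp P 7 = Lp P 6 := Lp_eq_of_e_eq hP (n := 7) (by norm_num; omega)
  have gap3 : Lp P 3 = Lp P 2 := Lp_eq_of_e_eq hP (n := 3) (by norm_num; omega)
  have gap2 : Lp P 2 = Lp P 1 := Lp_eq_of_e_eq hP (n := 2) (by norm_num; omega)
  have gap1 : Lp P 1 = Lp P 0 := Lp_eq_of_e_eq hP (n := 1) (by norm_num; rw [e_zero]; omega)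
  let V : K × F := (x, x')
  let Y : K × F := (y, y')
  let Z : K × F := (z, z')
  let u : Fin 4 → K × F := ![1, Y, Z, Y * Z]
  have hY : Y ^ 2 = aeval V (X : (ZMod 2)[X]) * Z + aeval V (C a₅) * Y + aeval V (C a₀) * 1 := by
    refine Prod.ext ?_ ?_
    · simpa [V, Y, Z] using hxyz.1
    · simpa [V, Y, Z] using hF.1
  have hZ : Z ^ 2 = aeval V (C b₁₁) * (Y * Z) + aeval V (C b₁₀ * X + C b₆) * Z +
      aeval V (C b₉ * X + C b₅) * Y + aeval V (X ^ 3 + C b₈ * X ^ 2 + C b₄ * X + C b₀) * 1 := by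
    have e1 := hxyz.2
    have e2 := hF.2
    refine Prod.ext ?_ ?_
    · simp [V, Y, Z]; linear_combination e1
    · simp [V, Y, Z]; linear_combination e2
  let S : K × F → Prop := fun s => ∃ g : Fin 4 → (ZMod 2)[X], s = ∑ l, aeval V (g l) * u l
  have Sadd : ∀ {s t}, S s → S t → S (s + t) := by
    rintro _ _ ⟨g, rfl⟩ ⟨h, rfl⟩
    exact ⟨g + h, by simp [add_mul, Finset.sum_add_distrib]⟩
  have Smul : ∀ p : (ZMod 2)[X], ∀ {s}, S s → S (aeval V p * s) := by
    rintro p _ ⟨g, rfl⟩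
    exact ⟨fun l => p * g l, by simp [Finset.mul_sum, mul_assoc]⟩
  have Su : ∀ k, S (u k) := fun k => ⟨Pi.single k 1, by
    rw [Finset.sum_eq_single k]
    · simp
    · intro j _ hj; rw [Pi.single_eq_of_ne hj]; simp
    · simp⟩
  have S1 : S 1 := Su 0
  have SY : S Y := Su 1
  have SZ : S Z := Su 2
  have SYZ : S (Y * Z) := Su 3
  have SY2 : S (Y ^ 2) := hY ▸ Sadd (Sadd (Smul _ SZ) (Smul _ SY)) (Smul _ S1)
  have SZ2 : S (Z ^ 2) := hZ ▸ Sadd (Sadd (Sadd (Smul _ SYZ) (Smul _ SZ)) (Smul _ SY)) (Smul _ S1)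
  have SY2Z : S (Y ^ 2 * Z) := by
    have := Sadd (Sadd (Smul X SZ2) (Smul (C a₅) SYZ)) (Smul (C a₀) SZ)
    convert this using 1
    linear_combination Z * hY
  have SYZ2 : S (Y * Z ^ 2) := by
    have := Sadd (Sadd (Sadd (Smul (C b₁₁) SY2Z) (Smul (C b₁₀ * X + C b₆) SYZ)) (Smul (C b₉ * X + C b₅) SY2))
      (Smul (X ^ 3 + C b₈ * X ^ 2 + C b₄ * X + C b₀) SY)
    convert this using 1
    linear_combination Y * hZ
  have SZ3 : S (Z ^ 3) := by
    have := Sadd (Sadd (Sadd (Smul (C b₁₁) SYZ2) (Smul (C b₁₀ * X + C b₆) SZ2)) (Smul (C b₉ * X + C b₅) SYZ))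
      (Smul (X ^ 3 + C b₈ * X ^ 2 + C b₄ * X + C b₀) SZ)
    convert this using 1
    linear_combination Z * hZ
  have SY2Z2 : S (Y ^ 2 * Z ^ 2) := by
    have := Sadd (Sadd (Smul X SZ3) (Smul (C a₅) SYZ2)) (Smul (C a₀) SZ2)
    convert this using 1
    linear_combination Z ^ 2 * hY
  have hyz : Ex P 11 (y * z) := by
    have := hy.mul hz
    rwa [show (5 : ℤ) + 6 = 11 by norm_num] at this
  obtain ⟨Q, hQ, hd, -⟩ := exists_place_of_basis hP (N := 4) (by norm_num) (X := V) hx u ![0, 5, 6, 11] (by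
    intro i
    fin_cases i
    · exact Ex.one
    · exact hy
    · exact hz
    · exact hyz) (by decide) (by
    intro n hn
    by_cases hn8 : n < 8
    · interval_cases n
      · exact .inl (by simpa using gap1)
      · exact .inl (by simpa using gap2)
      · exact .inl (by simpa using gap3)
      · exact .inr ⟨0, 1, rfl⟩
      · exact .inr ⟨1, 0, rfl⟩
      · exact .inr ⟨2, 0, rfl⟩
      · exact .inl (by simpa using gap7)
    · right
      have : n % 4 = 0 ∨ n % 4 = 1 ∨ n % 4 = 2 ∨ n % 4 = 3 := by omega
      rcases this with h | h | h | h
      · exact ⟨0, n / 4, by simp; omega⟩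
      · exact ⟨1, (n - 5) / 4, by simp; omega⟩
      · exact ⟨2, (n - 6) / 4, by simp; omega⟩
      · exact ⟨3, (n - 11) / 4, by simp; omega⟩)
    ⟨0, rfl⟩ (by
    intro i j
    change S (u i * u j)
    fin_cases i <;> fin_cases j <;> simp only [u, Fin.isValue, Fin.mk_one, Fin.zero_eta, Fin.reduceFinMk,
      Matrix.cons_val]
    · simpa using S1
    · simpa using SY
    · simpa using SZ
    · simpa using SYZ
    · simpa using SY
    · simpa [sq] using SY2
    · exact SYZ
    · rw [show Y * (Y * Z) = Y ^ 2 * Z by ring]; exact SY2Z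
    · simpa using SZ
    · rw [mul_comm]; exact SYZ
    · simpa [sq] using SZ2
    · rw [show Z * (Y * Z) = Y * Z ^ 2 by ring]; exact SYZ2
    · simpa using SYZ
    · rw [show Y * Z * Y = Y ^ 2 * Z by ring]; exact SY2Z
    · rw [show Y * Z * Z = Y * Z ^ 2 by ring]; exact SYZ2
    · rw [show Y * Z * (Y * Z) = Y ^ 2 * Z ^ 2 by ring]; exact SY2Z2)
  exact ⟨Q, hQ, hd⟩

theorem e_three_ne_one {P : Place (ZMod 2) K} (hP : placeDegree (ZMod 2) P = 1) : e K 3 ≠ 1 := by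
  intro h3
  obtain ⟨x, y, z, a₅, a₀, b₁₁, b₁₀, b₉, b₈, b₆, b₅, b₄, b₀, hx, hy, hz, hxyz⟩ := exists_qrt hP h3
  have h1 : e K 1 = 1 := le_antisymm e_one_le
    (e_pos (E := pt P) (Finsupp.single_nonneg.mpr zero_le_one) (deg_Lp hP 1))
  have h2 := e_two_eq_one hP
  have gap : ∀ {Q : Place (ZMod 2) K}, Q ≠ P → ¬ 2 ^ placeDegree (ZMod 2) Q ≤ 2 ^ 3 := by
    intro Q hQ hd
    rw [Nat.pow_le_pow_iff_right one_lt_two] at hd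
    have := placeDegree_pos Q
    interval_cases h : placeDegree (ZMod 2) Q
    · exact hQ (eq_of_placeDegree_eq_one hP h)
    · exact hQ (eq_of_gap hP (n := 2) (by norm_num; omega) (by rw [h]; rfl))
    · exact hQ (eq_of_gap hP (n := 3) (by norm_num; omega) (by rw [h]; rfl))
  rcases qrt_points a₅ a₀ b₁₁ b₁₀ b₉ b₈ b₆ b₅ b₄ b₀ with ⟨x', y', z', h⟩ | ⟨x', y', z', h⟩ | ⟨x', y', z', h⟩
  · obtain ⟨Q, hQ, hd⟩ := exists_place_of_qrt hP h3 hx hy hz hxyz h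
    rw [Nat.card_zmod] at hd
    exact gap hQ (hd.trans (by norm_num))
  · obtain ⟨Q, hQ, hd⟩ := exists_place_of_qrt hP h3 hx hy hz hxyz h
    rw [card_F4] at hd
    exact gap hQ (hd.trans (by norm_num))
  · obtain ⟨Q, hQ, hd⟩ := exists_place_of_qrt hP h3 hx hy hz hxyz h
    rw [card_F8] at hd
    exact gap hQ (hd.trans (by norm_num))

variable (K) in
theorem e_one : e K 1 = 0 := by
  by_contra h0
  have h1 : e K 1 = 1 := by have := e_one_le (K := K); omega
  obtain ⟨P, hP⟩ := exists_place_of_e_one h1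
  have h2 := e_two_eq_one hP
  have h3 := e_le_add_pdeg P 2
  rw [pdeg, hP, Nat.cast_one] at h3
  have h4 := e_pos (E := Finsupp.single P 3) (Finsupp.single_nonneg.mpr (by norm_num)) (deg_Lp hP 3)
  have h5 := e_three_ne_one hP
  have h6 := e_three_ne_two hP
  norm_num at h3
  omega

variable (K) in
theorem e_five_eq : e K 5 = 2 := by rw [e_five, e_one]

end Tetragonal
end CFF

namespace CFF

open Polynomial IsLocalRing

section FiniteField

/-- Artin's theorem for a finite field with a semilinear automorphism of prime order. -/
theorem card_fixed_pow {κ : Type*} [Field κ] [Finite κ] {ℓ : ℕ} (hℓ : ℓ.Prime) (φ : κ ≃+* κ)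
    (hφ : φ ^ ℓ = 1) (h1 : φ ≠ 1) : Nat.card {a | φ a = a} ^ ℓ = Nat.card κ := by
  have : Fintype κ := Fintype.ofFinite κ
  let G := Subgroup.zpowers φ
  have hcard : Nat.card G = ℓ := by
    rw [Nat.card_zpowers]
    have : Fact ℓ.Prime := ⟨hℓ⟩
    exact orderOf_eq_prime hφ h1
  have : Finite (κ ≃+* κ) := Finite.of_injective (fun f => (f : κ → κ)) DFunLike.coe_injective
  have : Fintype G := Fintype.ofFinite G
  have h2 := FixedPoints.finrank_eq_card G κ
  rw [← Nat.card_eq_fintype_card, hcard] at h2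
  have h3 := Module.natCard_eq_pow_finrank (K := FixedPoints.subfield G κ) (V := κ)
  rw [h2] at h3
  rw [h3]
  congr 1
  refine Nat.card_congr (Equiv.setCongr ?_)
  ext a
  constructor
  · intro ha
    rintro ⟨g, n, rfl⟩
    change (φ ^ n) a = a
    have : φ ∈ MulAction.stabilizer (κ ≃+* κ) a := ha
    exact zpow_mem this n
  · intro ha
    exact ha ⟨φ, Subgroup.mem_zpowers φ⟩

end FiniteField

section Action

variable {K : Type} [Field K] [Algebra (ZMod 2) K] [FunctionFieldTwo K]

/-- The image of a place under an automorphism. -/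
def mv (σ : K ≃ₐ[ZMod 2] K) (P : Place (ZMod 2) K) : Place (ZMod 2) K :=
  ⟨P.1.comap (σ.symm : K →+* K), fun h => P.2.1 <| by
    refine top_unique fun x _ => ?_
    have : σ x ∈ P.1.comap (σ.symm : K →+* K) := h ▸ ValuationSubring.mem_top _
    rw [ValuationSubring.mem_comap] at this
    simpa using this,
    fun c => by rw [ValuationSubring.mem_comap]; simpa using P.2.2 c⟩

variable (σ : K ≃ₐ[ZMod 2] K) (P : Place (ZMod 2) K)

variable {P} in
theorem map_mem_mv {f : K} : σ f ∈ (mv σ P).1 ↔ f ∈ P.1 := by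
  change σ f ∈ P.1.comap (σ.symm : K →+* K) ↔ f ∈ P.1
  rw [ValuationSubring.mem_comap]
  simp

theorem mv_symm : mv σ (mv σ.symm P) = P := by
  refine Subtype.ext (SetLike.ext fun x => ?_)
  obtain ⟨y, rfl⟩ := σ.surjective x
  refine (map_mem_mv σ (P := mv σ.symm P)).trans ?_
  have := map_mem_mv σ.symm (P := P) (f := σ y)
  rwa [AlgEquiv.symm_apply_apply] at this

theorem isU_mv {u : K} : IsU (mv σ P) (σ u) ↔ IsU P u := by
  rw [IsU, IsU, map_mem_mv, ← map_inv₀, map_mem_mv, _root_.map_ne_zero]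

theorem ordAt_mv (f : K) : ordAt (mv σ P).1 (σ f) = ordAt P.1 f := by
  by_cases hf0 : f = 0
  · rw [hf0, map_zero, ordAt_zero, ordAt_zero]
  obtain ⟨t, ht, htP, htn, h1, h2⟩ := exists_unif P
  have key : ∀ f ≠ 0, ordAt (mv σ P).1 (σ f) = ordAt P.1 f * ordAt (mv σ P).1 (σ t) := by
    intro f hf
    obtain ⟨n, u, hu, rfl⟩ := h2 f hf
    have hz : ordAt (mv σ P).1 (σ t ^ n) = n * ordAt (mv σ P).1 (σ t) := by
      rcases Int.le_total 0 n with hn | hn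
      · lift n to ℕ using hn
        rw [zpow_natCast, ordAt_pow]
      · obtain ⟨k, rfl⟩ : ∃ k : ℕ, n = -(k : ℤ) := ⟨n.natAbs, by omega⟩
        rw [zpow_neg, zpow_natCast, ordAt_inv, ordAt_pow]; ring
    rw [h1 n u hu, map_mul, map_zpow₀, ordAt_mul _ (zpow_ne_zero _ (by simpa using ht))
      (by simpa using hu.1), hz, isU_of_ordAt _ ((isU_mv σ P).mpr hu), add_zero]
  have hpos : 0 < ordAt (mv σ P).1 (σ t) := by
    rw [ordAt_pos_iff (by simpa using ht), ← map_inv₀, map_mem_mv]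
    exact htn
  obtain ⟨s, hs0, hs⟩ := exists_ordAt_eq (mv σ P) 1
  have h3 := key (σ.symm s) (by simpa using hs0)
  rw [AlgEquiv.apply_symm_apply, hs] at h3
  have h4 : ordAt (mv σ P).1 (σ t) = 1 :=
    Int.eq_one_of_mul_eq_one_left hpos.le h3.symm
  rw [key f hf0, h4, mul_one]

variable {P} in
theorem map_mem_fil_mv {f : K} {n : ℤ} : σ f ∈ fil (mv σ P) n ↔ f ∈ fil P n := by
  rw [mem_fil, mem_fil, ordAt_mv, map_eq_zero]

theorem pdeg_mv : pdeg (mv σ P) = pdeg P := by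
  have h : ∀ n, (fil P n).map (σ : K →+ K) = fil (mv σ P) n := by
    intro n
    ext x
    obtain ⟨y, rfl⟩ := σ.surjective x
    rw [map_mem_fil_mv]
    exact ⟨fun ⟨z, hz, e⟩ => σ.injective e ▸ hz, fun hy => ⟨y, hy, rfl⟩⟩
  have h1 := relIndex_fil (mv σ P) 0
  rw [← h, ← h, AddSubgroup.relIndex_map_map_of_injective _ _ σ.injective, relIndex_fil] at h1
  exact (Nat.pow_right_injective le_rfl h1).symm

variable {σ P}

theorem map_mem_iff (hP : mv σ P = P) {f : K} : σ f ∈ P.1 ↔ f ∈ P.1 := by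
  have := map_mem_mv σ (P := P) (f := f)
  rwa [hP] at this

theorem ordAt_map (hP : mv σ P = P) (f : K) : ordAt P.1 (σ f) = ordAt P.1 f := by
  have := ordAt_mv σ P f
  rwa [hP] at this

theorem map_mem_fil (hP : mv σ P = P) {f : K} {n : ℤ} : σ f ∈ fil P n ↔ f ∈ fil P n := by
  rw [mem_fil, mem_fil, ordAt_map hP, map_eq_zero]

theorem resAt_map_congr (hP : mv σ P = P) {f g : K} (hf : f ∈ P.1) (hg : g ∈ P.1)
    (h : resAt P f = resAt P g) : resAt P (σ f) = resAt P (σ g) := by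
  have h1 : resAt P (f + g) = 0 := by rw [resAt_add hf hg, h, CharTwo.add_self_eq_zero]
  have h2 : resAt P (σ f + σ g) = 0 := by
    rw [← map_add]
    rw [resAt_eq_zero_iff (add_mem hf hg)] at h1
    rwa [resAt_eq_zero_iff ((map_mem_iff hP).mpr (add_mem hf hg)), map_mem_fil hP]
  rw [resAt_add ((map_mem_iff hP).mpr hf) ((map_mem_iff hP).mpr hg)] at h2
  exact CharTwo.add_eq_zero.mp h2

/-- The inertia condition: the induced automorphism of the residue field is trivial. -/
def Triv (σ : K ≃ₐ[ZMod 2] K) (P : Place (ZMod 2) K) : Prop :=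
  ∀ f ∈ P.1, resAt P (σ f) = resAt P f

/-- The fixed field of the induced automorphism of the residue field. -/
def Efix (σ : K ≃ₐ[ZMod 2] K) (P : Place (ZMod 2) K) : Set (Res P) :=
  {a | ∃ f ∈ P.1, resAt P f = a ∧ resAt P (σ f) = a}

theorem triv_or {ℓ : ℕ} (hℓ : ℓ.Prime) (hσ : σ ^ ℓ = 1) (hP : mv σ P = P) :
    Triv σ P ∨ Nat.card (Efix σ P) ^ ℓ = 2 ^ pdeg P := by
  let r : Res P → K := fun a => (resAt_surjective a).choose
  have hr : ∀ a, r a ∈ P.1 := fun a => (resAt_surjective a).choose_spec.1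
  have hr' : ∀ a, resAt P (r a) = a := fun a => (resAt_surjective a).choose_spec.2
  have hs : ∀ a, σ (r a) ∈ P.1 := fun a => (map_mem_iff hP).mpr (hr a)
  have hc : ∀ f ∈ P.1, resAt P (σ (r (resAt P f))) = resAt P (σ f) := fun f hf =>
    resAt_map_congr hP (hr _) hf (hr' _)
  let φ₀ : Res P →+* Res P :=
    { toFun := fun a => resAt P (σ (r a))
      map_one' := by
        have := hc 1 P.1.one_mem
        rwa [map_one, resAt_one] at this
      map_zero' := by
        have := hc 0 P.1.zero_mem
        rwa [map_zero, resAt_zero] at this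
      map_mul' := fun a b => by
        have := hc _ (mul_mem (hr a) (hr b))
        rwa [resAt_mul (hr a) (hr b), hr', hr', map_mul, resAt_mul (hs a) (hs b)] at this
      map_add' := fun a b => by
        have := hc _ (add_mem (hr a) (hr b))
        rwa [resAt_add (hr a) (hr b), hr', hr', map_add, resAt_add (hs a) (hs b)] at this }
  let φ : Res P ≃+* Res P := RingEquiv.ofBijective φ₀
    (Finite.injective_iff_bijective.mp φ₀.injective)
  have hφ : ∀ f ∈ P.1, φ (resAt P f) = resAt P (σ f) := hc
  have hpow : ∀ n f, f ∈ P.1 → (σ ^ n) f ∈ P.1 ∧ (φ ^ n) (resAt P f) = resAt P ((σ ^ n) f) := by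
    intro n f hf
    induction n with
    | zero => exact ⟨hf, rfl⟩
    | succ n ih =>
      rw [pow_succ', pow_succ', AlgEquiv.mul_apply, RingAut.mul_apply, ih.2, hφ _ ih.1]
      exact ⟨(map_mem_iff hP).mpr ih.1, rfl⟩
  have h1 : φ ^ ℓ = 1 := by
    ext a
    obtain ⟨f, hf, rfl⟩ := resAt_surjective a
    rw [(hpow ℓ f hf).2, hσ]; rfl
  by_cases h : φ = 1
  · left
    intro f hf
    rw [← hφ f hf, h]; rfl
  · right
    rw [← card_res, ← card_fixed_pow hℓ φ h1 h]
    congr 1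
    refine Nat.card_congr (Equiv.setCongr ?_)
    ext a
    change (a ∈ Efix σ P) ↔ φ a = a
    constructor
    · rintro ⟨f, hf, rfl, h⟩
      rw [hφ f hf, h]
    · intro h
      obtain ⟨f, hf, rfl⟩ := resAt_surjective a
      exact ⟨f, hf, rfl, by rw [← hφ f hf, h]⟩

theorem triv_of_not_dvd {ℓ : ℕ} (hℓ : ℓ.Prime) (hσ : σ ^ ℓ = 1) (hP : mv σ P = P)
    (h : ¬ ℓ ∣ pdeg P) : Triv σ P := by
  refine (triv_or hℓ hσ hP).resolve_right fun h1 => h ?_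
  have h2 : Nat.card (Efix σ P) ∣ 2 ^ pdeg P := h1 ▸ dvd_pow_self _ hℓ.ne_zero
  obtain ⟨k, -, hk⟩ := (Nat.dvd_prime_pow Nat.prime_two).mp h2
  rw [hk, ← pow_mul] at h1
  exact ⟨k, by have := Nat.pow_right_injective le_rfl h1; rw [← this, mul_comm]⟩

variable (σ) in
/-- The additive group of fixed elements of an automorphism. -/
def Inv : AddSubgroup K where
  carrier := {f | σ f = f}
  zero_mem' := map_zero σ
  add_mem' := by intro a b ha hb; change σ (a + b) = _; rw [map_add, ha, hb]
  neg_mem' := by intro a ha; change σ (-a) = _; rw [map_neg, ha]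

theorem mem_Inv {f : K} : f ∈ Inv σ ↔ σ f = f := Iff.rfl

theorem card_Inv_step {n : ℤ} {X : AddSubgroup K} (hX : X ≤ fil P n) (hI : X ≤ Inv σ) :
    Nat.card X ≤ Nat.card (X ⊓ fil P (n + 1) : AddSubgroup K) * Nat.card (Efix σ P) := by
  refine card_step_le P hX _ ⟨0, P.1.zero_mem, by simp, by simp⟩ ?_
  intro f hf g hg _ hg1
  have hg0 : g ≠ 0 := fun h => hg1 (h ▸ zero_mem _)
  have hgn : ordAt P.1 g = n := by
    have h1 := hX hg
    rw [mem_fil_of_ne hg0] at h1 hg1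
    omega
  have h : f / g ∈ P.1 := mem_fil_zero.mp ((div_mem_fil_one_iff P hg0 hgn 0).mpr (by simpa using hX hf))
  exact ⟨f / g, h, rfl, by rw [map_div₀, mem_Inv.mp (hI hf), mem_Inv.mp (hI hg)]⟩

theorem card_L_Inv_step (D : Div K) (P : Place (ZMod 2) K) (n : ℕ) :
    Nat.card (L (D - Finsupp.single P (n : ℤ)) ⊓ Inv σ : AddSubgroup K) ≤
      Nat.card (L (D - Finsupp.single P ((n + 1 : ℕ) : ℤ)) ⊓ Inv σ : AddSubgroup K) *
        Nat.card (Efix σ P) := by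
  have h := card_Inv_step (σ := σ) (P := P) (n := -D P + n)
    (X := L (D - Finsupp.single P (n : ℤ)) ⊓ Inv σ) (by
      refine inf_le_left.trans ((L_le_fil _ P).trans (fil_mono ?_))
      simp) inf_le_right
  have h1 : fil P (-D P + n + 1) ≤ fil P (-D P + n) := fil_mono (by omega)
  rwa [inf_right_comm, ← L_inf_fil D P n, inf_assoc (L D) (fil P _) (fil P _), inf_eq_right.mpr h1,
    show -D P + (n : ℤ) + 1 = -D P + ((n + 1 : ℕ) : ℤ) by push_cast; ring, L_inf_fil D P n,
    L_inf_fil D P (n + 1)] at h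

theorem card_L_Inv_le (D : Div K) (P : Place (ZMod 2) K) (n : ℕ) :
    Nat.card (L D ⊓ Inv σ : AddSubgroup K) ≤
      Nat.card (L (D - Finsupp.single P (n : ℤ)) ⊓ Inv σ : AddSubgroup K) *
        Nat.card (Efix σ P) ^ n := by
  induction n with
  | zero => simp
  | succ n ih =>
    calc _ ≤ _ := ih
      _ ≤ _ := Nat.mul_le_mul_right _ (card_L_Inv_step D P n)
      _ = _ := by rw [pow_succ']; ring

/-- Divisors fixed by an automorphism. -/
def Fixed (σ : K ≃ₐ[ZMod 2] K) (D : Div K) : Prop := ∀ P, D (mv σ P) = D P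

theorem Fixed.add {D E : Div K} (hD : Fixed σ D) (hE : Fixed σ E) : Fixed σ (D + E) := fun P => by
  rw [Finsupp.add_apply, Finsupp.add_apply, hD, hE]

theorem mv_injective : Function.Injective (mv σ) := fun P Q h => by
  have := mv_symm σ.symm P
  rw [AlgEquiv.symm_symm, h] at this
  rw [← this]
  have := mv_symm σ.symm Q
  rwa [AlgEquiv.symm_symm] at this

theorem fixed_single (hP : mv σ P = P) (n : ℤ) : Fixed σ (Finsupp.single P n) := fun Q => by
  rw [Finsupp.single_apply, Finsupp.single_apply]
  congr 1
  conv_lhs => rw [← hP]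
  exact eq_iff_iff.mpr mv_injective.eq_iff

theorem map_mem_L {D : Div K} (hD : Fixed σ D) {f : K} (hf : f ∈ L D) : σ f ∈ L D := by
  rw [mem_L] at hf ⊢
  intro P
  have := hf (mv σ.symm P)
  rwa [← map_mem_fil_mv σ, mv_symm, ← hD, mv_symm] at this

/-- A place is not fixed if a function `T` with `σ T ≠ T` reduces to an invariant. -/
theorem mv_ne_of_resAt {f g : K} (hf : f ∈ P.1) (hσf : σ f = f + 1) (hg : g ∈ P.1)
    (hσg : σ g = g) (h : resAt P f = resAt P g) : mv σ P ≠ P := by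
  intro hP
  have := resAt_map_congr hP hf hg h
  rw [hσf, hσg, resAt_add hf P.1.one_mem, h, resAt_one] at this
  exact one_ne_zero (add_eq_left.mp this)

end Action

end CFF

namespace CFF

open Polynomial IsLocalRing

section Tools

variable {K : Type} [Field K] [Algebra (ZMod 2) K] [FiveGonal K]

theorem exists_eq_pt {D : Div K} (hD : 0 ≤ D) {n : ℕ} (hn : 0 < n) (h : deg D = n)
    (hs : ∀ m : ℕ, 0 < m → m < n → e K m = 0 ∨ e K (n - m) = 0) : ∃ P, pdeg P = n ∧ D = pt P := by
  obtain ⟨P, hP⟩ := exists_pos_of_ne hD (by rintro rfl; rw [map_zero] at h; omega)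
  have h0 : 0 ≤ D - pt P := sub_nonneg.mpr hP
  have h1 : deg (D - pt P) = n - pdeg P := by rw [map_sub, h, deg_single, one_mul]
  have h2 := deg_nonneg h0
  have h3 : pdeg P = n := by
    by_contra h3
    rcases hs (pdeg P) (placeDegree_pos P) (by omega) with h4 | h4
    · have := e_pos (E := pt P) (Finsupp.single_nonneg.mpr zero_le_one) (n := pdeg P) (by simp)
      omega
    · have := e_pos h0 h1
      omega
  exact ⟨P, h3, sub_eq_zero.mp (eq_zero_of_deg h0 (by omega))⟩

theorem single_nonneg' {P : Place (ZMod 2) K} {n : ℕ} : (0 : Div K) ≤ Finsupp.single P (n : ℤ) :=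
  Finsupp.single_nonneg.mpr (by positivity)

theorem pt_nonneg {P : Place (ZMod 2) K} : 0 ≤ pt P := Finsupp.single_nonneg.mpr zero_le_one

theorem pt_injective : Function.Injective (pt (K := K)) :=
  Finsupp.single_left_injective one_ne_zero

theorem eq_of_e_eq_one {n : ℕ} (hn : e K n = 1) {P Q : Place (ZMod 2) K} (hP : pdeg P = n)
    (hQ : pdeg Q = n) : P = Q :=
  pt_injective (eff_unique hn pt_nonneg pt_nonneg (by rw [deg_single, hP, one_mul])
    (by rw [deg_single, hQ, one_mul]))

theorem mv_eq_of_e_eq_one {n : ℕ} (hn : e K n = 1) {P : Place (ZMod 2) K} (hP : pdeg P = n)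
    (σ : K ≃ₐ[ZMod 2] K) : mv σ P = P :=
  eq_of_e_eq_one hn ((pdeg_mv σ P).trans hP) hP

theorem e_zero_of_place {n : ℕ} (hn : e K n = 0) (P : Place (ZMod 2) K) : pdeg P ≠ n := fun h => by
  have := e_pos (K := K) (E := pt P) pt_nonneg (n := n) (by rw [deg_single, h, one_mul])
  omega

theorem negPart_add_one (x : K) : (dv (x + 1))⁻ = (dv x)⁻ := by
  have h : ∀ y : K, (dv (y + 1))⁻ ≤ (dv y)⁻ := fun y =>
    negPart_le_of_mem (negPart_nonneg _)
      (add_mem (mem_L_negPart y) (one_mem_L (negPart_nonneg _)))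
  refine le_antisymm (h x) ?_
  have := h (x + 1)
  rwa [add_assoc, CharTwo.add_self_eq_zero, add_zero] at this

theorem negPart_inv (x : K) : (dv x⁻¹)⁻ = (dv x)⁺ := by rw [dv_inv, negPart_neg]

theorem HasDeg.ne {x : K} {n : ℕ} (hx : HasDeg x n) (hn : n ≠ 0) : x ≠ 0 ∧ x ≠ 1 := by
  constructor <;> rintro rfl <;> have := hx.deg_poles <;> simp [dv_zero] at this <;> omega

theorem negPart_add_dv (f : K) : (dv f)⁻ + dv f = (dv f)⁺ := by
  rw [add_comm]
  exact (sub_eq_iff_eq_add.mp (posPart_sub_negPart (dv f))).symm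

theorem HasDeg.add_one {x : K} {n : ℕ} (hn : n ≠ 0) (h : HasDeg x n) : HasDeg (x + 1) n := by
  obtain ⟨h0, h1⟩ := h.ne hn
  obtain ⟨m, hm⟩ := exists_deg (x := x + 1) (fun h => h1 (CharTwo.add_eq_zero.mp h))
    (fun h => h0 (add_eq_right.mp h))
  have := hm.deg_poles
  rw [negPart_add_one, h.deg_poles] at this
  have : n = m := by exact_mod_cast this
  rwa [this]

variable {T : K} (hT : HasDeg T 5)

include hT

theorem mem_L_poles {y : K} : y ∈ L (dv T)⁻ ↔ y = 0 ∨ y = 1 ∨ y = T ∨ y = T + 1 := by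
  have h1 := card_L_eq hT.deg_poles
  rw [Nat.cast_ofNat, e_five_eq] at h1
  obtain ⟨hT0, hT1⟩ := hT.ne (by norm_num)
  have hfin : Finite (L (dv T)⁻) := finite_L _
  have h2 : ({0, 1, T, T + 1} : Set K) ⊆ (L (dv T)⁻ : Set K) := by
    have h1 := one_mem_L (negPart_nonneg (dv T))
    have h3 := mem_L_negPart T
    rintro _ (rfl | rfl | rfl | rfl)
    exacts [zero_mem _, h1, h3, add_mem h3 h1]
  have h3 : ({0, 1, T, T + 1} : Set K).ncard = 4 := by
    have a1 : T + 1 ≠ 0 := fun h => hT1 (CharTwo.add_eq_zero.mp h)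
    rw [Set.ncard_insert_of_notMem, Set.ncard_insert_of_notMem, Set.ncard_pair]
    · simp
    · simp [hT1.symm, hT0]
    · simp [hT0.symm, a1.symm]
  have h4 := Set.eq_of_subset_of_ncard_le h2 (by
    rw [h3]; exact h1.le) (Set.toFinite _)
  change y ∈ (L (dv T)⁻ : Set K) ↔ _
  rw [← h4]; simp

theorem eff_five {E : Div K} (hE : 0 ≤ E) (h : deg E = 5) :
    E = (dv T)⁻ ∨ E = (dv T)⁺ ∨ E = (dv (T + 1))⁺ := by
  obtain ⟨f, hf, h0, rfl⟩ := eff_eq_add_dv (D := (dv T)⁻) hE (by rw [hT.deg_poles, h]; rfl)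
  rcases (mem_L_poles hT).mp hf with rfl | rfl | rfl | rfl
  · exact absurd rfl h0
  · left; simp
  · exact Or.inr (Or.inl (negPart_add_dv _))
  · right; right
    rw [← negPart_add_one, negPart_add_dv]

theorem poles_eq_of_deg_five {E : Div K} (hE : 0 ≤ E) (h : deg E = 5) {x : K} (hx : x ∈ L E)
    (h0 : x ≠ 0) (h1 : x ≠ 1) : (dv x)⁻ = E := by
  obtain ⟨S, hS, rfl⟩ : ∃ S, HasDeg S 5 ∧ E = (dv S)⁻ := by
    rcases eff_five hT hE h with rfl | rfl | rfl
    · exact ⟨T, hT, rfl⟩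
    · exact ⟨T⁻¹, hT.inv, (negPart_inv T).symm⟩
    · exact ⟨(T + 1)⁻¹, (hT.add_one (by norm_num)).inv, (negPart_inv _).symm⟩
  rcases (mem_L_poles hS).mp hx with rfl | rfl | rfl | rfl
  · exact absurd rfl h0
  · exact absurd rfl h1
  · rfl
  · exact negPart_add_one _

end Tools
end CFF

namespace CFF

open Polynomial IsLocalRing

section Involution

variable {K : Type} [Field K] [Algebra (ZMod 2) K] [FiveGonal K]

theorem ordAt_zpow (P : Place (ZMod 2) K) (f : K) (n : ℤ) : ordAt P.1 (f ^ n) = n * ordAt P.1 f := by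
  rcases Int.le_total 0 n with hn | hn
  · lift n to ℕ using hn
    rw [zpow_natCast, ordAt_pow]
  · obtain ⟨k, rfl⟩ : ∃ k : ℕ, n = -(k : ℤ) := ⟨n.natAbs, by omega⟩
    rw [zpow_neg, zpow_natCast, ordAt_inv, ordAt_pow]; ring

variable {σ : K ≃ₐ[ZMod 2] K} {P : Place (ZMod 2) K} {T : K}

theorem add_map_mem_fil (hP : mv σ P = P) (ht : Triv σ P) {f : K} (hf : f ∈ P.1) :
    f + σ f ∈ fil P 1 := by
  have h := (map_mem_iff hP).mpr hf
  rw [← resAt_eq_zero_iff (add_mem hf h), resAt_add hf h, ht f hf, CharTwo.add_self_eq_zero]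

/-- At a ramified place the invariants of an Artin–Schreier involution have even order. -/
theorem even_ordAt (hT : σ T = T + 1) (hP : mv σ P = P) (ht : Triv σ P) (h1 : ordAt P.1 T = -1)
    {f : K} (h0 : f ≠ 0) (hf : σ f = f) : Even (ordAt P.1 f) := by
  by_contra hodd
  obtain ⟨k, hk⟩ := Int.not_even_iff_odd.mp hodd
  have hT0 : T ≠ 0 := by rintro rfl; rw [ordAt_zero] at h1; omega
  have hT1 : T + 1 ≠ 0 := by rw [← hT]; simpa using hT0
  have hu0 : ordAt P.1 (T * (T + 1)) = -2 := by
    rw [ordAt_mul P hT0 hT1, ← hT, ordAt_map hP, h1]; norm_num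
  have hσ0 : σ (T * (T + 1)) = T * (T + 1) := by
    rw [map_mul, map_add, hT, map_one, add_assoc, CharTwo.add_self_eq_zero, add_zero, mul_comm]
  set h := f * (T * (T + 1)) ^ k with hh
  have hh0 : h ≠ 0 := mul_ne_zero h0 (zpow_ne_zero _ (mul_ne_zero hT0 hT1))
  have hσh : σ h = h := by rw [hh, map_mul, map_zpow₀, hσ0, hf]
  have hh1 : ordAt P.1 h = 1 := by
    rw [hh, ordAt_mul P h0 (zpow_ne_zero _ (mul_ne_zero hT0 hT1)), ordAt_zpow, hu0, hk]; ring
  have hu : h * T ∈ P.1 := by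
    rw [← ordAt_nonneg_iff, ordAt_mul P hh0 hT0, hh1, h1]; norm_num
  obtain ⟨r, hr⟩ := (Finite.surjective_of_injective (frobenius_inj (Res P) 2)) (resAt P (h * T))
  obtain ⟨t, htP, rfl⟩ := resAt_surjective r
  have hw : h * T + t ^ 2 ∈ fil P 1 := by
    rw [← resAt_eq_zero_iff (add_mem hu (pow_mem htP 2)), resAt_add hu (pow_mem htP 2),
      resAt_pow htP, ← frobenius_def, hr, CharTwo.add_self_eq_zero]
  have hw' : (h * T + t ^ 2) / h ∈ P.1 :=
    mem_fil_zero.mp ((div_mem_fil_one_iff P hh0 hh1 0).mpr (by simpa using hw))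
  have h2 := mul_mem_fil (mem_fil_of_le hh1.ge) (add_map_mem_fil hP ht hw')
  have h3 := pow_mem_fil (add_map_mem_fil hP ht htP) 2
  rw [Nat.cast_ofNat, mul_one] at h3
  have h4 : h * ((h * T + t ^ 2) / h + σ ((h * T + t ^ 2) / h)) + (t + σ t) ^ 2 = h := by
    rw [map_div₀, hσh, mul_add, mul_div_cancel₀ _ hh0, mul_div_cancel₀ _ hh0, map_add, map_mul, hT,
      hσh, map_pow, CharTwo.add_sq]
    linear_combination (h * T + t ^ 2 + σ t ^ 2) * CharTwo.two_eq_zero (R := K)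
  have h5 := add_mem h2 h3
  rw [h4, mem_fil_of_ne hh0, hh1] at h5
  norm_num at h5

theorem not_triv_of_mem (hT : σ T = T + 1) (h : T ∈ P.1) : ¬ Triv σ P := fun ht => by
  have := ht T h
  rw [hT, resAt_add h P.1.one_mem, resAt_one] at this
  exact one_ne_zero (add_eq_left.mp this)

theorem card_Efix {ℓ n : ℕ} (hℓ : ℓ.Prime) (hσ : σ ^ ℓ = 1) (hP : mv σ P = P) (hn : ¬ Triv σ P)
    (hd : pdeg P = ℓ * n) : Nat.card (Efix σ P) = 2 ^ n := by
  have := (triv_or hℓ hσ hP).resolve_left hn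
  rw [hd, mul_comm, pow_mul] at this
  exact Nat.pow_left_injective hℓ.ne_zero this

theorem card_L_le_two_mul {D : Div K} (h : ∀ f ∈ L D, f + σ f = 0 ∨ f + σ f = 1) :
    Nat.card (L D) ≤ 2 * Nat.card (L D ⊓ Inv σ : AddSubgroup K) := by
  let δ : K →+ K := AddMonoidHom.id K + (σ : K →+ K)
  have hk : δ.ker = Inv σ := by
    ext f
    change f + σ f = 0 ↔ σ f = f
    rw [CharTwo.add_eq_zero, eq_comm]
  rw [card_eq_card_inf_mul (L D) (Inv σ), mul_comm, ← hk, AddSubgroup.relIndex_ker]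
  refine Nat.mul_le_mul_right _ ?_
  have : ((L D).map δ : Set K) ⊆ {0, 1} := by
    rintro _ ⟨f, hf, rfl⟩
    exact h f hf
  calc _ = ((L D).map δ : Set K).ncard := rfl
    _ ≤ ({0, 1} : Set K).ncard := Set.ncard_le_ncard this
    _ = 2 := Set.ncard_pair zero_ne_one

variable (hσ : σ ^ 2 = 1) (hT : σ T = T + 1) (h5 : HasDeg T 5)

include hσ in
theorem involutive (f : K) : σ (σ f) = f := by
  have := congrArg (fun τ : K ≃ₐ[ZMod 2] K => τ f) hσ
  rwa [pow_two] at this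

include hσ in
theorem map_add_map (f : K) : σ (f + σ f) = f + σ f := by
  rw [map_add, involutive hσ, add_comm]

include hT in
theorem fixed_poles : Fixed σ (dv T)⁻ := fun P => by
  have h : ∀ f, (dv f)⁻ P = max (-(ordAt P.1 f)) 0 := fun f => by rw [← dv_apply]; rfl
  have h1 : (dv T)⁻ (mv σ P) = max (-(ordAt (mv σ P).1 T)) 0 := by rw [← dv_apply]; rfl
  obtain ⟨f, rfl⟩ := σ.surjective T
  have h2 : σ f = f + 1 := by
    apply σ.injective
    rw [hT, map_add, map_one]
  rw [h1, ordAt_mv, ← h, h2, negPart_add_one]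

theorem ordAt_of_poles {f : K} (h : 0 < (dv f)⁻ P) : ordAt P.1 f = -(dv f)⁻ P := by
  have h : (dv f)⁻ P = max (-(ordAt P.1 f)) 0 := by rw [← dv_apply]; rfl
  omega

theorem mem_of_poles {f : K} (h : (dv f)⁻ P = 0) : f ∈ P.1 := by
  have h : (dv f)⁻ P = max (-(ordAt P.1 f)) 0 := by rw [← dv_apply]; rfl
  rw [← ordAt_nonneg_iff]
  omega

theorem mv_eq_of_fixed {Q : Place (ZMod 2) K} (h : Fixed σ (pt Q)) : mv σ Q = Q := by
  have := h Q
  rw [pt, Finsupp.single_eq_same, Finsupp.single_apply] at this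
  by_contra hne
  rw [if_neg (Ne.symm hne)] at this
  exact zero_ne_one this

include hσ hT in
/-- At a ramified place, traces of functions with at most double poles are regular. -/
theorem add_map_regular (hP : mv σ P = P) (ht : Triv σ P) (h1 : ordAt P.1 T = -1) {f : K}
    (hf : f ∈ fil P (-2)) : f + σ f ∈ fil P 0 := by
  by_cases h0 : f + σ f = 0
  · rw [h0]; exact zero_mem _
  have hev := even_ordAt hT hP ht h1 h0 (map_add_map hσ f)
  have hT0 : T ≠ 0 := by rintro rfl; rw [ordAt_zero] at h1; omega
  have hT1 : T + 1 ≠ 0 := by rw [← hT]; simpa using hT0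
  have hu0 : ordAt P.1 (T * (T + 1)) = -2 := by
    rw [ordAt_mul P hT0 hT1, ← hT, ordAt_map hP, h1]; norm_num
  have hσ0 : σ (T * (T + 1)) = T * (T + 1) := by
    rw [map_mul, map_add, hT, map_one, add_assoc, CharTwo.add_self_eq_zero, add_zero, mul_comm]
  have hT2 := mul_ne_zero hT0 hT1
  have hg : f / (T * (T + 1)) ∈ P.1 :=
    mem_fil_zero.mp ((div_mem_fil_one_iff P hT2 hu0 0).mpr (by simpa using hf))
  have hg1 := add_map_mem_fil hP ht hg
  rw [map_div₀, hσ0, ← add_div, div_mem_fil_one_iff P hT2 hu0, mem_fil_of_ne h0] at hg1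
  obtain ⟨c, hc⟩ := hev
  rw [mem_fil_of_ne h0]
  omega

include hσ hT h5 in
theorem card_Inv_prime {Q : Place (ZMod 2) K} (hQ : (dv T)⁻ = pt Q) :
    64 ≤ Nat.card (L (Finsupp.single Q 2) ⊓ Inv σ : AddSubgroup K) := by
  have hdQ : pdeg Q = 5 := by
    have := h5.deg_poles
    rw [hQ, deg_single, one_mul] at this
    exact_mod_cast this
  have hfix := mv_eq_of_fixed (hQ ▸ fixed_poles hT)
  have ht : Triv σ Q := triv_of_not_dvd Nat.prime_two hσ hfix (by omega)
  have h1 : ordAt Q.1 T = -1 := by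
    rw [ordAt_of_poles (by rw [hQ, pt, Finsupp.single_eq_same]; norm_num), hQ, pt,
      Finsupp.single_eq_same]
  have hc : Nat.card (L (Finsupp.single Q 2)) = 128 := by
    have h7 := e_large (K := K) (n := 10) (by norm_num)
    rw [card_L_eq (n := 10) (by rw [deg_single, hdQ]; norm_num), show e K 10 = 7 by omega]; norm_num
  have := card_L_le_two_mul (σ := σ) (D := Finsupp.single Q 2) (fun f hf => by
    rw [← mem_L_zero, mem_L]
    intro P
    by_cases hPQ : P = Q
    · subst hPQ
      have hf2 := mem_L.mp hf P
      rw [Finsupp.single_eq_same] at hf2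
      simpa using add_map_regular hσ hT hfix ht h1 hf2
    · have := mem_L.mp (add_mem hf (map_mem_L (fixed_single hfix 2) hf)) P
      rwa [Finsupp.single_apply, if_neg (Ne.symm hPQ)] at this)
  omega

include hσ hT h5 in
theorem false_of_e_two_eq_zero (h2 : e K 2 = 0) : False := by
  have h4 : e K 4 = 1 := by rw [e_four, h2]
  obtain ⟨Q, hdQ, hQ⟩ := exists_eq_pt (negPart_nonneg (dv T)) (n := 5) (by norm_num) h5.deg_poles
    (by
      intro m h0 hm
      interval_cases m
      exacts [Or.inl (e_one K), Or.inl h2, Or.inr (by simpa using h2), Or.inr (by simpa using e_one K)])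
  have h64 := card_Inv_prime hσ hT h5 hQ
  obtain ⟨E, hE, hd⟩ := exists_eff (K := K) (n := 4) (by omega)
  obtain ⟨R, hdR, -⟩ := exists_eq_pt hE (n := 4) (by norm_num) hd (by
    intro m h0 hm
    interval_cases m
    exacts [Or.inl (e_one K), Or.inl h2, Or.inr (by simpa using e_one K)])
  have hfix := mv_eq_of_e_eq_one h4 hdR σ
  have hRQ : R ≠ Q := by rintro rfl; omega
  have hn : ¬ Triv σ R := not_triv_of_mem hT (mem_of_poles (by
    rw [hQ, pt, Finsupp.single_apply, if_neg (Ne.symm hRQ)]))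
  have hc := card_Efix (n := 2) Nat.prime_two hσ hfix hn hdR
  have h := card_L_Inv_le (σ := σ) (Finsupp.single Q 2) R 2
  have hle : Nat.card (L (Finsupp.single Q 2 - Finsupp.single R ((2 : ℕ) : ℤ)) ⊓ Inv σ : AddSubgroup K) ≤ 1 := by
    have hfin : Finite (L (Finsupp.single Q 2 - Finsupp.single R ((2 : ℕ) : ℤ))) := finite_L _
    have := card_L_eq (K := K) (D := Finsupp.single Q 2 - Finsupp.single R ((2 : ℕ) : ℤ)) (n := 2) (by
      rw [map_sub, deg_single, deg_single, hdQ, hdR]; norm_num)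
    rw [h2] at this
    exact (AddSubgroup.card_le_of_le inf_le_left).trans this.le
  rw [hc] at h
  omega

include hσ hT h5 in
theorem false_of_e_two_eq_one (h2 : e K 2 = 1) (h3 : e K 3 = 0) : False := by
  obtain ⟨Q, hdQ, hQ⟩ := exists_eq_pt (negPart_nonneg (dv T)) (n := 5) (by norm_num) h5.deg_poles
    (by
      intro m h0 hm
      interval_cases m
      exacts [Or.inl (e_one K), Or.inr (by simpa using h3), Or.inl h3, Or.inr (by simpa using e_one K)])
  have h64 := card_Inv_prime hσ hT h5 hQ
  obtain ⟨E, hE, hd⟩ := exists_eff (K := K) (n := 2) (by omega)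
  obtain ⟨R, hdR, -⟩ := exists_eq_pt hE (n := 2) (by norm_num) hd (by
    intro m h0 hm
    interval_cases m
    exact Or.inl (e_one K))
  have hfix := mv_eq_of_e_eq_one h2 hdR σ
  have hRQ : R ≠ Q := by rintro rfl; omega
  have hn : ¬ Triv σ R := not_triv_of_mem hT (mem_of_poles (by
    rw [hQ, pt, Finsupp.single_apply, if_neg (Ne.symm hRQ)]))
  have hc := card_Efix (n := 1) Nat.prime_two hσ hfix hn hdR
  have h := card_L_Inv_le (σ := σ) (Finsupp.single Q 2) R 4
  have hle : Nat.card (L (Finsupp.single Q 2 - Finsupp.single R ((4 : ℕ) : ℤ)) ⊓ Inv σ : AddSubgroup K) ≤ 2 := by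
    have hfin : Finite (L (Finsupp.single Q 2 - Finsupp.single R ((4 : ℕ) : ℤ))) := finite_L _
    have := card_L_eq (K := K) (D := Finsupp.single Q 2 - Finsupp.single R ((4 : ℕ) : ℤ)) (n := 2) (by
      rw [map_sub, deg_single, deg_single, hdQ, hdR]; norm_num)
    rw [h2] at this
    exact (AddSubgroup.card_le_of_le inf_le_left).trans this.le
  rw [hc] at h
  omega

end Involution
end CFF

namespace CFF

open Polynomial IsLocalRing

section Involution

variable {K : Type} [Field K] [Algebra (ZMod 2) K] [FiveGonal K]

theorem exists_place_of_e_two (h2 : e K 2 = 1) : ∃ P : Place (ZMod 2) K, pdeg P = 2 := by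
  obtain ⟨E, hE, hd⟩ := exists_eff (K := K) (n := 2) (by omega)
  obtain ⟨P, hP, -⟩ := exists_eq_pt hE (n := 2) (by norm_num) hd (by
    intro m h0 hm
    interval_cases m
    exact Or.inl (e_one K))
  exact ⟨P, hP⟩

theorem exists_place_of_e_three (h3 : e K 3 ≠ 0) : ∃ P : Place (ZMod 2) K, pdeg P = 3 := by
  obtain ⟨E, hE, hd⟩ := exists_eff (K := K) (n := 3) h3
  obtain ⟨P, hP, -⟩ := exists_eq_pt hE (n := 3) (by norm_num) hd (by
    intro m h0 hm
    interval_cases m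
    exacts [Or.inl (e_one K), Or.inr (by simpa using e_one K)])
  exact ⟨P, hP⟩

section

variable {P : Place (ZMod 2) K} (hP : pdeg P = 2) (h2 : e K 2 = 1)

include hP h2

/-- An effective divisor of degree four avoiding the place of degree two is prime. -/
theorem exists_eq_pt_four {E : Div K} (hE : 0 ≤ E) (hd : deg E = 4) (hEP : E P = 0) :
    ∃ R, pdeg R = 4 ∧ E = pt R := by
  obtain ⟨R, hR⟩ := exists_pos_of_ne hE (by rintro rfl; rw [map_zero] at hd; omega)
  have h0 : 0 ≤ E - pt R := sub_nonneg.mpr hR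
  have h1 : deg (E - pt R) = 4 - pdeg R := by rw [map_sub, hd, deg_single, one_mul]
  have h3 := deg_nonneg h0
  have h4 := placeDegree_pos R
  have h5 : pdeg R ≠ 1 := e_zero_of_place (by exact_mod_cast e_one K) R
  have h6 : pdeg R ≠ 2 := fun h => by
    obtain rfl := eq_of_e_eq_one h2 h hP
    have := hR R
    rw [pt, Finsupp.single_eq_same, hEP] at this
    omega
  have h7 : pdeg R ≠ 3 := fun h => by
    have := e_pos h0 h1
    rw [h, show ((4 : ℤ) - (3 : ℕ)) = 1 by norm_num, e_one] at this
    omega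
  change 0 < pdeg R at h4
  have h8 : pdeg R = 4 := by omega
  exact ⟨R, h8, sub_eq_zero.mp (eq_zero_of_deg h0 (by omega))⟩

theorem exists_quartic : ∃ X : K, X ∈ L (Finsupp.single P 2) ∧ X ≠ 0 ∧ X ≠ 1 := by
  refine exists_nonconst_mem (n := 4) ?_ ?_
  · rw [deg_single, hP]; norm_num
  · rw [e_four, h2]

theorem poles_quartic {X : K} (hX : X ∈ L (Finsupp.single P 2)) (h0 : X ≠ 0) (h1 : X ≠ 1) :
    (dv X)⁻ = Finsupp.single P 2 := by
  have hle := negPart_le_of_mem (Finsupp.single_nonneg.mpr (by norm_num)) hX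
  have hpos := deg_poles_pos h0 h1
  have h0' : 0 ≤ Finsupp.single P 2 - (dv X)⁻ := sub_nonneg.mpr hle
  have hle2 : (dv X)⁻ P ≤ 2 := by simpa using hle P
  have heq : (dv X)⁻ = Finsupp.single P ((dv X)⁻ P) := by
    ext Q
    by_cases hQ : Q = P
    · subst hQ; simp
    · have a := hle Q
      have b : 0 ≤ (dv X)⁻ Q := negPart_nonneg (dv X) Q
      rw [Finsupp.single_apply, if_neg (Ne.symm hQ)] at a ⊢
      omega
  have hnn : 0 ≤ (dv X)⁻ P := negPart_nonneg (dv X) P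
  have h3 : (dv X)⁻ P ≠ 0 := fun h => by
    rw [heq, h] at hpos; simp at hpos
  have h4 : (dv X)⁻ P ≠ 1 := fun h => by
    have hX1 := mem_L_negPart X
    have := two_le_e (n := 2) (by rw [heq, h, deg_single, hP]; norm_num) (negPart_nonneg _) hX1 h0 h1
    omega
  rw [heq]
  congr 1
  omega

theorem mem_L_quartic {X y : K} (hX : X ∈ L (Finsupp.single P 2)) (h0 : X ≠ 0) (h1 : X ≠ 1)
    (hy : y ∈ L (Finsupp.single P 2)) : y = 0 ∨ y = 1 ∨ y = X ∨ y = X + 1 := by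
  have hc := card_L_eq (K := K) (D := Finsupp.single P 2) (n := 4) (by rw [deg_single, hP]; norm_num)
  rw [e_four, h2] at hc
  have hfin : Finite (L (Finsupp.single P 2)) := finite_L _
  have h2 : ({0, 1, X, X + 1} : Set K) ⊆ (L (Finsupp.single P 2) : Set K) := by
    have h1 := one_mem_L (D := Finsupp.single P 2) (Finsupp.single_nonneg.mpr (by norm_num))
    rintro _ (rfl | rfl | rfl | rfl)
    exacts [zero_mem _, h1, hX, add_mem hX h1]
  have h3 : ({0, 1, X, X + 1} : Set K).ncard = 4 := by
    have a1 : X + 1 ≠ 0 := fun h => h1 (CharTwo.add_eq_zero.mp h)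
    rw [Set.ncard_insert_of_notMem, Set.ncard_insert_of_notMem, Set.ncard_pair]
    · simp
    · simp [h1.symm, h0]
    · simp [h0.symm, a1.symm]
  have h4 := Set.eq_of_subset_of_ncard_le h2 (by
    rw [h3]; exact hc.le) (Set.toFinite _)
  have : y ∈ (L (Finsupp.single P 2) : Set K) := hy
  rw [← h4] at this
  simpa using this

theorem zeros_quartic {X : K} (hX : X ∈ L (Finsupp.single P 2)) (h0 : X ≠ 0) (h1 : X ≠ 1) :
    ∃ R, pdeg R = 4 ∧ (dv X)⁺ = pt R := by
  have hp := poles_quartic hP h2 hX h0 h1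
  refine exists_eq_pt_four hP h2 (posPart_nonneg _) ?_ ?_
  · rw [← negPart_add_dv, map_add, deg_dv, hp, deg_single, hP]; norm_num
  · have a : (dv X)⁻ P = max (-(dv X P)) 0 := rfl
    rw [hp, Finsupp.single_eq_same] at a
    rw [posPart_apply]
    omega

end

variable {T : K} (h5 : HasDeg T 5)

include h5 in
theorem e_three_eq_one (h2 : e K 2 = 1) (h3 : e K 3 ≠ 0) : e K 3 = 1 := by
  obtain ⟨P, hP⟩ := exists_place_of_e_two h2
  obtain ⟨Q, hQ⟩ := exists_place_of_e_three h3
  by_contra h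
  obtain ⟨x, hx, h0, h1⟩ := exists_nonconst_mem (D := pt Q) (n := 3) (by rw [deg_single, hQ]; norm_num)
    (by omega)
  have h4 := poles_eq_of_deg_five h5 (E := pt P + pt Q) (add_nonneg pt_nonneg pt_nonneg)
    (by rw [map_add, deg_single, deg_single, hP, hQ]; norm_num)
    (L_mono (le_add_of_nonneg_left pt_nonneg) hx) h0 h1
  have h6 := deg_mono (negPart_le_of_mem pt_nonneg hx)
  rw [h4, map_add, deg_single, deg_single, hP, hQ] at h6
  norm_num at h6

variable {σ : K ≃ₐ[ZMod 2] K} (hσ : σ ^ 2 = 1) (hT : σ T = T + 1)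
  {P Q : Place (ZMod 2) K} (hP : pdeg P = 2) (hQ : pdeg Q = 3) (h2 : e K 2 = 1)

include h5 hT hP hQ h2 in
theorem poles_eq_two_three : (dv T)⁻ = pt P + pt Q := by
  have hf := mv_eq_of_e_eq_one h2 hP σ
  have key : ordAt P.1 T ≤ 0 ∧ ordAt P.1 (T + 1) ≤ 0 := by
    have h0 : ordAt P.1 (T + 1) = ordAt P.1 T := by rw [← hT, ordAt_map hf]
    rw [h0, and_self]
    by_contra h
    have a : T ∈ fil P 1 := mem_fil_of_le (by omega)
    have b : T + 1 ∈ fil P 1 := mem_fil_of_le (by omega)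
    have c := add_mem a b
    rw [← add_assoc, CharTwo.add_self_eq_zero, zero_add, mem_fil_of_ne one_ne_zero, ordAt_one] at c
    omega
  have hpos : 0 < (pt P + pt Q : Div K) P := by
    rw [Finsupp.add_apply, pt, Finsupp.single_eq_same]
    have := pt_nonneg (P := Q) P
    rw [Finsupp.zero_apply] at this
    omega
  rcases eff_five h5 (E := pt P + pt Q) (add_nonneg pt_nonneg pt_nonneg)
    (by rw [map_add, deg_single, deg_single, hP, hQ]; norm_num) with h | h | h
  · exact h.symm
  · rw [h, posPart_apply, dv_apply] at hpos; omega
  · rw [h, posPart_apply, dv_apply] at hpos; omega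

theorem ordAt_pt_add {P Q : Place (ZMod 2) K} (hPQ : P ≠ Q) (h : (dv T)⁻ = pt P + pt Q) :
    ordAt P.1 T = -1 ∧ ordAt Q.1 T = -1 := by
  have a : (dv T)⁻ P = 1 := by simp [h, Ne.symm hPQ]
  have b : (dv T)⁻ Q = 1 := by simp [h, hPQ]
  rw [ordAt_of_poles (by rw [a]; norm_num), ordAt_of_poles (by rw [b]; norm_num), a, b]
  exact ⟨rfl, rfl⟩

include h5 hT hP hQ h2 hσ in
/-- The place of degree two is inert. -/
theorem not_triv_two (h3 : e K 3 = 1) : ¬ Triv σ P := by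
  intro htP
  have hfP := mv_eq_of_e_eq_one h2 hP σ
  have hfQ := mv_eq_of_e_eq_one h3 hQ σ
  have htQ : Triv σ Q := triv_of_not_dvd Nat.prime_two hσ hfQ (by omega)
  have hPQ : P ≠ Q := by rintro rfl; omega
  obtain ⟨hoP, hoQ⟩ := ordAt_pt_add hPQ (poles_eq_two_three h5 hT hP hQ h2)
  set D : Div K := Finsupp.single P 2 + Finsupp.single Q 2 with hD
  have hDP : D P = 2 := by simp [hD, Ne.symm hPQ]
  have hDQ : D Q = 2 := by simp [hD, hPQ]
  have hc : Nat.card (L D) = 128 := by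
    have h7 := e_large (K := K) (n := 10) (by norm_num)
    rw [card_L_eq (n := 10) (by rw [hD, map_add, deg_single, deg_single, hP, hQ]; norm_num),
      show e K 10 = 7 by omega]; norm_num
  have h64 := card_L_le_two_mul (σ := σ) (D := D) (fun f hf => by
    rw [← mem_L_zero, mem_L]
    intro R
    by_cases hRP : R = P
    · subst hRP
      have := mem_L.mp hf R
      rw [hDP] at this
      simpa using add_map_regular hσ hT hfP htP hoP this
    by_cases hRQ : R = Q
    · subst hRQ
      have := mem_L.mp hf R
      rw [hDQ] at this
      simpa using add_map_regular hσ hT hfQ htQ hoQ this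
    · have := mem_L.mp (add_mem hf (map_mem_L ((fixed_single hfP 2).add (fixed_single hfQ 2)) hf)) R
      rwa [hD, Finsupp.add_apply, Finsupp.single_apply, if_neg (Ne.symm hRP), Finsupp.single_apply,
        if_neg (Ne.symm hRQ), add_zero] at this)
  have hs := card_L_Inv_le (σ := σ) D Q 1
  have hE : Nat.card (Efix σ Q) ≤ 8 := by
    have h := card_res Q
    change _ = 2 ^ pdeg Q at h
    rw [hQ] at h
    exact (Nat.card_le_card_of_injective _ Subtype.val_injective).trans h.le
  have hle : L (D - Finsupp.single Q ((1 : ℕ) : ℤ)) ⊓ Inv σ ≤ L (Finsupp.single P 2) := by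
    rintro f ⟨hf, hfi⟩
    by_cases h0 : f = 0
    · rw [h0]; exact zero_mem _
    rw [mem_L]
    intro R
    have hR := mem_L.mp hf R
    by_cases hRQ : R = Q
    · subst hRQ
      have hev := even_ordAt hT hfQ htQ hoQ h0 hfi
      rw [Finsupp.sub_apply, hDQ, Finsupp.single_eq_same, mem_fil_of_ne h0] at hR
      obtain ⟨c, hc⟩ := hev
      rw [mem_fil_of_ne h0, Finsupp.single_apply, if_neg hPQ]
      push_cast at hR
      omega
    · rwa [hD, Finsupp.sub_apply, Finsupp.add_apply, Finsupp.single_apply (a := Q), if_neg (Ne.symm hRQ),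
        Finsupp.single_apply (a := Q), if_neg (Ne.symm hRQ), add_zero, sub_zero] at hR
  have hfin : Finite (L (Finsupp.single P 2)) := finite_L _
  have h4 := AddSubgroup.card_le_of_le hle
  rw [card_L_eq (n := 4) (by rw [deg_single, hP]; norm_num), e_four, h2] at h4
  have := Nat.mul_le_mul h4 hE
  rw [pow_one] at hs
  omega

theorem Inv_peel (hE : Nat.card (Efix σ P) = 2) {n : ℤ} {f g : K} (hf : f ∈ fil P n)
    (hσf : σ f = f) (hg0 : g ≠ 0) (hg : ordAt P.1 g = n) (hσg : σ g = g) :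
    ∃ c : K, (c = 0 ∨ c = 1) ∧ f + c * g ∈ fil P (n + 1) := by
  have hfg : f / g ∈ P.1 := mem_fil_zero.mp ((div_mem_fil_one_iff P hg0 hg 0).mpr (by simpa using hf))
  have h01 : Efix σ P = {0, 1} := by
    refine (Set.eq_of_subset_of_ncard_le ?_ ?_ (Set.toFinite _)).symm
    · rintro _ (rfl | rfl)
      · exact ⟨0, P.1.zero_mem, by simp, by simp⟩
      · exact ⟨1, P.1.one_mem, by simp, by simp⟩
    · rw [Set.ncard_pair zero_ne_one]; exact hE.le
  have hm : resAt P (f / g) ∈ Efix σ P := ⟨f / g, hfg, rfl, by rw [map_div₀, hσf, hσg]⟩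
  rw [h01] at hm
  rcases hm with h | h
  · refine ⟨0, Or.inl rfl, ?_⟩
    rw [zero_mul, add_zero]
    exact (div_mem_fil_one_iff P hg0 hg 1).mp ((resAt_eq_zero_iff hfg).mp h)
  · refine ⟨1, Or.inr rfl, ?_⟩
    rw [one_mul, ← div_mem_fil_one_iff P hg0 hg 1, add_div, div_self hg0,
      ← resAt_eq_zero_iff (add_mem hfg P.1.one_mem), resAt_add hfg P.1.one_mem, h, resAt_one,
      CharTwo.add_self_eq_zero]

end Involution
end CFF

namespace CFF

open Polynomial IsLocalRing

theorem quad_cases {F : Type*} [Field F] [CharP F 2] {y a b : F} (ha : a = 0 ∨ a = 1)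
    (hb : b = 0 ∨ b = 1) (h : y ^ 2 + a * y = b) (h0 : y ≠ 0) (h1 : y ≠ 1) : a = 1 ∧ b = 1 := by
  rcases ha with rfl | rfl <;> rcases hb with rfl | rfl
  · exact absurd (pow_eq_zero_iff two_ne_zero |>.mp (by simpa using h)) h0
  · exact absurd (by grind) h1
  · grind
  · exact ⟨rfl, rfl⟩

section Involution

variable {K : Type} [Field K] [Algebra (ZMod 2) K] [FiveGonal K]

variable {σ : K ≃ₐ[ZMod 2] K} {P Q : Place (ZMod 2) K} {T : K}

/-- The reduction of `T` does not satisfy an Artin–Schreier equation split by invariants. -/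
theorem artinSchreier_contra (hP : mv σ P = P) {θ g : K} (hθ : θ ∈ P.1) (hσθ : σ θ = θ + 1)
    (hg : g ∈ P.1) (hσg : σ g = g) (h : θ ^ 2 + θ + (g ^ 2 + g) ∈ fil P 1) : False := by
  have h1 : (θ + g) * (θ + g + 1) = θ ^ 2 + θ + (g ^ 2 + g) := by
    linear_combination (θ * g) * CharTwo.two_eq_zero (R := K)
  have hm := add_mem hθ hg
  have hm1 := add_mem hm P.1.one_mem
  rw [← h1, ← resAt_eq_zero_iff (mul_mem hm hm1), resAt_mul hm hm1] at h
  rcases mul_eq_zero.mp h with h | h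
  · rw [resAt_add hθ hg] at h
    exact mv_ne_of_resAt hθ hσθ hg hσg (CharTwo.add_eq_zero.mp h) hP
  · rw [add_assoc, resAt_add hθ (add_mem hg P.1.one_mem)] at h
    exact mv_ne_of_resAt hθ hσθ (add_mem hg P.1.one_mem) (by rw [map_add, hσg, map_one])
      (CharTwo.add_eq_zero.mp h) hP

theorem mem_of_artinSchreier {θ : K} (h : θ ^ 2 + θ ∈ fil P (-1)) : θ ∈ P.1 := by
  by_contra hθ
  rw [← ordAt_nonneg_iff, not_le] at hθ
  have h0 : θ ≠ 0 := by rintro rfl; rw [ordAt_zero] at hθ; omega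
  obtain ⟨h1, h2⟩ := ordAt_add_eq (P := P) (f := θ) (g := 1) h0 (mem_fil_of_le (by rw [ordAt_one]; omega))
  rw [show θ ^ 2 + θ = θ * (θ + 1) by ring, mem_fil_of_ne (mul_ne_zero h0 h1), ordAt_mul P h0 h1,
    h2] at h
  omega

theorem pt_le_posPart {f : K} {R : Place (ZMod 2) K} (h0 : f ≠ 0) (h : f ∈ fil R 1) :
    pt R ≤ (dv f)⁺ := by
  intro S
  by_cases hS : S = R
  · subst hS
    rw [mem_fil_of_ne h0, ← dv_apply] at h
    rw [pt, Finsupp.single_eq_same, posPart_apply]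
    exact le_max_of_le_left h
  · rw [pt, Finsupp.single_apply, if_neg (Ne.symm hS)]
    exact posPart_nonneg (dv f) S

theorem mem_L_single {n : ℤ} {f : K} (h : f ∈ fil P (-n)) (h' : ∀ R, R ≠ P → f ∈ R.1) :
    f ∈ L (Finsupp.single P n) := by
  rw [mem_L]
  intro R
  by_cases hR : R = P
  · subst hR; rwa [Finsupp.single_eq_same]
  · rw [Finsupp.single_apply, if_neg (Ne.symm hR), neg_zero, mem_fil_zero]
    exact h' R hR

variable (h2 : e K 2 = 1) (hP : pdeg P = 2) (hQ : pdeg Q = 3)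

include h2 hP in
theorem eq_zero_or_one_of_fil {f : K} (h : f ∈ fil P (-1)) (h' : ∀ R, R ≠ P → f ∈ R.1) :
    f = 0 ∨ f = 1 := by
  by_contra! hf
  have := two_le_e (D := pt P) (n := 2) (by rw [deg_single, hP]; norm_num) pt_nonneg
    (mem_L_single h h') hf.1 hf.2
  omega

variable (hσ : σ ^ 2 = 1) (hT : σ T = T + 1) (hfP : mv σ P = P)
  (hfQ : mv σ Q = Q) (hPQ : P ≠ Q) (htQ : Triv σ Q) (hE : Nat.card (Efix σ P) = 2)
  (hoQ : ordAt Q.1 T = -1)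

include h2 hP hT hfP hfQ hPQ htQ hoQ in
theorem map_quartic {X : K} (hX : X ∈ L (Finsupp.single P 2)) (h0 : X ≠ 0) (h1 : X ≠ 1) :
    σ X = X := by
  rcases mem_L_quartic hP h2 hX h0 h1 (map_mem_L (fixed_single hfP 2) hX) with h | h | h | h
  · exact absurd ((map_eq_zero σ).mp h) h0
  · exact absurd (σ.injective (h.trans (map_one σ).symm)) h1
  · exact h
  · exfalso
    have hT0 : T ≠ 0 := by rintro rfl; rw [ordAt_zero] at hoQ; omega
    have hXQ := mem_L.mp hX Q
    rw [Finsupp.single_apply, if_neg hPQ] at hXQ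
    obtain ⟨h3, h4⟩ := ordAt_add_eq (P := Q) (f := T) (g := X) hT0 (by rw [hoQ]; simpa using hXQ)
    have h5 := even_ordAt hT hfQ htQ hoQ h3 (by
      rw [map_add, hT, h]
      linear_combination CharTwo.two_eq_zero (R := K))
    rw [h4, hoQ] at h5
    revert h5; decide

include hP hQ hfP hfQ in
theorem exists_cubic : ∃ Y : K, Y ≠ 0 ∧ dv Y = Finsupp.single Q 2 - Finsupp.single P 3 ∧ σ Y = Y := by
  obtain ⟨Y, h0, hY⟩ := exists_dv_eq (D := Finsupp.single Q 2 - Finsupp.single P 3)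
    (by rw [map_sub, deg_single, deg_single, hP, hQ]; norm_num)
  refine ⟨Y, h0, hY, dv_injective (by simpa using h0) h0 ?_⟩
  ext R
  obtain ⟨R, rfl⟩ : ∃ R', mv σ R' = R := ⟨_, mv_symm σ R⟩
  rw [dv_apply, ordAt_mv, ← dv_apply, hY, Finsupp.sub_apply, Finsupp.sub_apply, fixed_single hfP,
    fixed_single hfQ]

include hP hQ h2 hPQ in
theorem weierstrass_res {Y : K} (hY0 : Y ≠ 0)
    (hY : dv Y = Finsupp.single Q 2 - Finsupp.single P 3) {R : Place (ZMod 2) K} (hR : pdeg R = 4) :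
    Y ∈ R.1 ∧ resAt R Y ≠ 0 ∧ resAt R Y ≠ 1 := by
  have hRP : P ≠ R := by rintro rfl; omega
  have hRQ : Q ≠ R := by rintro rfl; omega
  have hoR : ordAt R.1 Y = 0 := by
    rw [← dv_apply, hY, Finsupp.sub_apply, Finsupp.single_apply, Finsupp.single_apply, if_neg hRP,
      if_neg hRQ, sub_zero]
  have hYR : Y ∈ R.1 := by rw [← ordAt_nonneg_iff, hoR]
  refine ⟨hYR, fun h => ?_, fun h => ?_⟩
  · rw [resAt_eq_zero_iff hYR, mem_fil_of_ne hY0, hoR] at h; omega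
  · have hY1 : Y + 1 ∈ fil R 1 := by
      rw [← resAt_eq_zero_iff (add_mem hYR R.1.one_mem), resAt_add hYR R.1.one_mem, h, resAt_one,
        CharTwo.add_self_eq_zero]
    have hYP : ordAt P.1 Y = -3 := by
      rw [← dv_apply, hY, Finsupp.sub_apply, Finsupp.single_apply, if_neg (Ne.symm hPQ),
        Finsupp.single_eq_same, zero_sub]
    obtain ⟨h10, h1P⟩ := ordAt_add_eq (P := P) (f := Y) (g := 1) hY0
      (mem_fil_of_le (by rw [hYP, ordAt_one]; norm_num))
    have hneg : (dv Y)⁻ = Finsupp.single P 3 := by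
      ext S
      have : (dv Y)⁻ S = max (-(dv Y S)) 0 := rfl
      rw [this, hY, Finsupp.sub_apply, Finsupp.single_apply, Finsupp.single_apply]
      split_ifs with a b b
      · exact absurd (b.trans a.symm) hPQ
      all_goals norm_num
    have hd : deg (dv (Y + 1))⁺ = 6 := by
      rw [← negPart_add_dv, map_add, deg_dv, negPart_add_one, hneg, deg_single, hP]; norm_num
    have hpP : (dv (Y + 1))⁺ P = 0 := by
      rw [posPart_apply, dv_apply, h1P, hYP]; rfl
    have hle : pt R ≤ (dv (Y + 1))⁺ := pt_le_posPart h10 hY1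
    have h0' : 0 ≤ (dv (Y + 1))⁺ - pt R := sub_nonneg.mpr hle
    have := eff_unique (n := 2) h2 h0' (pt_nonneg (P := P)) (by rw [map_sub, hd, deg_single, hR]; norm_num)
      (by rw [deg_single, hP]; norm_num)
    have := DFunLike.congr_fun this P
    rw [Finsupp.sub_apply, hpP, pt, pt, Finsupp.single_eq_same, Finsupp.single_apply,
      if_neg (Ne.symm hRP)] at this
    omega

end Involution
end CFF

namespace CFF

open Polynomial IsLocalRing

section Involution

variable {K : Type} [Field K] [Algebra (ZMod 2) K] [FiveGonal K]

variable {σ : K ≃ₐ[ZMod 2] K} {P Q : Place (ZMod 2) K} {T : K}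

/-- The `σ`-invariant functions regular away from `P`. -/
def affine (σ : K ≃ₐ[ZMod 2] K) (P : Place (ZMod 2) K) : Subring K where
  carrier := {f | σ f = f ∧ ∀ R, R ≠ P → f ∈ R.1}
  mul_mem' := fun ha hb =>
    ⟨by rw [map_mul, ha.1, hb.1], fun R hR => mul_mem (ha.2 R hR) (hb.2 R hR)⟩
  add_mem' := fun ha hb =>
    ⟨by rw [map_add, ha.1, hb.1], fun R hR => add_mem (ha.2 R hR) (hb.2 R hR)⟩
  one_mem' := ⟨map_one σ, fun R _ => R.1.one_mem⟩
  zero_mem' := ⟨map_zero σ, fun R _ => R.1.zero_mem⟩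
  neg_mem' := fun ha => ⟨by rw [map_neg, ha.1], fun R hR => neg_mem (ha.2 R hR)⟩

theorem bit_mem {A : Subring K} {c : K} (hc : c = 0 ∨ c = 1) : c ∈ A := by
  rcases hc with rfl | rfl
  exacts [zero_mem _, one_mem _]

theorem bit_mem' {A : ValuationSubring K} {c : K} (hc : c = 0 ∨ c = 1) : c ∈ A := by
  rcases hc with rfl | rfl
  exacts [zero_mem _, one_mem _]

theorem affine_peel (hE : Nat.card (Efix σ P) = 2) (n : ℤ) {m : ℤ} (hm : n + 1 = m) {f g : K}
    (hf : f ∈ affine σ P)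
    (hfn : f ∈ fil P n) (hg : g ∈ affine σ P) (hg0 : g ≠ 0) (hgn : ordAt P.1 g = n) :
    ∃ c : K, (c = 0 ∨ c = 1) ∧ f + c * g ∈ affine σ P ∧ f + c * g ∈ fil P m := by
  obtain ⟨c, hc, h⟩ := Inv_peel hE hfn hf.1 hg0 hgn hg.1
  exact ⟨c, hc, add_mem hf (mul_mem (bit_mem hc) hg), hm ▸ h⟩

/-- Generators of the invariant affine ring with poles of order two and three at `P`. -/
structure Coords (σ : K ≃ₐ[ZMod 2] K) (P : Place (ZMod 2) K) (X Y : K) : Prop where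
  inert : Nat.card (Efix σ P) = 2
  X_ne : X ≠ 0
  Y_ne : Y ≠ 0
  ord_X : ordAt P.1 X = -2
  ord_Y : ordAt P.1 Y = -3
  X_mem : X ∈ affine σ P
  Y_mem : Y ∈ affine σ P

variable {X Y : K}

theorem bit_fil {c : K} (hc : c = 0 ∨ c = 1) : c ∈ fil P 0 := mem_fil_zero.mpr (bit_mem' hc)

theorem Coords.add_one (h : Coords σ P X Y) : Coords σ P (X + 1) Y := by
  obtain ⟨h1, h2⟩ := ordAt_add_eq (P := P) (f := X) (g := 1) h.X_ne
    (mem_fil_of_le (by rw [h.ord_X, ordAt_one]; norm_num))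
  exact ⟨h.inert, h1, h.Y_ne, h2.trans h.ord_X, h.ord_Y, add_mem h.X_mem (one_mem _), h.Y_mem⟩

theorem Coords.peel_four (h2 : e K 2 = 1) (hP : pdeg P = 2) (h : Coords σ P X Y) {f : K}
    (hf : f ∈ affine σ P) (hfP : f ∈ fil P (-5)) : ∃ c5 c4 c3 c2 c0 : K, (c5 = 0 ∨ c5 = 1) ∧
      (c4 = 0 ∨ c4 = 1) ∧ (c3 = 0 ∨ c3 = 1) ∧ (c2 = 0 ∨ c2 = 1) ∧ (c0 = 0 ∨ c0 = 1) ∧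
      f = c5 * (X * Y) + c4 * X ^ 2 + c3 * Y + c2 * X + c0 := by
  obtain ⟨c5, h5, a5, b5⟩ := affine_peel h.inert (-5) (m := -4) (by norm_num) hf hfP (mul_mem h.X_mem h.Y_mem)
    (mul_ne_zero h.X_ne h.Y_ne) (by rw [ordAt_mul P h.X_ne h.Y_ne, h.ord_X, h.ord_Y]; norm_num)
  obtain ⟨c4, h4, a4, b4⟩ := affine_peel h.inert (-4) (m := -3) (by norm_num) a5 b5 (pow_mem h.X_mem 2)
    (pow_ne_zero 2 h.X_ne) (by rw [ordAt_pow, h.ord_X]; norm_num)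
  obtain ⟨c3, h3, a3, b3⟩ := affine_peel h.inert (-3) (m := -2) (by norm_num) a4 b4 h.Y_mem h.Y_ne h.ord_Y
  obtain ⟨c2, h2', a2, b2⟩ := affine_peel h.inert (-2) (m := -1) (by norm_num) a3 b3 h.X_mem h.X_ne h.ord_X
  refine ⟨c5, c4, c3, c2, _, h5, h4, h3, h2', eq_zero_or_one_of_fil h2 hP b2 a2.2, ?_⟩
  linear_combination (-(c5 * (X * Y) + c4 * X ^ 2 + c3 * Y + c2 * X)) * CharTwo.two_eq_zero (R := K)

theorem Coords.weierstrass (h2 : e K 2 = 1) (hP : pdeg P = 2) (h : Coords σ P X Y) :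
    ∃ a1 a2 a3 a4 a6 : K, (a1 = 0 ∨ a1 = 1) ∧
      (a2 = 0 ∨ a2 = 1) ∧ (a3 = 0 ∨ a3 = 1) ∧ (a4 = 0 ∨ a4 = 1) ∧ (a6 = 0 ∨ a6 = 1) ∧
      Y ^ 2 + a1 * (X * Y) + a3 * Y = X ^ 3 + a2 * X ^ 2 + a4 * X + a6 := by
  have oY : ordAt P.1 (Y ^ 2) = -6 := by rw [ordAt_pow, h.ord_Y]; norm_num
  obtain ⟨c, hc, a, b⟩ := affine_peel h.inert (-6) (m := -5) (by norm_num) (pow_mem h.Y_mem 2)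
    (mem_fil_of_le oY.ge) (pow_mem h.X_mem 3)
    (pow_ne_zero 3 h.X_ne) (by rw [ordAt_pow, h.ord_X]; norm_num)
  obtain ⟨a1, a2, a3, a4, a6, h1, h2', h3, h4, h6, heq⟩ := h.peel_four h2 hP a b
  refine ⟨a1, a2, a3, a4, a6, h1, h2', h3, h4, h6, ?_⟩
  rcases hc with rfl | rfl
  · rw [zero_mul, add_zero, mem_fil_of_ne (pow_ne_zero 2 h.Y_ne), oY] at b
    norm_num at b
  · linear_combination heq + (a1 * (X * Y) + a3 * Y - X ^ 3) * CharTwo.two_eq_zero (R := K)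

theorem quad_res {R : Place (ZMod 2) K} {y a b : K} (hy : y ∈ R.1) (h0 : resAt R y ≠ 0)
    (h1 : resAt R y ≠ 1) (ha : a = 0 ∨ a = 1) (hb : b = 0 ∨ b = 1)
    (h : y ^ 2 + a * y + b ∈ fil R 1) : a = 1 ∧ b = 1 := by
  have hm : y ^ 2 + a * y ∈ R.1 := add_mem (pow_mem hy 2) (mul_mem (bit_mem' ha) hy)
  rw [← resAt_eq_zero_iff (add_mem hm (bit_mem' hb)), resAt_add hm (bit_mem' hb),
    resAt_add (pow_mem hy 2) (mul_mem (bit_mem' ha) hy), resAt_pow hy,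
    resAt_mul (bit_mem' ha) hy] at h
  have key {c : K} (hc : c = 0 ∨ c = 1) :
      (resAt R c = 0 ∨ resAt R c = 1) ∧ (resAt R c = 1 → c = 1) := by
    rcases hc with rfl | rfl
    · simp
    · simp
  obtain ⟨h3, h4⟩ := quad_cases (key ha).1 (key hb).1 (CharTwo.add_eq_zero.mp h) h0 h1
  exact ⟨(key ha).2 h3, (key hb).2 h4⟩

theorem bit_add {a b : K} (ha : a = 0 ∨ a = 1) (hb : b = 0 ∨ b = 1) : a + b = 0 ∨ a + b = 1 := by
  rcases ha with rfl | rfl <;> rcases hb with rfl | rfl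
  · simp
  · simp
  · simp
  · exact Or.inl (CharTwo.add_self_eq_zero 1)

theorem mul_mem_fil_one {R : Place (ZMod 2) K} {x y : K} (hx : x ∈ fil R 1) (hy : y ∈ R.1) :
    x * y ∈ fil R 1 := by
  simpa using mul_mem_fil hx (mem_fil_zero.mpr hy)

theorem Coords.elliptic (h2 : e K 2 = 1) (hP : pdeg P = 2) (h : Coords σ P X Y)
    {R R' : Place (ZMod 2) K} (hXR : X ∈ fil R 1) (hXR' : X + 1 ∈ fil R' 1)
    (hR : Y ∈ R.1 ∧ resAt R Y ≠ 0 ∧ resAt R Y ≠ 1)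
    (hR' : Y ∈ R'.1 ∧ resAt R' Y ≠ 0 ∧ resAt R' Y ≠ 1) :
    Y ^ 2 + Y = X ^ 3 + X + 1 ∨ Y ^ 2 + Y = (X + 1) ^ 3 + (X + 1) + 1 := by
  obtain ⟨a1, a2, a3, a4, a6, h1, h2', h3, h4, h6, heq⟩ := h.weierstrass h2 hP
  have hX : X ∈ R.1 := mem_fil_zero.mp (fil_mono (by norm_num) hXR)
  have hX' : X + 1 ∈ R'.1 := mem_fil_zero.mp (fil_mono (by norm_num) hXR')
  have hX'' : X ∈ R'.1 := by simpa using sub_mem hX' R'.1.one_mem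
  obtain ⟨rfl, rfl⟩ := quad_res hR.1 hR.2.1 hR.2.2 h3 h6 (by
    have : Y ^ 2 + a3 * Y + a6 = X * (X ^ 2 + a2 * X + a4 + a1 * Y) := by
      linear_combination heq + (a6 - a1 * X * Y) * CharTwo.two_eq_zero (R := K)
    rw [this]
    exact mul_mem_fil_one hXR (add_mem (add_mem (add_mem (pow_mem hX 2) (mul_mem (bit_mem' h2') hX))
      (bit_mem' h4)) (mul_mem (bit_mem' h1) hR.1)))
  obtain ⟨ha, hb⟩ := quad_res hR'.1 hR'.2.1 hR'.2.2 (bit_add h1 (Or.inr rfl)) (bit_add h2' h4) (by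
    have : Y ^ 2 + (a1 + 1) * Y + (a2 + a4) = (X + 1) * (X ^ 2 + X + 1 + a2 * (X + 1) + a4 + a1 * Y) := by
      linear_combination heq + (a2 * X^2+a2*X+ a4*X+a2+a4-X^2-X+1 - a1*X*Y - (1+a2+2*a2*X+a2*X^2+a4+a4*X)) * CharTwo.two_eq_zero (R := K)
    rw [this]
    refine mul_mem_fil_one hXR' ?_
    exact add_mem (add_mem (add_mem (add_mem (add_mem (pow_mem hX'' 2) hX'') (one_mem _))
      (mul_mem (bit_mem' h2') hX')) (bit_mem' h4)) (mul_mem (bit_mem' h1) hR'.1))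
  obtain rfl : a1 = 0 := by simpa using ha
  rcases h2' with rfl | rfl
  · obtain rfl : a4 = 1 := by simpa using hb
    left
    linear_combination heq
  · obtain rfl : a4 = 0 := by simpa using hb
    right
    linear_combination heq - (X^2+2*X+1) * CharTwo.two_eq_zero (R := K)

end Involution
end CFF

namespace CFF

open Polynomial IsLocalRing

section Involution

variable {K : Type} [Field K] [Algebra (ZMod 2) K] [FiveGonal K]

variable {σ : K ≃ₐ[ZMod 2] K} {P Q : Place (ZMod 2) K} {T X Y : K}

theorem map_mul_add_one (hT : σ T = T + 1) : σ (T * (T + 1)) = T * (T + 1) := by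
  rw [map_mul, map_add, hT, map_one]
  linear_combination (T + 1) * CharTwo.two_eq_zero (R := K)

/-- The Artin–Schreier equation of `T` over the coordinates. -/
theorem Coords.exists_eq (h2 : e K 2 = 1) (hP : pdeg P = 2) (h : Coords σ P X Y)
    (hT : σ T = T + 1) (hTP : ordAt P.1 T = -1) (hreg : ∀ R, R ≠ P → T * (T + 1) * Y ∈ R.1) :
    ∃ c4 c3 c2 c0 : K, (c4 = 0 ∨ c4 = 1) ∧ (c3 = 0 ∨ c3 = 1) ∧ (c2 = 0 ∨ c2 = 1) ∧
      (c0 = 0 ∨ c0 = 1) ∧ T ^ 2 + T = X + c4 * X ^ 2 / Y + c3 + c2 * X / Y + c0 / Y := by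
  have hT0 : T ≠ 0 := by rintro rfl; rw [ordAt_zero] at hTP; omega
  obtain ⟨hT1, hT1P⟩ := ordAt_add_eq (P := P) (f := T) (g := 1) hT0
    (mem_fil_of_le (by rw [hTP, ordAt_one]; norm_num))
  have hT2 := mul_ne_zero hT0 hT1
  have hU0 := mul_ne_zero hT2 h.Y_ne
  have oU : ordAt P.1 (T * (T + 1) * Y) = -5 := by
    rw [ordAt_mul P hT2 h.Y_ne, ordAt_mul P hT0 hT1, hT1P, hTP, h.ord_Y]; norm_num
  obtain ⟨c5, c4, c3, c2, c0, h5, h4, h3, h2', h0, heq⟩ := h.peel_four h2 hP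
    (f := T * (T + 1) * Y) ⟨by rw [map_mul, map_mul_add_one hT, h.Y_mem.1], hreg⟩
    (mem_fil_of_le oU.ge)
  refine ⟨c4, c3, c2, c0, h4, h3, h2', h0, ?_⟩
  have hX : X ∈ fil P (-2) := mem_fil_of_le h.ord_X.ge
  have hY : Y ∈ fil P (-4) := mem_fil_of_le (by rw [h.ord_Y]; norm_num)
  rcases h5 with rfl | rfl
  · exfalso
    have hb {c g : K} (hc : c = 0 ∨ c = 1) (hg : g ∈ fil P (-4)) : c * g ∈ fil P (-4) := by
      simpa using mul_mem_fil (bit_fil hc) hg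
    have : T * (T + 1) * Y ∈ fil P (-4) := by
      rw [heq, zero_mul, zero_add]
      refine add_mem (add_mem (add_mem (hb h4 ?_) (hb h3 hY)) (hb h2' (fil_mono (by norm_num) hX)))
        (fil_mono (by norm_num) (bit_fil h0))
      have := pow_mem_fil hX 2
      exact fil_mono (by norm_num) this
    rw [mem_fil_of_ne hU0, oU] at this
    norm_num at this
  · have hY0 := h.Y_ne
    field_simp
    linear_combination heq

theorem Coords.coeff_infinity (h : Coords σ P X Y) (hfP : mv σ P = P) (hT : σ T = T + 1)
    (hXY : Y ^ 2 + Y = X ^ 3 + X + 1) {c4 c3 c2 c0 : K} (h4 : c4 = 0 ∨ c4 = 1)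
    (h3 : c3 = 0 ∨ c3 = 1) (h2 : c2 = 0 ∨ c2 = 1) (h0 : c0 = 0 ∨ c0 = 1)
    (heq : T ^ 2 + T = X + c4 * X ^ 2 / Y + c3 + c2 * X / Y + c0 / Y) : c4 = 1 ∧ c3 = 1 := by
  have hX0 := h.X_ne
  have hY0 := h.Y_ne
  have two := CharTwo.two_eq_zero (R := K)
  have oX : X ∈ fil P (-2) := mem_fil_of_le h.ord_X.ge
  have oY : Y ∈ fil P (-3) := mem_fil_of_le h.ord_Y.ge
  have iX : X⁻¹ ∈ fil P 2 := mem_fil_of_le (by rw [ordAt_inv, h.ord_X]; norm_num)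
  have iY : Y⁻¹ ∈ fil P 3 := mem_fil_of_le (by rw [ordAt_inv, h.ord_Y]; norm_num)
  have hX2 : X ^ 2 * Y⁻¹ ∈ fil P (-1) := by
    have := mul_mem_fil (pow_mem_fil oX 2) iY
    norm_num at this; exact this
  have hXY1 : X * Y⁻¹ ∈ fil P 1 := by
    have := mul_mem_fil oX iY; norm_num at this; exact this
  have hYX : Y * X⁻¹ ∈ fil P (-1) := by
    have := mul_mem_fil oY iX; norm_num at this; exact this
  have hs : (Y + X + 1) ∈ fil P (-3) :=
    add_mem (add_mem oY (fil_mono (by norm_num) oX)) (fil_mono (by norm_num) (bit_fil (Or.inr rfl)))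
  have hs1 : (Y + X + 1) * X⁻¹ ^ 2 ∈ fil P 1 := by
    have := mul_mem_fil hs (pow_mem_fil iX 2); norm_num at this; rwa [inv_pow]
  have hb {c g : K} (n : ℤ) (hc : c = 0 ∨ c = 1) (hg : g ∈ fil P n) : c * g ∈ fil P n := by
    simpa using mul_mem_fil (bit_fil hc) hg
  have htail : c2 * (X * Y⁻¹) + c0 * Y⁻¹ + (Y + X + 1) * X⁻¹ ^ 2 ∈ fil P 1 :=
    add_mem (add_mem (hb 1 h2 hXY1) (hb 1 h0 (fil_mono (by norm_num) iY))) hs1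
  have hθ : (T + Y * X⁻¹) ^ 2 + (T + Y * X⁻¹) = c4 * (X ^ 2 * Y⁻¹) + Y * X⁻¹ + c3 +
      (c2 * (X * Y⁻¹) + c0 * Y⁻¹ + (Y + X + 1) * X⁻¹ ^ 2) := by
    have e1 : (Y * X⁻¹) ^ 2 = X + (Y + X + 1) * X⁻¹ ^ 2 := by
      field_simp
      linear_combination hXY - Y * two
    linear_combination heq + e1 + (X + T * (Y * X⁻¹)) * two
  have hθP : T + Y * X⁻¹ ∈ P.1 := mem_of_artinSchreier (by
    rw [hθ]
    exact add_mem (add_mem (add_mem (hb _ h4 hX2) hYX) (fil_mono (by norm_num) (bit_fil h3)))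
      (fil_mono (by norm_num) htail))
  have hθ2 : (T + Y * X⁻¹) ^ 2 + (T + Y * X⁻¹) ∈ fil P 0 :=
    mem_fil_zero.mpr (add_mem (pow_mem hθP 2) hθP)
  have hσθ : σ (T + Y * X⁻¹) = T + Y * X⁻¹ + 1 := by
    rw [map_add, map_mul, map_inv₀, h.X_mem.1, h.Y_mem.1, hT]; ring
  rcases h4 with rfl | rfl
  · exfalso
    have : Y * X⁻¹ ∈ fil P 0 := by
      have h5 := sub_mem (sub_mem hθ2 (fil_mono (by norm_num) htail)) (bit_fil h3)
      rw [hθ] at h5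
      simpa using h5
    rw [mem_fil_of_ne (mul_ne_zero hY0 (inv_ne_zero hX0)), ordAt_mul P hY0 (inv_ne_zero hX0),
      ordAt_inv, h.ord_X, h.ord_Y] at this
    norm_num at this
  refine ⟨rfl, ?_⟩
  rcases h3 with rfl | rfl
  · exfalso
    have e2 : 1 * (X ^ 2 * Y⁻¹) + Y * X⁻¹ = (Y + X + 1) * (X⁻¹ * Y⁻¹) := by
      field_simp
      linear_combination hXY + (X ^ 3 - Y) * two
    refine artinSchreier_contra hfP hθP hσθ P.1.zero_mem (map_zero σ) ?_
    rw [hθ, e2]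
    simp only [add_zero, ne_eq, OfNat.ofNat_ne_zero, not_false_eq_true, zero_pow]
    refine add_mem ?_ htail
    have := mul_mem_fil hs (mul_mem_fil iX iY)
    exact fil_mono (by norm_num) this
  · rfl

end Involution
end CFF

namespace CFF

open Polynomial IsLocalRing

section Involution

variable {K : Type} [Field K] [Algebra (ZMod 2) K] [FiveGonal K]

variable {σ : K ≃ₐ[ZMod 2] K} {P Q : Place (ZMod 2) K} {T X Y : K}

theorem Coords.coeff_finite (h : Coords σ P X Y) (hT : σ T = T + 1)
    (hXY : Y ^ 2 + Y = X ^ 3 + X + 1) {c2 c0 : K}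
    (h2 : c2 = 0 ∨ c2 = 1) (h0 : c0 = 0 ∨ c0 = 1)
    (heq : T ^ 2 + T = X + 1 * X ^ 2 / Y + 1 + c2 * X / Y + c0 / Y)
    {R R' : Place (ZMod 2) K} (hR : mv σ R = R) (hR' : mv σ R' = R') (hXR : X ∈ fil R 1)
    (hXR' : X + 1 ∈ fil R' 1) (hTR : T ∈ R.1) (hTR' : T ∈ R'.1) (hYR : Y ∈ R.1) (hYR' : Y⁻¹ ∈ R'.1)
    (hYR1 : Y⁻¹ ∈ R.1) : c2 = 1 ∧ c0 = 1 := by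
  have hY0 := h.Y_ne
  have two := CharTwo.two_eq_zero (R := K)
  have hX : X ∈ R.1 := mem_fil_zero.mp (fil_mono (by norm_num) hXR)
  have hX' : X + 1 ∈ R'.1 := mem_fil_zero.mp (fil_mono (by norm_num) hXR')
  have h0' : c0 = 1 := by
    rcases h0 with rfl | rfl
    · exfalso
      refine artinSchreier_contra hR hTR hT hYR h.Y_mem.1 ?_
      have : T ^ 2 + T + (Y ^ 2 + Y) = X * (X * Y⁻¹ + c2 * Y⁻¹ + X ^ 2) := by
        linear_combination heq + hXY + (1 + X) * two
      rw [this]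
      exact mul_mem_fil_one hXR (add_mem (add_mem (mul_mem hX hYR1) (mul_mem (bit_mem' h2) hYR1))
        (pow_mem hX 2))
    · rfl
  refine ⟨?_, h0'⟩
  subst h0'
  rcases h2 with rfl | rfl
  · exfalso
    refine artinSchreier_contra hR' hTR' hT R'.1.zero_mem (map_zero σ) ?_
    have : T ^ 2 + T + (0 ^ 2 + 0) = (X + 1) * (1 + (X + 1) * Y⁻¹) := by
      linear_combination heq - (X * Y⁻¹) * two
    rw [this]
    exact mul_mem_fil_one hXR' (add_mem R'.1.one_mem (mul_mem hX' hYR'))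
  · rfl

theorem Coords.moves (h : Coords σ P X Y) (hT : σ T = T + 1)
    (hXY : Y ^ 2 + Y = X ^ 3 + X + 1)
    (heq : T ^ 2 + T = X + 1 * X ^ 2 / Y + 1 + 1 * X / Y + 1 / Y)
    {Z : Place (ZMod 2) K} (hXZ : X ∈ Z.1) (hYZ : Y + 1 ∈ fil Z 1) (hTZ : T ∈ Z.1)
    (hYZ' : Y ∈ Z.1) (hYZ1 : Y⁻¹ ∈ Z.1) : mv σ Z ≠ Z := fun hZ => by
  have hY0 := h.Y_ne
  have two := CharTwo.two_eq_zero (R := K)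
  refine artinSchreier_contra (g := X ^ 2 + X) hZ hTZ hT (add_mem (pow_mem hXZ 2) hXZ)
    (by rw [map_add, map_pow, h.X_mem.1]) ?_
  have : T ^ 2 + T + ((X ^ 2 + X) ^ 2 + (X ^ 2 + X)) =
      (Y + 1) * ((X ^ 2 + X + 1) * Y⁻¹ + X * Y) := by
    have hi : Y * Y⁻¹ = 1 := mul_inv_cancel₀ hY0
    linear_combination heq - X * hXY - (X ^ 2 + X + 1) * hi + X ^ 3 * two
  rw [this]
  exact mul_mem_fil_one hYZ (add_mem (mul_mem (add_mem (add_mem (pow_mem hXZ 2) hXZ) Z.1.one_mem)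
    hYZ1) (mul_mem hXZ hYZ'))

end Involution
end CFF

namespace CFF

open Polynomial IsLocalRing

section Involution

variable {K : Type} [Field K] [Algebra (ZMod 2) K] [FiveGonal K]

variable {σ : K ≃ₐ[ZMod 2] K} {P Q : Place (ZMod 2) K} {T X Y : K}

theorem ordAt_cubic (hY : dv Y = Finsupp.single Q 2 - Finsupp.single P 3)
    {R : Place (ZMod 2) K} (hRP : R ≠ P) (hRQ : R ≠ Q) : ordAt R.1 Y = 0 := by
  rw [← dv_apply, hY, Finsupp.sub_apply, Finsupp.single_apply, Finsupp.single_apply,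
    if_neg hRQ.symm, if_neg hRP.symm, sub_zero]

theorem Coords.exists_moved (h2 : e K 2 = 1) (hP : pdeg P = 2) (hQ : pdeg Q = 3)
    (h : Coords σ P X Y) (hPQ : P ≠ Q) (hfP : mv σ P = P) (hfQ : mv σ Q = Q)
    (hY : dv Y = Finsupp.single Q 2 - Finsupp.single P 3)
    (hmv : ∀ Z : Place (ZMod 2) K, Z ≠ P → Z ≠ Q → Y + 1 ∈ fil Z 1 → mv σ Z ≠ Z)
    (h3 : e K 3 = 1) : False := by
  obtain ⟨h10, h1P⟩ := ordAt_add_eq (P := P) (f := Y) (g := 1) h.Y_ne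
    (mem_fil_of_le (by rw [h.ord_Y, ordAt_one]; norm_num))
  have hneg : (dv Y)⁻ = Finsupp.single P 3 := by
    ext S
    have : (dv Y)⁻ S = max (-(dv Y S)) 0 := rfl
    rw [this, hY, Finsupp.sub_apply, Finsupp.single_apply, Finsupp.single_apply]
    split_ifs with a b b
    · exact absurd (b.trans a.symm) hPQ
    all_goals norm_num
  have hd : deg (dv (Y + 1))⁺ = 6 := by
    rw [← negPart_add_dv, map_add, deg_dv, negPart_add_one, hneg, deg_single, hP]; norm_num
  obtain ⟨Z, hZ⟩ := exists_pos_of_ne (posPart_nonneg (dv (Y + 1))) (by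
    intro h; rw [h, map_zero] at hd; norm_num at hd)
  have hZ1 : 1 ≤ ordAt Z.1 (Y + 1) := by
    have := hZ Z
    rw [pt, Finsupp.single_eq_same, posPart_apply, dv_apply] at this
    omega
  have hZP : Z ≠ P := by
    rintro rfl
    rw [h1P, h.ord_Y] at hZ1; norm_num at hZ1
  have hZQ : Z ≠ Q := by
    rintro rfl
    have hYZ : Y ∈ fil Z 1 := mem_fil_of_le (by
      rw [← dv_apply, hY, Finsupp.sub_apply, Finsupp.single_eq_same, Finsupp.single_apply, if_neg hPQ]
      norm_num)
    have := sub_mem (mem_fil_of_le (P := Z) hZ1) hYZ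
    rw [add_sub_cancel_left, mem_fil_of_ne one_ne_zero, ordAt_one] at this
    norm_num at this
  have hm := hmv Z hZP hZQ (mem_fil_of_le hZ1)
  have hσZ : pt (mv σ Z) ≤ (dv (Y + 1))⁺ := pt_le_posPart h10 (mem_fil_of_le (by
    have := ordAt_mv σ Z (Y + 1)
    rw [map_add, h.Y_mem.1, map_one] at this
    rw [this]; exact hZ1))
  have hle : pt Z + pt (mv σ Z) ≤ (dv (Y + 1))⁺ := by
    intro S
    have a := hZ S
    have b := hσZ S
    rw [pt, Finsupp.single_apply] at a b
    rw [Finsupp.add_apply, pt, pt, Finsupp.single_apply, Finsupp.single_apply]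
    split_ifs at a b ⊢ with c d
    · exact absurd (d.trans c.symm) hm
    all_goals omega
  have h6 := deg_mono hle
  rw [map_add, deg_single, deg_single, pdeg_mv, hd] at h6
  have hpos : 0 < pdeg Z := placeDegree_pos Z
  have n1 : pdeg Z ≠ 1 := e_zero_of_place (by exact_mod_cast e_one K) Z
  have hc : pdeg Z = 2 ∨ pdeg Z = 3 := by omega
  rcases hc with hc | hc
  · exact hZP (eq_of_e_eq_one h2 hc hP)
  · exact hZQ (eq_of_e_eq_one (by exact_mod_cast h3) hc hQ)

theorem false_of_elliptic (h2 : e K 2 = 1) (h3 : e K 3 = 1) (hP : pdeg P = 2) (hQ : pdeg Q = 3)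
    (h : Coords σ P X Y) (hPQ : P ≠ Q) (hfP : mv σ P = P) (hfQ : mv σ Q = Q)
    (hT : σ T = T + 1) (hTp : (dv T)⁻ = pt P + pt Q)
    (hY : dv Y = Finsupp.single Q 2 - Finsupp.single P 3)
    (hXY : Y ^ 2 + Y = X ^ 3 + X + 1) {R R' : Place (ZMod 2) K} (hR4 : pdeg R = 4)
    (hR4' : pdeg R' = 4) (hR : mv σ R = R) (hR' : mv σ R' = R') (hXR : X ∈ fil R 1)
    (hXR' : X + 1 ∈ fil R' 1) : False := by
  obtain ⟨oP, oQ⟩ := ordAt_pt_add hPQ hTp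
  have hTm (S : Place (ZMod 2) K) (hSP : S ≠ P) (hSQ : S ≠ Q) : T ∈ S.1 := mem_of_poles (by
    rw [hTp, Finsupp.add_apply, pt, pt, Finsupp.single_apply, Finsupp.single_apply,
      if_neg hSP.symm, if_neg hSQ.symm, add_zero])
  have hYm (S : Place (ZMod 2) K) (hSP : S ≠ P) (hSQ : S ≠ Q) : Y ∈ S.1 ∧ Y⁻¹ ∈ S.1 := by
    have := ordAt_cubic hY hSP hSQ
    rw [← ordAt_nonneg_iff, ← ordAt_nonneg_iff, ordAt_inv, this]
    norm_num
  obtain ⟨c4, c3, c2, c0, h4, h3', h2', h0, heq⟩ := h.exists_eq h2 hP hT oP (fun S hS => by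
    by_cases hSQ : S = Q
    · subst hSQ
      have a : T ∈ fil S (-1) := mem_fil_of_le oQ.ge
      have b : T + 1 ∈ fil S (-1) := add_mem a (fil_mono (by norm_num) (bit_fil (Or.inr rfl)))
      have c : Y ∈ fil S 2 := mem_fil_of_le (by
        rw [← dv_apply, hY, Finsupp.sub_apply, Finsupp.single_eq_same, Finsupp.single_apply, if_neg hPQ]
        norm_num)
      have := mul_mem_fil (mul_mem_fil a b) c
      norm_num at this
      exact mem_fil_zero.mp this
    · have a := hTm S hS hSQ
      exact mul_mem (mul_mem a (add_mem a S.1.one_mem)) (hYm S hS hSQ).1)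
  obtain ⟨rfl, rfl⟩ := h.coeff_infinity hfP hT hXY h4 h3' h2' h0 heq
  have hne {S : Place (ZMod 2) K} (hS : pdeg S = 4) : S ≠ P ∧ S ≠ Q :=
    ⟨by rintro rfl; omega, by rintro rfl; omega⟩
  obtain ⟨a, b⟩ := hne hR4
  obtain ⟨a', b'⟩ := hne hR4'
  obtain ⟨rfl, rfl⟩ := h.coeff_finite hT hXY h2' h0 heq hR hR' hXR hXR' (hTm R a b) (hTm R' a' b')
    (hYm R a b).1 (hYm R' a' b').2 (hYm R a b).2
  refine h.exists_moved h2 hP hQ hPQ hfP hfQ hY (fun Z hZP hZQ hZ => ?_) h3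
  exact h.moves hT hXY heq (h.X_mem.2 Z hZP) hZ (hTm Z hZP hZQ) (hYm Z hZP hZQ).1 (hYm Z hZP hZQ).2

/-- No involution of Artin–Schreier type exists when there is a place of degree three. -/
theorem false_of_e_three_ne_zero (hσ : σ ^ 2 = 1) (hT : σ T = T + 1) (h5 : HasDeg T 5)
    (h2 : e K 2 = 1) (h3 : e K 3 ≠ 0) : False := by
  obtain ⟨P, hP⟩ := exists_place_of_e_two h2
  obtain ⟨Q, hQ⟩ := exists_place_of_e_three h3
  have h3 := e_three_eq_one h5 h2 h3
  have hfP := mv_eq_of_e_eq_one (n := 2) h2 hP σ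
  have hfQ := mv_eq_of_e_eq_one (n := 3) h3 hQ σ
  have htQ : Triv σ Q := triv_of_not_dvd Nat.prime_two hσ hfQ (by omega)
  have hPQ : P ≠ Q := by rintro rfl; omega
  have hTp := poles_eq_two_three h5 hT hP hQ h2
  obtain ⟨oP, oQ⟩ := ordAt_pt_add hPQ hTp
  have hE : Nat.card (Efix σ P) = 2 := by
    simpa using card_Efix (n := 1) Nat.prime_two hσ hfP (not_triv_two h5 hσ hT hP hQ h2 h3) hP
  obtain ⟨X, hX, hX0, hX1⟩ := exists_quartic hP h2
  have hσX := map_quartic h2 hP hT hfP hfQ hPQ htQ oQ hX hX0 hX1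
  obtain ⟨Y, hY0, hY, hσY⟩ := exists_cubic hP hQ hfP hfQ
  have hXp := poles_quartic hP h2 hX hX0 hX1
  have hX10 : X + 1 ≠ 0 := fun h => hX1 (CharTwo.add_eq_zero.mp h)
  have hX11 : X + 1 ≠ 1 := fun h => hX0 (by simpa using h)
  have hXm : X + 1 ∈ L (Finsupp.single P 2) :=
    add_mem hX (one_mem_L (Finsupp.single_nonneg.mpr (by norm_num)))
  have hzero {x : K} (hx : x ∈ L (Finsupp.single P 2)) (hx0 : x ≠ 0) (hx1 : x ≠ 1) (hσx : σ x = x) :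
      ∃ R, pdeg R = 4 ∧ mv σ R = R ∧ x ∈ fil R 1 := by
    obtain ⟨R, hR, hRx⟩ := zeros_quartic hP h2 hx hx0 hx1
    have hRo : 1 ≤ ordAt R.1 x := by
      have := DFunLike.congr_fun hRx R
      rw [pt, Finsupp.single_eq_same, posPart_apply, dv_apply] at this
      omega
    refine ⟨R, hR, pt_injective ?_, mem_fil_of_le hRo⟩
    have hle := pt_le_posPart (R := mv σ R) hx0 (mem_fil_of_le (by
      have := ordAt_mv σ R x
      rw [hσx] at this
      rw [this]; exact hRo))
    rw [hRx] at hle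
    refine (sub_eq_zero.mp (eq_zero_of_deg (sub_nonneg.mpr hle) ?_)).symm
    rw [map_sub, deg_single, deg_single, pdeg_mv, sub_self]
  obtain ⟨R, hR4, hR, hXR⟩ := hzero hX hX0 hX1 hσX
  obtain ⟨R', hR4', hR', hXR'⟩ := hzero hXm hX10 hX11 (by rw [map_add, hσX, map_one])
  have hC : Coords σ P X Y := by
    refine ⟨hE, hX0, hY0, ?_, ?_, ⟨hσX, fun R hRP => ?_⟩, ⟨hσY, fun R hRP => ?_⟩⟩
    · rw [ordAt_of_poles (by rw [hXp]; simp), hXp, Finsupp.single_eq_same]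
    · rw [← dv_apply, hY, Finsupp.sub_apply, Finsupp.single_apply, if_neg hPQ.symm,
        Finsupp.single_eq_same, zero_sub]
    · exact mem_of_poles (by rw [hXp, Finsupp.single_apply, if_neg hRP.symm])
    · rw [← ordAt_nonneg_iff, ← dv_apply, hY, Finsupp.sub_apply, Finsupp.single_apply (a := P),
        if_neg hRP.symm, sub_zero]
      exact (Finsupp.single_nonneg.mpr (by norm_num) : (0 : Div K) ≤ Finsupp.single Q 2) R
  rcases hC.elliptic h2 hP hXR hXR' (weierstrass_res h2 hP hQ hPQ hY0 hY hR4)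
    (weierstrass_res h2 hP hQ hPQ hY0 hY hR4') with hXY | hXY
  · exact false_of_elliptic h2 h3 hP hQ hC hPQ hfP hfQ hT hTp hY hXY hR4 hR4' hR hR' hXR hXR'
  · refine false_of_elliptic h2 h3 hP hQ hC.add_one hPQ hfP hfQ hT hTp hY hXY hR4' hR4 hR' hR hXR' ?_
    rwa [add_assoc, CharTwo.add_self_eq_zero, add_zero]

end Involution
end CFF

namespace CFF

open Polynomial

set_option synthInstance.maxSize 4096 in
set_option maxRecDepth 100000 in
theorem exists_split : ∀ f₀ f₁ f₂ f₃ f₄ g₀ g₁ g₂ g₃ g₄ : ZMod 2,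
    ∃ α ∈ ([0, 1, ⟨⟨0, 1⟩, 0⟩, ⟨0, 1⟩, ⟨1, 1⟩, ⟨⟨1, 0⟩, ⟨0, 1⟩⟩, ⟨⟨0, 1⟩, ⟨0, 1⟩⟩] : List F16),
    ∃ b₁ b₂ b₃ : ZMod 2,
      α ^ 5 + f₄ • α ^ 4 + f₃ • α ^ 3 + f₂ • α ^ 2 + f₁ • α + f₀ • 1 = 0 ∨
      (b₃ • α ^ 3 + b₂ • α ^ 2 + b₁ • α + (b₃ • α ^ 3 + b₂ • α ^ 2 + b₁ • α) ^ 2) *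
        (α ^ 5 + f₄ • α ^ 4 + f₃ • α ^ 3 + f₂ • α ^ 2 + f₁ • α + f₀ • 1) +
        (α ^ 5 + g₄ • α ^ 4 + g₃ • α ^ 3 + g₂ • α ^ 2 + g₁ • α + g₀ • 1) = 0 := by
  decide +kernel


theorem F16_noZeroDivisors : ∀ a b : F16, a * b = 0 → a = 0 ∨ b = 0 := by decide +kernel

instance : IsDomain F16 :=
  have : Nontrivial F16 := ⟨0, 1, by decide +kernel⟩
  have : NoZeroDivisors F16 := ⟨fun {a b} => F16_noZeroDivisors a b⟩
  NoZeroDivisors.to_isDomain _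

theorem finrank_F16 : Module.finrank (ZMod 2) F16 = 4 := by
  have h := Module.natCard_eq_pow_finrank (K := ZMod 2) (V := F16)
  rw [card_F16, Nat.card_zmod] at h
  exact (Nat.pow_right_injective le_rfl (by simpa using h)).symm

theorem irreducible_minpoly_F16 (α : F16) :
    Irreducible (minpoly (ZMod 2) α) ∧ (minpoly (ZMod 2) α).natDegree ≤ 4 := by
  have : Finite F16 := Nat.finite_of_card_ne_zero (by rw [card_F16]; norm_num)
  exact ⟨minpoly.irreducible (Algebra.IsIntegral.isIntegral α),
    finrank_F16 ▸ minpoly.natDegree_le α⟩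

/-- A rational function of degree five takes somewhere on `F16` a value of the form `β ^ 2 + β`. -/
theorem exists_minpoly_dvd {F G : (ZMod 2)[X]} (hF : F.Monic) (hF5 : F.natDegree = 5) (hG : G.Monic)
    (hG5 : G.natDegree = 5) : ∃ r b : (ZMod 2)[X], Irreducible r ∧ r.natDegree ≤ 4 ∧
      (r ∣ F ∨ r ∣ (b ^ 2 + b) * F + G) := by
  have key {F : (ZMod 2)[X]} (hF : F.Monic) (hF5 : F.natDegree = 5) (α : F16) :
      aeval α F = α ^ 5 + F.coeff 4 • α ^ 4 + F.coeff 3 • α ^ 3 + F.coeff 2 • α ^ 2 +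
        F.coeff 1 • α + F.coeff 0 • 1 := by
    have h : F.coeff 5 = 1 := by rw [← hF5]; exact hF
    rw [aeval_eq_sum_range, hF5]
    simp only [Finset.sum_range_succ, Finset.sum_range_zero, h]
    rw [pow_zero, pow_one, one_smul]
    ring
  obtain ⟨α, -, b₁, b₂, b₃, h⟩ := exists_split (F.coeff 0) (F.coeff 1) (F.coeff 2) (F.coeff 3)
    (F.coeff 4) (G.coeff 0) (G.coeff 1) (G.coeff 2) (G.coeff 3) (G.coeff 4)
  obtain ⟨h1, h2⟩ := irreducible_minpoly_F16 α
  refine ⟨minpoly (ZMod 2) α, b₃ • X ^ 3 + b₂ • X ^ 2 + b₁ • X, h1, h2,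
    h.imp (fun h => minpoly.dvd _ _ ((key hF hF5 α).trans h)) (fun h => minpoly.dvd _ _ ?_)⟩
  rw [map_add, map_mul, key hF hF5, key hG hG5, map_add, map_pow]
  simp only [map_add, map_smul, map_pow, aeval_X]
  rw [add_comm ((_ : F16) ^ 2)]
  exact h

end CFF

namespace CFF

open Polynomial IsLocalRing

section

variable {K : Type} [Field K] [Algebra (ZMod 2) K] [FiveGonal K]

variable {σ : K ≃ₐ[ZMod 2] K} {Q R S : Place (ZMod 2) K} {T z : K}

theorem div_quadratic (hR : pdeg R = 2) (hz : z ∈ L (pt R)) (h0 : z ≠ 0) (h1 : z ≠ 1) :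
    (dv z)⁻ = pt R := by
  have hle := negPart_le_of_mem pt_nonneg hz
  have hpos := deg_poles_pos h0 h1
  have hle' : 0 ≤ pt R - (dv z)⁻ := sub_nonneg.mpr hle
  have h3 := deg_nonneg hle'
  have h4 := negPart_nonneg (dv z)
  have h6 : deg (dv z)⁻ ≠ 1 := fun h => by
    have := e_pos h4 h
    rw [e_one] at this; omega
  refine (sub_eq_zero.mp (eq_zero_of_deg hle' ?_)).symm
  rw [map_sub, deg_single, hR] at h3 ⊢
  push_cast at h3 ⊢
  omega

theorem poly_in_pole (hz : (dv z)⁻ = pt R) {n : ℕ} {p : (ZMod 2)[X]} (hp : p.natDegree ≤ n) :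
    aeval z p ∈ L (Finsupp.single R (n : ℤ)) := by
  have := poly_mem_L pt_nonneg (hz ▸ mem_L_negPart z : z ∈ L (pt R)) n hp
  rwa [pt, Finsupp.smul_single, nsmul_one] at this

theorem aeval_ne_zero (h0 : z ≠ 0) (h1 : z ≠ 1) {p : (ZMod 2)[X]} (hp : p ≠ 0) : aeval z p ≠ 0 :=
  fun h => hp ((transcendental_iff.mp (transcendental_of_ne h0 h1)) p h)

/-- Riemann–Roch spaces of small multiples of a place of degree two. -/
theorem mem_L_two (h2 : e K 2 = 2) (hR : pdeg R = 2) (hz : (dv z)⁻ = pt R) (h0 : z ≠ 0) (h1 : z ≠ 1)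
    {n : ℕ} (hn : n = 1 ∨ n = 2) {f : K} (hf : f ∈ L (Finsupp.single R (n : ℤ))) :
    ∃ p : (ZMod 2)[X], p.natDegree ≤ n ∧ f = aeval z p := by
  have hc : Nat.card (L (Finsupp.single R (n : ℤ))) = 2 ^ (n + 1) := by
    rw [card_L_eq (n := n * 2) (by rw [deg_single, hR]; rfl)]
    rcases hn with rfl | rfl
    · norm_num [h2]
    · norm_num [e_four, h2]
  have hd {p : (ZMod 2)[X]} (hp : p ∈ degreeLT (ZMod 2) (n + 1)) : p.natDegree ≤ n := by
    rw [mem_degreeLT] at hp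
    rcases eq_or_ne p 0 with rfl | h
    · simp
    · exact Nat.lt_succ_iff.mp ((natDegree_lt_iff_degree_lt h).mpr hp)
  have hfin : Finite (L (Finsupp.single R (n : ℤ))) := finite_L _
  let φ : degreeLT (ZMod 2) (n + 1) → L (Finsupp.single R (n : ℤ)) := fun p =>
    ⟨aeval z p.1, poly_in_pole hz (hd p.2)⟩
  have hinj : Function.Injective φ := fun p q h => by
    have h' : aeval z p.1 = aeval z q.1 := congrArg Subtype.val h
    by_contra hpq
    refine aeval_ne_zero h0 h1 (sub_ne_zero.mpr fun h => hpq (Subtype.ext h)) ?_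
    rw [map_sub, h', sub_self]
  have hcard : Nat.card (degreeLT (ZMod 2) (n + 1)) = 2 ^ (n + 1) := by
    rw [Nat.card_congr (degreeLTEquiv (ZMod 2) (n + 1)).toEquiv, Nat.card_fun]
    simp
  obtain ⟨p, hp⟩ := (Function.Injective.bijective_of_nat_card_le hinj (by rw [hc, hcard])).2 ⟨f, hf⟩
  exact ⟨p.1, hd p.2, (congrArg Subtype.val hp).symm⟩

theorem not_coprime {p q : (ZMod 2)[X]} (hz : z ∈ S.1) (hp : aeval z p ∈ fil S 1)
    (hq : aeval z q ∈ fil S 1) : ¬ IsCoprime p q := by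
  rintro ⟨a, b, h⟩
  have hm (a : (ZMod 2)[X]) : aeval z a ∈ S.1 := aeval_mem_subring _ hz a
  have h1 := add_mem (mul_mem_fil_one hp (hm a)) (mul_mem_fil_one hq (hm b))
  have h2 := congrArg (aeval z) h
  rw [map_add, map_mul, map_mul, map_one] at h2
  rw [mul_comm (aeval z p), mul_comm (aeval z q), h2, mem_fil_of_ne one_ne_zero, ordAt_one] at h1
  norm_num at h1

/-- Irreducible polynomials of degree at most four stay prime. -/
theorem pdeg_gt (h2 : e K 2 = 2) (h3 : e K 3 = 0) (hR : pdeg R = 2) (hz : (dv z)⁻ = pt R)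
    (h0 : z ≠ 0) (h1 : z ≠ 1) {r : (ZMod 2)[X]} (hr : Irreducible r) (hr4 : r.natDegree ≤ 4)
    (hzS : z ∈ S.1) (hS : aeval z r ∈ fil S 1) : r.natDegree < pdeg S := by
  by_contra! hle
  have hpos : 0 < pdeg S := placeDegree_pos S
  have n1 : pdeg S ≠ 1 := e_zero_of_place (by exact_mod_cast e_one K) S
  have n3 : pdeg S ≠ 3 := e_zero_of_place (by exact_mod_cast h3) S
  obtain ⟨n, hn, hSn⟩ : ∃ n : ℕ, (n = 1 ∨ n = 2) ∧ pdeg S = n * 2 := by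
    have : pdeg S = 2 ∨ pdeg S = 4 := by omega
    rcases this with h | h
    · exact ⟨1, Or.inl rfl, h⟩
    · exact ⟨2, Or.inr rfl, h⟩
  have hSR : S ≠ R := by
    rintro rfl
    have := ordAt_of_poles (f := z) (P := S) (by rw [hz]; simp)
    rw [hz, pt, Finsupp.single_eq_same] at this
    rw [← ordAt_nonneg_iff, this] at hzS
    norm_num at hzS
  obtain ⟨f, hf, hf0, hfS⟩ := eff_eq_add_dv (D := Finsupp.single R (n : ℤ)) (E := pt S) pt_nonneg (by
    rw [deg_single, deg_single, hR, hSn]; push_cast; ring)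
  obtain ⟨p, hp, rfl⟩ := mem_L_two h2 hR hz h0 h1 hn hf
  have hfS1 : aeval z p ∈ fil S 1 := by
    have := DFunLike.congr_fun hfS S
    rw [pt, Finsupp.single_eq_same, Finsupp.add_apply, Finsupp.single_apply, if_neg hSR.symm,
      zero_add, dv_apply] at this
    exact mem_fil_of_le this.le
  refine not_coprime hzS hS hfS1 ((hr.coprime_iff_not_dvd).mpr fun hd => ?_)
  have := natDegree_le_of_dvd hd (by rintro rfl; simp at hf0)
  rcases hn with rfl | rfl <;> omega

end
end CFF

namespace CFF

open Polynomial IsLocalRing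

section

variable {K : Type} [Field K] [Algebra (ZMod 2) K] [FiveGonal K]

variable {σ : K ≃ₐ[ZMod 2] K} {Q R S : Place (ZMod 2) K} {T z : K}

theorem e_three_of_e_two_eq_two (h5 : HasDeg T 5) (h2 : e K 2 = 2) : e K 3 = 0 := by
  by_contra h3
  obtain ⟨D, hD, hd⟩ := exists_eff (K := K) (n := 2) (by omega)
  obtain ⟨D', hD', hd'⟩ := exists_eff (K := K) (n := 3) (by exact_mod_cast h3)
  obtain ⟨x, hx, h0, h1⟩ := exists_nonconst_mem (D := D) (n := 2) hd (by omega)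
  have h := poles_eq_of_deg_five h5 (add_nonneg hD hD') (by rw [map_add, hd, hd']; norm_num)
    (L_mono (le_add_of_nonneg_right hD') hx) h0 h1
  have := deg_mono (negPart_le_of_mem hD hx)
  rw [h, map_add, hd, hd'] at this
  norm_num at this

theorem exists_pt_two {D : Div K} (hD : 0 ≤ D) (hd : deg D = 2) : ∃ R, pdeg R = 2 ∧ D = pt R :=
  exists_eq_pt hD (n := 2) (by norm_num) hd (by
    intro m h0 hm
    interval_cases m
    exact Or.inl (e_one K))

theorem exists_quadratic (h2 : e K 2 = 2) (hR : pdeg R = 2) :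
    ∃ z : K, z ≠ 0 ∧ z ≠ 1 ∧ (dv z)⁻ = pt R := by
  obtain ⟨z, hz, h0, h1⟩ := exists_nonconst_mem (D := pt R) (n := 2)
    (by rw [deg_single, hR]; norm_num) (by omega)
  exact ⟨z, h0, h1, div_quadratic hR hz h0 h1⟩

theorem mem_L_quadratic (h2 : e K 2 = 2) (hR : pdeg R = 2) (hz : (dv z)⁻ = pt R) (h0 : z ≠ 0)
    (h1 : z ≠ 1) {f : K} (hf : f ∈ L (pt R)) : f = 0 ∨ f = 1 ∨ f = z ∨ f = z + 1 := by
  obtain ⟨p, hp, rfl⟩ := mem_L_two h2 hR hz h0 h1 (n := 1) (Or.inl rfl) (by simpa using hf)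
  obtain ⟨a, b, rfl⟩ := exists_eq_X_add_C_of_natDegree_le_one hp
  rcases zmod_two_cases a with rfl | rfl <;> rcases zmod_two_cases b with rfl | rfl <;> simp

theorem deg_poles_quadratic (hR : pdeg R = 2) (hz : (dv z)⁻ = pt R) : deg (dv z)⁺ = 2 := by
  rw [← negPart_add_dv, map_add, deg_dv, hz, deg_single, hR]
  norm_num

theorem quadratic_fibres (h2 : e K 2 = 2) (hR : pdeg R = 2) (hz : (dv z)⁻ = pt R) (h0 : z ≠ 0)
    (h1 : z ≠ 1) : ∃ R₀ R₁, (dv z)⁺ = pt R₀ ∧ (dv (z + 1))⁺ = pt R₁ ∧ R₀ ≠ R ∧ R₁ ≠ R ∧ R₀ ≠ R₁ ∧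
      pdeg R₀ = 2 ∧ pdeg R₁ = 2 ∧ ∀ S, pdeg S = 2 → S = R ∨ S = R₀ ∨ S = R₁ := by
  have h10 : z + 1 ≠ 0 := fun h => h1 (CharTwo.add_eq_zero.mp h)
  obtain ⟨R₀, hR₀, hz₀⟩ := exists_pt_two (posPart_nonneg (dv z)) (deg_poles_quadratic hR hz)
  obtain ⟨R₁, hR₁, hz₁⟩ := exists_pt_two (posPart_nonneg (dv (z + 1)))
    (deg_poles_quadratic hR (by rw [negPart_add_one, hz]))
  have hpole : ordAt R.1 z < 0 := by
    rw [ordAt_of_poles (by rw [hz]; simp), hz, pt, Finsupp.single_eq_same]; norm_num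
  have hpole1 : ordAt R.1 (z + 1) < 0 := by
    rw [ordAt_of_poles (by rw [negPart_add_one, hz]; simp), negPart_add_one, hz, pt,
      Finsupp.single_eq_same]; norm_num
  have hzero : z ∈ fil R₀ 1 := by
    have := DFunLike.congr_fun hz₀ R₀
    rw [posPart_apply, pt, Finsupp.single_eq_same, dv_apply] at this
    exact mem_fil_of_le (by omega)
  have hzero1 : z + 1 ∈ fil R₁ 1 := by
    have := DFunLike.congr_fun hz₁ R₁
    rw [posPart_apply, pt, Finsupp.single_eq_same, dv_apply] at this
    exact mem_fil_of_le (by omega)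
  refine ⟨R₀, R₁, hz₀, hz₁, ?_, ?_, ?_, hR₀, hR₁, fun S hS => ?_⟩
  · rintro rfl
    rw [mem_fil_of_ne h0] at hzero; omega
  · rintro rfl
    rw [mem_fil_of_ne h10] at hzero1; omega
  · rintro rfl
    have := add_mem hzero hzero1
    rw [← add_assoc, CharTwo.add_self_eq_zero, zero_add, mem_fil_of_ne one_ne_zero, ordAt_one] at this
    norm_num at this
  · obtain ⟨f, hf, hf0, hfS⟩ := eff_eq_add_dv (D := pt R) (E := pt S) pt_nonneg (by
      rw [deg_single, deg_single, hR, hS])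
    rcases mem_L_quadratic h2 hR hz h0 h1 hf with rfl | rfl | rfl | rfl
    · exact absurd rfl hf0
    · left; exact pt_injective (by simpa using hfS)
    · right; left; rw [← hz, negPart_add_dv, hz₀] at hfS; exact pt_injective hfS
    · right; right
      rw [← hz, ← negPart_add_one, negPart_add_dv, hz₁] at hfS; exact pt_injective hfS

theorem exists_fixed_two (hσ : σ ^ 2 = 1) (h2 : e K 2 = 2) : ∃ R, pdeg R = 2 ∧ mv σ R = R := by
  have hs : σ.symm = σ := by
    ext f
    exact σ.injective (by rw [σ.apply_symm_apply, involutive hσ])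
  have hinv (P : Place (ZMod 2) K) : mv σ (mv σ P) = P := by
    have := mv_symm σ P
    rwa [hs] at this
  obtain ⟨D, hD, hd⟩ := exists_eff (K := K) (n := 2) (by omega)
  obtain ⟨R, hR, -⟩ := exists_pt_two hD hd
  obtain ⟨z, h0, h1, hz⟩ := exists_quadratic h2 hR
  obtain ⟨R₀, R₁, -, -, n0, n1, n01, hR₀, hR₁, hall⟩ := quadratic_fibres h2 hR hz h0 h1
  have hd (S) (hS : pdeg S = 2) : pdeg (mv σ S) = 2 := by rw [pdeg_mv, hS]
  by_contra! h
  have a := hall _ (hd R hR)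
  have b := hall _ (hd R₀ hR₀)
  have c := hall _ (hd R₁ hR₁)
  have a' := h R hR
  have b' := h R₀ hR₀
  have c' := h R₁ hR₁
  have i := hinv R
  have i0 := hinv R₀
  have i1 := hinv R₁
  grind

end
end CFF

namespace CFF

open Polynomial IsLocalRing

section

variable {K : Type} [Field K] [Algebra (ZMod 2) K] [FiveGonal K]

variable {σ : K ≃ₐ[ZMod 2] K} {Q R S : Place (ZMod 2) K} {T z : K}

theorem ordAt_quadratic (hz : (dv z)⁻ = pt R) : ordAt R.1 z = -1 := by
  rw [ordAt_of_poles (by rw [hz]; simp), hz, pt, Finsupp.single_eq_same]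

theorem mem_quadratic (hz : (dv z)⁻ = pt R) (hS : S ≠ R) : z ∈ S.1 :=
  mem_of_poles (by rw [hz, pt, Finsupp.single_apply, if_neg hS.symm])

theorem map_quadratic (hT : σ T = T + 1) (hQ : mv σ Q = Q) (htQ : Triv σ Q)
    (hoQ : ordAt Q.1 T = -1) (h2 : e K 2 = 2) (hR : pdeg R = 2) (hfR : mv σ R = R) (hQR : Q ≠ R)
    (hz : (dv z)⁻ = pt R) (h0 : z ≠ 0) (h1 : z ≠ 1) : σ z = z := by
  rcases mem_L_quadratic h2 hR hz h0 h1 (map_mem_L (fixed_single hfR 1) (hz ▸ mem_L_negPart z))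
    with h | h | h | h
  · exact absurd ((map_eq_zero σ).mp h) h0
  · exact absurd (σ.injective (h.trans (map_one σ).symm)) h1
  · exact h
  · exfalso
    have hT0 : T ≠ 0 := by rintro rfl; rw [ordAt_zero] at hoQ; omega
    obtain ⟨h3, h4⟩ := ordAt_add_eq (P := Q) (f := T) (g := z) hT0
      (by rw [hoQ]; simpa [mem_fil_zero] using mem_quadratic hz hQR)
    have h5 := even_ordAt hT hQ htQ hoQ h3 (by
      rw [map_add, hT, h]
      linear_combination CharTwo.two_eq_zero (R := K))
    rw [h4, hoQ] at h5
    revert h5; decide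

theorem map_aeval (hσz : σ z = z) (p : (ZMod 2)[X]) : σ (aeval z p) = aeval z p := by
  rw [← aeval_algHom_apply σ z p, hσz]

theorem aeval_mem_fil_pole (hz : (dv z)⁻ = pt R) {n : ℕ} {p : (ZMod 2)[X]}
    (hp : p.natDegree ≤ n) : aeval z p ∈ fil R (-n) := by
  simpa using mem_L.mp (poly_in_pole hz hp) R

theorem eq_aeval (hE : Nat.card (Efix σ R) = 2) (hz : (dv z)⁻ = pt R) (h0 : z ≠ 0)
    (hσz : σ z = z) (n : ℕ) : ∀ f ∈ L (Finsupp.single R (n : ℤ)), σ f = f →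
      ∃ p : (ZMod 2)[X], p.natDegree ≤ n ∧ f = aeval z p := by
  induction n with
  | zero =>
    intro f hf _
    rw [Nat.cast_zero, Finsupp.single_zero, mem_L_zero] at hf
    rcases hf with rfl | rfl
    · exact ⟨0, by simp, by simp⟩
    · exact ⟨1, by simp, by simp⟩
  | succ n ih =>
    intro f hf hσf
    have hfR : f ∈ fil R (-(n + 1 : ℕ)) := by simpa using mem_L.mp hf R
    obtain ⟨c, hc, h⟩ := Inv_peel hE (g := z ^ (n + 1)) hfR hσf (pow_ne_zero _ h0)
      (by rw [ordAt_pow, ordAt_quadratic hz]; ring) (by rw [map_pow, hσz])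
    have hσc : σ c = c := by rcases hc with rfl | rfl <;> simp
    obtain ⟨p, hp, hfp⟩ := ih (f + c * z ^ (n + 1)) (mem_L_single (by
      convert h using 2
      push_cast; ring) (fun S hS => by
        refine add_mem ?_ (mul_mem (bit_mem' hc) (pow_mem (mem_quadratic hz hS) _))
        have := mem_L.mp hf S
        rwa [Finsupp.single_apply, if_neg hS.symm, neg_zero, mem_fil_zero] at this))
      (by rw [map_add, map_mul, map_pow, hσz, hσf, hσc])
    have hf' : f = aeval z p + c * z ^ (n + 1) := by
      rw [← hfp]; linear_combination (-(c * z ^ (n + 1))) * CharTwo.two_eq_zero (R := K)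
    rcases hc with rfl | rfl
    · exact ⟨p, by omega, by simpa using hf'⟩
    · refine ⟨p + X ^ (n + 1), (natDegree_add_le _ _).trans ?_, by simpa using hf'⟩
      rw [natDegree_X_pow]; omega

/-- Polynomials in `z` of exact pole order. -/
theorem monic_of_notMem_fil (hz : (dv z)⁻ = pt R) {n : ℕ} {p : (ZMod 2)[X]}
    (hp : p.natDegree ≤ n + 1) (h : aeval z p ∉ fil R (-n)) : p.Monic ∧ p.natDegree = n + 1 := by
  have hn : p.natDegree = n + 1 := by
    by_contra hne
    exact h (aeval_mem_fil_pole hz (by omega))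
  refine ⟨?_, hn⟩
  rcases zmod_two_cases p.leadingCoeff with h | h
  · rw [leadingCoeff_eq_zero] at h
    subst h; simp at hn
  · exact h

theorem deg_zeros_aeval (hR : pdeg R = 2) (hz : (dv z)⁻ = pt R) (p : (ZMod 2)[X]) :
    ∃ k : ℕ, k ≤ p.natDegree ∧ deg (dv (aeval z p))⁺ = 2 * k := by
  have h := poly_in_pole hz (le_refl p.natDegree)
  have hle := negPart_le_of_mem single_nonneg' h
  have h' (S) (hS : S ≠ R) : (dv (aeval z p))⁻ S = 0 := by
    refine le_antisymm ?_ (negPart_nonneg (dv (aeval z p)) S)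
    have := hle S
    rwa [Finsupp.single_apply, if_neg hS.symm] at this
  obtain ⟨k, hk⟩ := Int.eq_ofNat_of_zero_le (negPart_nonneg (dv (aeval z p)) R)
  have heq : (dv (aeval z p))⁻ = Finsupp.single R (k : ℤ) := by
    ext S
    by_cases hS : S = R
    · subst hS; rw [hk, Finsupp.single_eq_same]
    · rw [h' S hS, Finsupp.single_apply, if_neg (Ne.symm hS)]
  refine ⟨k, ?_, ?_⟩
  · have := hle R
    rw [heq, Finsupp.single_eq_same, Finsupp.single_eq_same] at this
    exact_mod_cast this
  · rw [← negPart_add_dv, map_add, deg_dv, heq, deg_single, hR]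
    push_cast; ring

end
end CFF

namespace CFF

open Polynomial IsLocalRing

section

variable {K : Type} [Field K] [Algebra (ZMod 2) K] [FiveGonal K]

variable {σ : K ≃ₐ[ZMod 2] K} {Q R S : Place (ZMod 2) K} {T z : K}

theorem exists_fixed_of_dv {D : Div K} (hD : Fixed σ D) (hd : deg D = 0) :
    ∃ p : K, p ≠ 0 ∧ dv p = D ∧ σ p = p := by
  obtain ⟨Y, h0, hY⟩ := exists_dv_eq hd
  refine ⟨Y, h0, hY, dv_injective (by simpa using h0) h0 ?_⟩
  ext R
  obtain ⟨R, rfl⟩ : ∃ R', mv σ R' = R := ⟨_, mv_symm σ R⟩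
  rw [dv_apply, ordAt_mv, ← dv_apply, hY, hD]

theorem pt_add_pt_le {D : Div K} (h : Q ≠ R) (hQ : pt Q ≤ D) (hR : pt R ≤ D) : pt Q + pt R ≤ D := by
  intro P
  have hQ := hQ P
  have hR := hR P
  rw [pt, Finsupp.single_apply] at hQ hR
  rw [Finsupp.add_apply, pt, pt, Finsupp.single_apply, Finsupp.single_apply]
  split_ifs at hQ hR ⊢ with h1 h2
  · exact absurd (h1.trans h2.symm) h
  all_goals omega

theorem mem_fil_of_pt_le {f : K} (h : pt R ≤ (dv f)⁺) : f ∈ fil R 1 := by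
  have := h R
  rw [posPart_apply, pt, Finsupp.single_eq_same, dv_apply] at this
  exact mem_fil_of_le (by omega)

theorem exists_zero (h2 : e K 2 = 2) (h3 : e K 3 = 0) (hR : pdeg R = 2)
    (hz : (dv z)⁻ = pt R) (h0 : z ≠ 0) (h1 : z ≠ 1) {r : (ZMod 2)[X]}
    (hr : Irreducible r) (hr4 : r.natDegree ≤ 4) :
    ∃ S, S ≠ R ∧ r.natDegree < pdeg S ∧ pdeg S ≤ 2 * r.natDegree ∧ aeval z r ∈ fil S 1 := by
  have hz0 : aeval z r ≠ 0 := aeval_ne_zero h0 h1 hr.ne_zero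
  have hz1 : aeval z r ≠ 1 := fun h => by
    have := aeval_ne_zero h0 h1 (p := r - 1) (fun h => hr.not_isUnit (by
      rw [sub_eq_zero.mp h]; exact isUnit_one))
    rw [map_sub, h, map_one, sub_self] at this
    exact this rfl
  obtain ⟨k, hk, hd⟩ := deg_zeros_aeval hR hz r
  have hpoles := deg_poles_pos hz0 hz1
  have hp : (dv (aeval z r))⁺ ≠ 0 := by
    intro h
    have := congrArg deg (negPart_add_dv (aeval z r))
    rw [map_add, deg_dv, h, map_zero] at this
    omega
  have hpos := posPart_nonneg (dv (aeval z r))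
  obtain ⟨S, hS⟩ := exists_pos_of_ne hpos hp
  have hS1 := mem_fil_of_pt_le hS
  have hSR : S ≠ R := by
    rintro rfl
    have hpoleS : ∀ P, P ≠ S → (dv (aeval z r))⁻ P = 0 := fun P hP => by
      refine le_antisymm ?_ (negPart_nonneg (dv (aeval z r)) P)
      have := negPart_le_of_mem single_nonneg' (poly_in_pole hz (le_refl r.natDegree)) P
      rwa [Finsupp.single_apply, if_neg hP.symm] at this
    have : (dv (aeval z r))⁻ = 0 := by
      ext P
      by_cases hP : P = S
      · subst hP
        rw [mem_fil_of_ne hz0] at hS1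
        change max (-(dv (aeval z r) P)) 0 = 0
        rw [dv_apply]; omega
      · exact hpoleS P hP
    rw [this, map_zero] at hpoles
    omega
  refine ⟨S, hSR, pdeg_gt h2 h3 hR hz h0 h1 hr hr4 (mem_quadratic hz hSR) hS1, ?_, hS1⟩
  have := deg_mono hS
  rw [deg_single, hd] at this
  omega

/-- A zero of an irreducible polynomial of degree at most four in `z` is fixed and is not a
place of degree five. -/
theorem exists_fixed_zero (h2 : e K 2 = 2) (h3 : e K 3 = 0) (hR : pdeg R = 2)
    (hz : (dv z)⁻ = pt R) (h0 : z ≠ 0) (h1 : z ≠ 1) (hσz : σ z = z) {r : (ZMod 2)[X]}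
    (hr : Irreducible r) (hr4 : r.natDegree ≤ 4) :
    ∃ S, S ≠ R ∧ mv σ S = S ∧ pdeg S ≠ 5 ∧ aeval z r ∈ fil S 1 := by
  obtain ⟨S, hSR, hgt, -, hS1⟩ := exists_zero h2 h3 hR hz h0 h1 hr hr4
  have hz0 : aeval z r ≠ 0 := aeval_ne_zero h0 h1 hr.ne_zero
  obtain ⟨k, hk, hd⟩ := deg_zeros_aeval hR hz r
  have hS := pt_le_posPart hz0 hS1
  refine ⟨S, hSR, ?_, fun h5 => ?_, hS1⟩
  · by_contra hne
    have hS2 : pt (mv σ S) ≤ (dv (aeval z r))⁺ := pt_le_posPart hz0 (by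
      have := (map_mem_fil_mv σ).mpr hS1
      rwa [map_aeval hσz] at this)
    have := deg_mono (pt_add_pt_le (Ne.symm hne) hS hS2)
    rw [map_add, deg_single, deg_single, pdeg_mv, hd] at this
    omega
  · have hle := sub_nonneg.mpr hS
    have h := deg_nonneg hle
    have hdeg : deg ((dv (aeval z r))⁺ - pt S) = 2 * k - 5 := by
      rw [map_sub, hd, deg_single, h5]; norm_num
    have hk : k = 3 ∨ k = 4 := by omega
    rcases hk with rfl | rfl
    · have := e_pos hle (n := 1) (by rw [hdeg]; norm_num)
      rw [e_one] at this; omega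
    · have := e_pos hle (n := 3) (by rw [hdeg]; norm_num)
      omega

theorem false_of_e_two_eq_two (hσ : σ ^ 2 = 1) (hT : σ T = T + 1) (h5 : HasDeg T 5)
    (h2 : e K 2 = 2) : False := by
  have h3 := e_three_of_e_two_eq_two h5 h2
  obtain ⟨Q, hdQ, hQ⟩ := exists_eq_pt (negPart_nonneg (dv T)) (n := 5) (by norm_num) h5.deg_poles
    (by
      intro m h0 hm
      interval_cases m
      exacts [Or.inl (e_one K), Or.inr (by simpa using h3), Or.inl (by simpa using h3),
        Or.inr (by simpa using e_one K)])
  have hfQ := mv_eq_of_fixed (hQ ▸ fixed_poles hT)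
  have htQ : Triv σ Q := triv_of_not_dvd Nat.prime_two hσ hfQ (by omega)
  have hoQ : ordAt Q.1 T = -1 := by
    rw [ordAt_of_poles (by rw [hQ, pt, Finsupp.single_eq_same]; norm_num), hQ, pt,
      Finsupp.single_eq_same]
  have hTm (S) (hS : S ≠ Q) : T ∈ S.1 := mem_of_poles (by
    rw [hQ, pt, Finsupp.single_apply, if_neg hS.symm])
  obtain ⟨R, hR, hfR⟩ := exists_fixed_two hσ h2
  have hRQ : R ≠ Q := by rintro rfl; omega
  obtain ⟨z, h0, h1, hz⟩ := exists_quadratic h2 hR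
  have hσz := map_quadratic hT hfQ htQ hoQ h2 hR hfR hRQ.symm hz h0 h1
  have hE : Nat.card (Efix σ R) = 2 := by
    simpa using card_Efix Nat.prime_two hσ hfR (not_triv_of_mem hT (hTm R hRQ)) (n := 1) hR
  obtain ⟨p, hp0, hp, hσp⟩ := exists_fixed_of_dv (σ := σ)
    (D := Finsupp.single Q 2 - Finsupp.single R 5) (fun P => by
      rw [Finsupp.sub_apply, Finsupp.sub_apply, fixed_single hfQ, fixed_single hfR])
    (by rw [map_sub, deg_single, deg_single, hdQ, hR]; norm_num)
  have hpo (S) : ordAt S.1 p = (Finsupp.single Q (2 : ℤ) : Div K) S - (Finsupp.single R (5 : ℤ) : Div K) S := by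
    rw [← dv_apply, hp, Finsupp.sub_apply]
  have hpR : ordAt R.1 p = -5 := by
    rw [hpo, Finsupp.single_apply, if_neg hRQ.symm, Finsupp.single_eq_same]; norm_num
  have hpQ : ordAt Q.1 p = 2 := by
    rw [hpo, Finsupp.single_eq_same, Finsupp.single_apply, if_neg hRQ]; norm_num
  have hpS (S) (hS : S ≠ R) (hS' : S ≠ Q) : ordAt S.1 p = 0 := by
    rw [hpo, Finsupp.single_apply, Finsupp.single_apply, if_neg hS.symm, if_neg hS'.symm]; norm_num
  have hw (S) (hS : S ≠ Q) : T ^ 2 + T ∈ S.1 := add_mem (pow_mem (hTm S hS) 2) (hTm S hS)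
  have hσw : σ (T ^ 2 + T) = T ^ 2 + T := by
    rw [map_add, map_pow, hT]
    linear_combination (T + 1) * CharTwo.two_eq_zero (R := K)
  have hpL : p ∈ L (Finsupp.single R ((5 : ℕ) : ℤ)) := mem_L_single (mem_fil_of_le (by rw [hpR]; norm_num))
    (fun S hS => by
      rw [← ordAt_nonneg_iff]
      by_cases hS' : S = Q
      · subst hS'; rw [hpQ]; norm_num
      · rw [hpS S hS hS'])
  have hwL : (T ^ 2 + T) * p ∈ L (Finsupp.single R ((5 : ℕ) : ℤ)) := by
    refine mem_L_single ?_ (fun S hS => ?_)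
    · have := mul_mem_fil (mem_fil_zero.mpr (hw R hRQ)) (mem_fil_of_le hpR.ge)
      norm_num at this ⊢; exact this
    · by_cases hS' : S = Q
      · subst hS'
        have hTS : T ∈ fil S (-1) := mem_fil_of_le hoQ.ge
        have hT1 := add_mem hTS (mem_fil_of_le (n := -1) (f := (1 : K)) (P := S) (by rw [ordAt_one]; norm_num))
        have := mul_mem_fil (mul_mem_fil hTS hT1) (mem_fil_of_le hpQ.ge)
        norm_num at this
        rw [mem_fil_zero] at this
        convert this using 1; ring
      · exact mul_mem (hw S hS') ((ordAt_nonneg_iff S p).mp (hpS S hS hS').ge)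
  obtain ⟨F, hF, hpF⟩ := eq_aeval hE hz h0 hσz 5 p hpL hσp
  obtain ⟨G, hG, hpG⟩ := eq_aeval hE hz h0 hσz 5 _ hwL (by rw [map_mul, hσw, hσp])
  obtain ⟨hF, hF5⟩ := monic_of_notMem_fil hz (n := 4) hF (by
    rw [← hpF, mem_fil_of_ne hp0, hpR]; norm_num)
  obtain ⟨hG, hG5⟩ := monic_of_notMem_fil hz (n := 4) hG (by
    rw [← hpG]
    intro h
    have h' := (div_mem_fil_one_iff R hp0 hpR 1).mpr (show (T ^ 2 + T) * p ∈ _ by norm_num at h ⊢; exact h)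
    rw [mul_div_cancel_right₀ _ hp0] at h'
    exact artinSchreier_contra hfR (hTm R hRQ) hT (zero_mem _) (map_zero σ) (by simpa using h'))
  obtain ⟨r, b, hr, hr4, hdvd⟩ := exists_minpoly_dvd hF hF5 hG hG5
  obtain ⟨S, hSR, hfS, hS5, hrS⟩ := exists_fixed_zero h2 h3 hR hz h0 h1 hσz hr hr4
  have hSQ : S ≠ Q := by rintro rfl; exact hS5 hdQ
  have hzS (a : (ZMod 2)[X]) : aeval z a ∈ S.1 := aeval_mem_subring _ (mem_quadratic hz hSR) a
  have hvan {f : (ZMod 2)[X]} (hf : r ∣ f) : aeval z f ∈ fil S 1 := by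
    obtain ⟨c, rfl⟩ := hf
    rw [map_mul]
    exact mul_mem_fil_one hrS (hzS c)
  rcases hdvd with hd | hd
  · have := hvan hd
    rw [← hpF, mem_fil_of_ne hp0, hpS S hSR hSQ] at this
    norm_num at this
  · have := hvan hd
    rw [map_add, map_mul, ← hpF, ← hpG, ← add_mul] at this
    have h' := (div_mem_fil_one_iff S hp0 (hpS S hSR hSQ) 1).mpr (by simpa using this)
    rw [mul_div_cancel_right₀ _ hp0] at h'
    refine artinSchreier_contra hfS (hTm S hSQ) hT (hzS b) (map_aeval hσz b) ?_
    rw [add_comm]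
    exact h'

/-- There is no Artin–Schreier involution on a coordinate of degree five. -/
theorem false_of_involution (hσ : σ ^ 2 = 1) (hT : σ T = T + 1) (h5 : HasDeg T 5) : False := by
  have := e_two_le (K := K)
  have h : e K 2 = 0 ∨ e K 2 = 1 ∨ e K 2 = 2 := by omega
  rcases h with h | h | h
  · exact false_of_e_two_eq_zero hσ hT h5 h
  · by_cases h3 : e K 3 = 0
    · exact false_of_e_two_eq_one hσ hT h5 h h3
    · exact false_of_e_three_ne_zero hσ hT h5 h h3
  · exact false_of_e_two_eq_two hσ hT h5 h

end
end CFF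

namespace CFF

open Polynomial IsLocalRing

section

variable {K : Type} [Field K] [Algebra (ZMod 2) K] [FiveGonal K]

variable {σ : K ≃ₐ[ZMod 2] K} {P Q R S : Place (ZMod 2) K} {T z : K}

theorem add_one_mem_iff {A : ValuationSubring K} : T + 1 ∈ A ↔ T ∈ A :=
  ⟨fun h => by simpa using sub_mem h A.one_mem, fun h => add_mem h A.one_mem⟩

/-- At a fixed place with trivial action, a coordinate of order three reduces to a cube root
of unity. -/
theorem zero_of_triv (hT : σ T = (T + 1)⁻¹) (hT1 : T + 1 ≠ 0) (hP : mv σ P = P) (ht : Triv σ P) :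
    T ^ 2 + T + 1 ∈ fil P 1 := by
  have hTP : T ∈ P.1 := by
    by_contra h
    have h' : σ T ∉ P.1 := fun h1 => h ((map_mem_iff hP).mp h1)
    rw [← add_one_mem_iff, ← ordAt_nonneg_iff] at h
    rw [hT, ← ordAt_nonneg_iff, ordAt_inv] at h'
    omega
  have h := mul_mem_fil_one (add_map_mem_fil hP ht hTP) (add_one_mem_iff.mpr hTP)
  rw [hT, add_mul, inv_mul_cancel₀ hT1] at h
  convert h using 1; ring

theorem mem_of_zero (h : T ^ 2 + T + 1 ∈ fil P 1) : T ∈ P.1 := by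
  refine mem_of_artinSchreier (P := P) ?_
  have := add_mem (fil_mono (n := 1) (m := -1) (P := P) (by norm_num) h)
    (mem_fil_of_le (n := -1) (f := (1 : K)) (P := P) (by rw [ordAt_one]; norm_num))
  rwa [add_assoc, CharTwo.add_self_eq_zero, add_zero] at this

theorem ordAt_of_zero (h : T ^ 2 + T + 1 ∈ fil P 1) : ordAt P.1 T = 0 := by
  have hT := mem_of_zero h
  refine le_antisymm ?_ ((ordAt_nonneg_iff P T).mpr hT)
  by_contra! h0
  have h1 := mul_mem_fil_one (mem_fil_of_le (n := 1) (P := P) (f := T) (by omega))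
    (add_one_mem_iff.mpr hT)
  have h2 := add_mem h1 h
  rw [show T * (T + 1) + (T ^ 2 + T + 1) = 1 by
    linear_combination (T ^ 2 + T) * CharTwo.two_eq_zero (R := K), mem_fil_of_ne one_ne_zero,
    ordAt_one] at h2
  norm_num at h2

theorem even_pdeg (h : T ^ 2 + T + 1 ∈ fil P 1) : Even (pdeg P) := by
  have hT := mem_of_zero h
  rw [← resAt_eq_zero_iff (add_mem (add_mem (pow_mem hT 2) hT) P.1.one_mem),
    resAt_add (add_mem (pow_mem hT 2) hT) P.1.one_mem, resAt_add (pow_mem hT 2) hT, resAt_pow hT,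
    resAt_one] at h
  set t := resAt P T
  have h4 : ∀ k : ℕ, t ^ 4 ^ k = t := by
    intro k
    induction k with
    | zero => simp
    | succ k ih =>
      rw [pow_succ, pow_mul, ih]
      grind
  by_contra hodd
  obtain ⟨k, hk⟩ := Nat.not_even_iff_odd.mp hodd
  have hc : t ^ 2 ^ pdeg P = t := by
    have := Fintype.ofFinite (Res P)
    rw [← card_res P, Nat.card_eq_fintype_card]
    exact FiniteField.pow_card t
  rw [hk, pow_add, pow_mul, pow_mul, show (2 : ℕ) ^ 2 = 4 by norm_num, h4] at hc
  grind

theorem map_norm (hT : σ T = (T + 1)⁻¹) (hT1 : T + 1 ≠ 0) :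
    σ (T ^ 2 + T + 1) = (T ^ 2 + T + 1) / (T + 1) ^ 2 := by
  rw [map_add, map_add, map_pow, hT, map_one]
  field_simp
  linear_combination (T + 1) * CharTwo.two_eq_zero (R := K)

theorem mv_zero (hT : σ T = (T + 1)⁻¹) (hT1 : T + 1 ≠ 0)
    (h : T ^ 2 + T + 1 ∈ fil P 1) : T ^ 2 + T + 1 ∈ fil (mv σ P) 1 := by
  have h1 : T + 1 = σ T⁻¹ := by rw [map_inv₀, hT, inv_inv]
  have h2 : T⁻¹ ∈ P.1 := by rw [← ordAt_nonneg_iff, ordAt_inv, ordAt_of_zero h]; norm_num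
  have h3 := mul_mem_fil_one ((map_mem_fil_mv σ).mpr h) ((map_mem_mv σ).mpr (pow_mem h2 2))
  rwa [map_norm hT hT1, map_pow, ← h1, div_mul_cancel₀ _ (pow_ne_zero 2 hT1)] at h3

/-- An invariant function cannot be an associate of the norm form at a place with trivial
action. -/
theorem false_of_invariant (hT : σ T = (T + 1)⁻¹) (hT1 : T + 1 ≠ 0) (hP : mv σ P = P)
    (ht : Triv σ P) (hτ : T ^ 2 + T + 1 ∈ fil P 1) (hτ0 : T ^ 2 + T + 1 ≠ 0) {f : K} (h0 : f ≠ 0)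
    (hf : σ f = f) (ho : ordAt P.1 f = ordAt P.1 (T ^ 2 + T + 1)) : False := by
  have hr0 : (T ^ 2 + T + 1) / f ≠ 0 := div_ne_zero hτ0 h0
  have hr : ordAt P.1 ((T ^ 2 + T + 1) / f) = 0 := by rw [ordAt_div P hτ0 h0, ho, sub_self]
  have hTP := mem_of_zero hτ
  have hT0 : T ≠ 0 := by
    rintro rfl
    rw [mem_fil_of_ne hτ0] at hτ
    norm_num [ordAt_one] at hτ
  have h := mul_mem_fil_one (add_map_mem_fil hP ht ((ordAt_nonneg_iff P _).mp hr.ge))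
    (pow_mem (add_one_mem_iff.mpr hTP) 2)
  rw [map_div₀, hf, map_norm hT hT1, show ((T ^ 2 + T + 1) / f + (T ^ 2 + T + 1) / (T + 1) ^ 2 / f) *
    (T + 1) ^ 2 = (T ^ 2 + T + 1) / f * T ^ 2 by
      field_simp
      linear_combination ((T + 1) * (T ^ 2 + T + 1)) * CharTwo.two_eq_zero (R := K),
    mem_fil_of_ne (mul_ne_zero hr0 (pow_ne_zero 2 hT0)), ordAt_mul P hr0 (pow_ne_zero 2 hT0), hr,
    ordAt_pow, ordAt_of_zero hτ] at h
  norm_num at h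

theorem HasDeg.norm_ne_zero (h5 : HasDeg T 5) : T ^ 2 + T + 1 ≠ 0 := by
  obtain ⟨h0, h1⟩ := h5.ne (by norm_num)
  have hp : (X ^ 2 + X + 1 : (ZMod 2)[X]) ≠ 0 := fun h => by
    have := congrArg (eval 0) h
    simp at this
  simpa using aeval_ne_zero h0 h1 hp

theorem HasDeg.deg_norm (h5 : HasDeg T 5) : deg (dv (T ^ 2 + T + 1))⁺ = 10 := by
  obtain ⟨h0, h1⟩ := h5.ne (by norm_num)
  have h10 : T + 1 ≠ 0 := fun h => h1 (CharTwo.add_eq_zero.mp h)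
  have hτ0 := h5.norm_ne_zero
  have h : (dv (T ^ 2 + T + 1))⁻ = (dv T)⁻ + (dv T)⁻ := by
    ext P
    have a (f : K) : (dv f)⁻ P = max (-(ordAt P.1 f)) 0 := by rw [← dv_apply]; rfl
    rw [Finsupp.add_apply, a, a]
    by_cases hP : T ∈ P.1
    · have h2 := (ordAt_nonneg_iff P T).mpr hP
      have h3 := (ordAt_nonneg_iff P _).mpr (add_mem (add_mem (pow_mem hP 2) hP) P.1.one_mem)
      omega
    · rw [← ordAt_nonneg_iff, not_le] at hP
      obtain ⟨-, h2⟩ := ordAt_add_eq (P := P) (f := T) (g := 1) h0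
        (mem_fil_of_le (by rw [ordAt_one]; omega))
      have h3 : ordAt P.1 (T * (T + 1)) = ordAt P.1 T + ordAt P.1 T := by
        rw [ordAt_mul P h0 h10, h2]
      obtain ⟨-, h4⟩ := ordAt_add_eq (P := P) (f := T * (T + 1)) (g := 1) (mul_ne_zero h0 h10)
        (mem_fil_of_le (by rw [ordAt_one, h3]; omega))
      rw [show T ^ 2 + T + 1 = T * (T + 1) + 1 by ring, h4, h3]
      omega
  rw [← negPart_add_dv, map_add, deg_dv, h, map_add, h5.deg_poles]
  norm_num

theorem pt_le_norm (h5 : HasDeg T 5) (hτ : T ^ 2 + T + 1 ∈ fil P 1) :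
    pt P ≤ (dv (T ^ 2 + T + 1))⁺ :=
  pt_le_posPart h5.norm_ne_zero hτ

end
end CFF

namespace CFF

open Polynomial IsLocalRing

section

variable {K : Type} [Field K] [Algebra (ZMod 2) K] [FiveGonal K]

variable {σ : K ≃ₐ[ZMod 2] K} {P Q R S : Place (ZMod 2) K} {T z : K}

theorem HasDeg.add_one_ne_zero (h5 : HasDeg T 5) : T + 1 ≠ 0 :=
  fun h => (h5.ne (by norm_num)).2 (CharTwo.add_eq_zero.mp h)

theorem zero_of_not_dvd (hσ : σ ^ 3 = 1) (hT : σ T = (T + 1)⁻¹) (h5 : HasDeg T 5)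
    (hP : mv σ P = P) (hd : ¬ 3 ∣ pdeg P) : T ^ 2 + T + 1 ∈ fil P 1 :=
  zero_of_triv hT h5.add_one_ne_zero hP (triv_of_not_dvd Nat.prime_three hσ hP hd)

theorem false_of_order_three_of_e_two_eq_one (hσ : σ ^ 3 = 1) (hT : σ T = (T + 1)⁻¹)
    (h5 : HasDeg T 5) (h2 : e K 2 = 1) : False := by
  obtain ⟨P, hP⟩ := exists_place_of_e_two h2
  have hfP := mv_eq_of_e_eq_one h2 hP σ
  obtain ⟨y, hy, h0, h1⟩ := exists_quartic hP h2
  have hσy : σ y = y := by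
    rcases mem_L_quartic hP h2 hy h0 h1 (map_mem_L (fixed_single hfP 2) hy) with h | h | h | h
    · exact absurd ((map_eq_zero σ).mp h) h0
    · exact absurd (σ.injective (h.trans (map_one σ).symm)) h1
    · exact h
    · exfalso
      have h3 : (σ ^ 3) y = y := by rw [hσ]; rfl
      have h4 : (σ ^ 3) y = σ (σ (σ y)) := rfl
      rw [h4, h, map_add, h, map_one, map_add, map_add, h, map_one] at h3
      have : (1 : K) = 0 := by linear_combination h3 - CharTwo.two_eq_zero (R := K)
      exact one_ne_zero this
  obtain ⟨A, hA, hyA⟩ := zeros_quartic hP h2 hy h0 h1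
  have hy1 : y + 1 ≠ 0 := fun h => h1 (CharTwo.add_eq_zero.mp h)
  have hone : (1 : K) ∈ L (Finsupp.single P 2) := one_mem_L (Finsupp.single_nonneg.mpr (by norm_num))
  obtain ⟨B, hB, hyB⟩ := zeros_quartic hP h2 (add_mem hy hone) hy1 (by simpa using h0)
  have hyA1 : y ∈ fil A 1 := mem_fil_of_pt_le hyA.ge
  have hyB1 : y + 1 ∈ fil B 1 := mem_fil_of_pt_le hyB.ge
  have hAB : A ≠ B := by
    rintro rfl
    have := add_mem hyA1 hyB1
    rw [← add_assoc, CharTwo.add_self_eq_zero, zero_add, mem_fil_of_ne one_ne_zero, ordAt_one] at this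
    norm_num at this
  have hfix {f : K} (hf0 : f ≠ 0) (hf : σ f = f) {D : Place (ZMod 2) K} (hD : (dv f)⁺ = pt D) :
      mv σ D = D := by
    refine pt_injective ?_
    have h := pt_le_posPart hf0 (R := mv σ D) (by
      have := (map_mem_fil_mv σ).mpr (mem_fil_of_pt_le hD.ge)
      rwa [hf] at this)
    rw [hD] at h
    exact (sub_eq_zero.mp (eq_zero_of_deg (sub_nonneg.mpr h) (by
      rw [map_sub, deg_single, deg_single, pdeg_mv, sub_self]))).symm
  have hfA := hfix h0 hσy hyA
  have hfB := hfix hy1 (by rw [map_add, hσy, map_one]) hyB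
  have hτP := zero_of_not_dvd hσ hT h5 hfP (by omega)
  have hτA := zero_of_not_dvd hσ hT h5 hfA (by omega)
  have hτB := zero_of_not_dvd hσ hT h5 hfB (by omega)
  have hle := pt_add_pt_le hAB (pt_le_norm h5 hτA) (pt_le_norm h5 hτB)
  have hPA : P ≠ A := by rintro rfl; omega
  have hPB : P ≠ B := by rintro rfl; omega
  have hle' : pt P ≤ (dv (T ^ 2 + T + 1))⁺ - (pt A + pt B) := by
    have hZ := pt_le_norm h5 hτP
    intro S
    have a := hZ S
    have b := hle S
    rw [Finsupp.sub_apply, Finsupp.add_apply]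
    rw [Finsupp.add_apply] at b
    by_cases hS : P = S
    · subst hS
      rw [pt, Finsupp.single_eq_same] at a
      rw [pt, pt, pt, Finsupp.single_eq_same, Finsupp.single_apply, Finsupp.single_apply,
        if_neg hPA.symm, if_neg hPB.symm]
      omega
    · rw [pt, Finsupp.single_apply, if_neg hS]
      omega
  have hZ : (dv (T ^ 2 + T + 1))⁺ - (pt A + pt B) = pt P := sub_eq_zero.mp <|
    eq_zero_of_deg (sub_nonneg.mpr hle') (by
      rw [map_sub, map_sub, map_add, h5.deg_norm, deg_single, deg_single, deg_single, hA, hB, hP]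
      norm_num)
  refine false_of_invariant hT h5.add_one_ne_zero hfA
    (triv_of_not_dvd Nat.prime_three hσ hfA (by omega)) hτA h5.norm_ne_zero h0 hσy ?_
  have a := DFunLike.congr_fun hyA A
  have b := DFunLike.congr_fun hZ A
  rw [Finsupp.sub_apply, Finsupp.add_apply, pt, pt, pt, Finsupp.single_eq_same,
    Finsupp.single_apply, Finsupp.single_apply, if_neg hAB.symm, if_neg hPA, posPart_apply,
    dv_apply] at b
  rw [pt, Finsupp.single_eq_same, posPart_apply, dv_apply] at a
  omega

theorem aeval_eq_mul {p : (ZMod 2)[X]} (hp : p.natDegree ≤ 2) (h : p ≠ X ^ 2 + X + 1) (z : K) :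
    ∃ a b : (ZMod 2)[X], a.natDegree ≤ 1 ∧ b.natDegree ≤ 1 ∧ aeval z p = aeval z a * aeval z b := by
  have hX : (X + 1 : (ZMod 2)[X]).natDegree ≤ 1 := (natDegree_X_add_C (1 : ZMod 2)).le
  have hp' : p = C (p.coeff 0) + C (p.coeff 1) * X + C (p.coeff 2) * X ^ 2 := by
    rw [p.as_sum_range_C_mul_X_pow' (n := 3) (by omega)]
    simp [Finset.sum_range_succ]
  rcases zmod_two_cases (p.coeff 0) with h0 | h0 <;> rcases zmod_two_cases (p.coeff 1) with h1 | h1 <;>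
    rcases zmod_two_cases (p.coeff 2) with h2 | h2 <;> rw [h0, h1, h2] at hp'
  · exact ⟨0, 0, by simp, by simp, by simp [hp']⟩
  · exact ⟨X, X, by simp, by simp, by simp [hp']; ring⟩
  · exact ⟨X, 1, by simp, by simp, by simp [hp']⟩
  · exact ⟨X, X + 1, by simp, hX, by simp [hp']; ring⟩
  · exact ⟨1, 1, by simp, by simp, by simp [hp']⟩
  · exact ⟨X + 1, X + 1, hX, hX, by
      simp [hp']; linear_combination (-z) * CharTwo.two_eq_zero (R := K)⟩
  · exact ⟨X + 1, 1, hX, by simp, by simp [hp']; ring⟩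
  · exact absurd (by rw [hp']; simp; ring) h

theorem irreducible_X_sq_add_X_add_one : Irreducible (X ^ 2 + X + 1 : (ZMod 2)[X]) := by
  have hd : (X ^ 2 + X + 1 : (ZMod 2)[X]).natDegree = 2 := by compute_degree!
  rw [irreducible_iff_roots_eq_zero_of_degree_le_three hd.ge (by omega)]
  refine Multiset.eq_zero_of_forall_notMem fun a ha => ?_
  have := (mem_roots'.mp ha).2
  revert this
  rcases zmod_two_cases a with rfl | rfl
  · simp [IsRoot]
  · simp only [IsRoot, eval_add, eval_pow, eval_X, eval_one]
    decide

/-- Places of degree four in the hyperelliptic-type case are the zeros of `z ^ 2 + z + 1`. -/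
theorem zero_of_pdeg_four (h2 : e K 2 = 2) (hR : pdeg R = 2) (hz : (dv z)⁻ = pt R) (h0 : z ≠ 0)
    (h1 : z ≠ 1) (hS : pdeg S = 4) : z ^ 2 + z + 1 ∈ fil S 1 := by
  have hSR : S ≠ R := by rintro rfl; omega
  obtain ⟨f, hf, hf0, hfS⟩ := eff_eq_add_dv (D := Finsupp.single R ((2 : ℕ) : ℤ)) (E := pt S) pt_nonneg (by
    rw [deg_single, deg_single, hR, hS]; norm_num)
  obtain ⟨p, hp, rfl⟩ := mem_L_two h2 hR hz h0 h1 (Or.inr rfl) hf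
  by_cases hpx : p = X ^ 2 + X + 1
  · have := DFunLike.congr_fun hfS S
    rw [pt, Finsupp.single_eq_same, Finsupp.add_apply, Finsupp.single_apply, if_neg hSR.symm,
      zero_add, dv_apply, hpx] at this
    simpa using mem_fil_of_le this.le
  · exfalso
    obtain ⟨a, b, ha, hb, hab⟩ := aeval_eq_mul hp hpx z
    rw [hab] at hf0 hfS
    obtain ⟨ha0, hb0⟩ := mul_ne_zero_iff.mp hf0
    have heff {c : (ZMod 2)[X]} (hc : c.natDegree ≤ 1) (hc0 : aeval z c ≠ 0) :
        0 ≤ pt R + dv (aeval z c) := by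
      have := mem_L.mp (poly_in_pole hz hc)
      intro P
      have h := this P
      rw [mem_fil_of_ne hc0] at h
      rw [Finsupp.add_apply, dv_apply, pt]
      change 0 ≤ _
      simp only [Nat.cast_one] at h
      omega
    have hA := heff ha ha0
    have hB := heff hb hb0
    rw [dv_mul ha0 hb0, show (Finsupp.single R ((2 : ℕ) : ℤ) : Div K) = pt R + pt R by
      rw [pt, ← Finsupp.single_add]; norm_num, add_add_add_comm] at hfS
    have hdA : deg (pt R + dv (aeval z a)) = 2 := by rw [map_add, deg_dv, deg_single, hR]; norm_num
    obtain ⟨U, hU, hUA⟩ := exists_pt_two hA hdA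
    have hle : pt U ≤ pt S := by rw [hfS, hUA]; exact le_add_of_nonneg_right hB
    have hUS : U = S := by
      by_contra hne
      have := hle U
      rw [pt, pt, Finsupp.single_eq_same, Finsupp.single_apply, if_neg (Ne.symm hne)] at this
      norm_num at this
    rw [hUS] at hU
    omega

theorem false_of_order_three_of_e_two_eq_two (hσ : σ ^ 3 = 1) (hT : σ T = (T + 1)⁻¹)
    (h5 : HasDeg T 5) (h2 : e K 2 = 2) : False := by
  have h3 := e_three_of_e_two_eq_two h5 h2
  obtain ⟨D, hD, hd⟩ := exists_eff (K := K) (n := 2) (by omega)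
  obtain ⟨R, hR, -⟩ := exists_pt_two hD hd
  obtain ⟨z, h0, h1, hz⟩ := exists_quadratic h2 hR
  have hp := irreducible_X_sq_add_X_add_one
  have hpd : (X ^ 2 + X + 1 : (ZMod 2)[X]).natDegree = 2 := by compute_degree!
  obtain ⟨S, hSR, hS, hS2, hS4⟩ := exists_zero h2 h3 hR hz h0 h1 hp (by omega)
  have hS3 : pdeg S ≠ 3 := e_zero_of_place (by exact_mod_cast h3) S
  have hdS : pdeg S = 4 := by omega
  have hfS : mv σ S = S := by
    have hz4 := zero_of_pdeg_four h2 hR hz h0 h1 (S := mv σ S) (by rw [pdeg_mv, hdS])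
    by_contra hne
    have hz0 : z ^ 2 + z + 1 ≠ 0 := by simpa using aeval_ne_zero h0 h1 hp.ne_zero
    obtain ⟨k, hk, hdk⟩ := deg_zeros_aeval hR hz (X ^ 2 + X + 1)
    have := deg_mono (pt_add_pt_le (Ne.symm hne)
      (pt_le_posPart hz0 (zero_of_pdeg_four h2 hR hz h0 h1 hdS)) (pt_le_posPart hz0 hz4))
    rw [map_add, deg_single, deg_single, pdeg_mv, hdS] at this
    simp only [map_add, map_pow, aeval_X, map_one] at hdk
    omega
  have hτ := zero_of_not_dvd hσ hT h5 hfS (by omega)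
  have hzS := zero_of_pdeg_four h2 hR hz h0 h1 hdS
  have hTS := mem_of_zero hτ
  have hzS' := mem_of_zero hzS
  obtain ⟨g, hg, hgL, hgS⟩ : ∃ g, g ≠ 0 ∧ g ∈ L (pt R + (dv T)⁻) ∧ g ∈ fil S 1 := by
    have hzL : z ∈ L (pt R + (dv T)⁻) :=
      L_mono (le_add_of_nonneg_right (negPart_nonneg (dv T))) (hz ▸ mem_L_negPart z)
    have hTL : T ∈ L (pt R + (dv T)⁻) := L_mono (le_add_of_nonneg_left pt_nonneg) (mem_L_negPart T)
    have hne {c : K} (hc : c = z ∨ c = z + 1) : c + T ≠ 0 := fun h => by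
      have h' : (dv T)⁻ = pt R := by
        rw [← CharTwo.add_eq_zero.mp h]
        rcases hc with rfl | rfl
        · exact hz
        · rw [negPart_add_one, hz]
      have := h5.deg_poles
      rw [h', deg_single, hR] at this
      norm_num at this
    have hprod : (z + T) * (z + 1 + T) ∈ fil S 1 := by
      convert add_mem hzS hτ using 1
      linear_combination (z * T - 1) * CharTwo.two_eq_zero (R := K)
    have ha : z + T ∈ S.1 := add_mem hzS' hTS
    have hb : z + 1 + T ∈ S.1 := add_mem (add_mem hzS' S.1.one_mem) hTS
    rw [← resAt_eq_zero_iff (mul_mem ha hb), resAt_mul ha hb, mul_eq_zero, resAt_eq_zero_iff ha,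
      resAt_eq_zero_iff hb] at hprod
    rcases hprod with h | h
    · exact ⟨_, hne (Or.inl rfl), add_mem hzL hTL, h⟩
    · exact ⟨_, hne (Or.inr rfl), add_mem (add_mem hzL
        (one_mem_L (add_nonneg pt_nonneg (negPart_nonneg (dv T))))) hTL, h⟩
  have hE : 0 ≤ pt R + (dv T)⁻ - pt S + dv g := by
    intro P
    have h := mem_L.mp hgL P
    rw [mem_fil_of_ne hg] at h
    rw [mem_fil_of_ne hg] at hgS
    have hn := (add_nonneg (pt_nonneg (P := R)) (negPart_nonneg (dv T)) : (0 : Div K) ≤ pt R + (dv T)⁻) P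
    rw [Finsupp.add_apply, Finsupp.sub_apply, dv_apply]
    change 0 ≤ _
    change 0 ≤ (pt R + (dv T)⁻) P at hn
    by_cases hP : P = S
    · subst hP
      rw [show pt P P = 1 from Finsupp.single_eq_same]
      omega
    · rw [show pt S P = 0 from Finsupp.single_eq_of_ne hP]
      omega
  have := e_pos hE (n := 3) (by
    rw [map_add, map_sub, map_add, deg_dv, deg_single, deg_single, h5.deg_poles, hR, hdS]; norm_num)
  omega

end
end CFF

namespace CFF
open Polynomial IsLocalRing
section
variable {K : Type} [Field K] [Algebra (ZMod 2) K] [FiveGonal K]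
variable {σ : K ≃ₐ[ZMod 2] K} {P Q R S : Place (ZMod 2) K} {T z : K}

theorem add_map_mem_fil_neg_two (hT : σ T = (T + 1)⁻¹) (hT1 : T + 1 ≠ 0) (hP : mv σ P = P)
    (ht : Triv σ P) (hτ : ordAt P.1 (T ^ 2 + T + 1) = 1) {f : K} (hf : f ∈ fil P (-3)) :
    f + σ f ∈ fil P (-2) := by
  have hτ1 : T ^ 2 + T + 1 ∈ fil P 1 := mem_fil_of_le hτ.ge
  have hTP := mem_of_zero hτ1
  have hτ0 : T ^ 2 + T + 1 ≠ 0 := by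
    intro h
    rw [h, ordAt_zero] at hτ
    omega
  have hg : f * (T ^ 2 + T + 1) ^ 3 ∈ P.1 := by
    have := mul_mem_fil hf (pow_mem_fil hτ1 3)
    norm_num at this
    rwa [mem_fil_zero] at this
  have h := mul_mem_fil_one (add_map_mem_fil hP ht hg) (pow_mem (add_mem hTP P.1.one_mem) 6)
  have hτP : T ^ 2 + T + 1 ∈ P.1 := add_mem (add_mem (pow_mem hTP 2) hTP) P.1.one_mem
  have h2 := mul_mem_fil_one hτ1 (mul_mem hg (mul_mem (pow_mem hTP 2) hτP))
  have h3 : (f + σ f) * (T ^ 2 + T + 1) ^ 3 ∈ fil P (3 + -2) := by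
    rw [show (3 + -2 : ℤ) = 1 by norm_num]
    convert add_mem h h2 using 1
    rw [map_mul, map_pow, map_norm hT hT1, add_mul _ (σ f * _),
      show σ f * ((T ^ 2 + T + 1) / (T + 1) ^ 2) ^ 3 * (T + 1) ^ 6 = σ f * (T ^ 2 + T + 1) ^ 3 by
        field_simp]
    have h6 : (T + 1) ^ 6 = 1 + (T ^ 2 + T + 1) ^ 2 * T ^ 2 := by
      linear_combination (3 * T + 7 * T ^ 2 + 9 * T ^ 3 + 6 * T ^ 4 + 2 * T ^ 5) *
         CharTwo.two_eq_zero (R := K)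
    rw [h6]
    linear_combination (-f * (T ^ 2 + T + 1) ^ 5 * T ^ 2) * CharTwo.two_eq_zero (R := K)
  have h4 : ordAt P.1 ((T ^ 2 + T + 1) ^ 3) = 3 := by rw [ordAt_pow, hτ]; norm_num
  rwa [← div_mem_fil_one_iff P (pow_ne_zero 3 hτ0) h4, mul_div_cancel_right₀ _ (pow_ne_zero 3 hτ0)] at h3

theorem false_of_order_three_of_e_two_eq_zero (hσ : σ ^ 3 = 1) (hT : σ T = (T + 1)⁻¹)
    (h5 : HasDeg T 5) (h2 : e K 2 = 0) : False := by
  have h4 : e K 4 = 1 := by have := e_four (K := K); omega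
  have h6 := e_six (K := K)
  have hT1 := h5.add_one_ne_zero
  have hτ0 := h5.norm_ne_zero
  have hpos (S : Place (ZMod 2) K) : 0 < pdeg S := placeDegree_pos S
  have hn1 (S : Place (ZMod 2) K) : pdeg S ≠ 1 := e_zero_of_place (by exact_mod_cast e_one K) S
  have hn2 (S : Place (ZMod 2) K) : pdeg S ≠ 2 := e_zero_of_place (by exact_mod_cast h2) S
  obtain ⟨D, hD, hd⟩ := exists_eff (K := K) (n := 4) (by omega)
  obtain ⟨A, hA, -⟩ := exists_eq_pt hD (n := 4) (by omega) (by exact_mod_cast hd) (by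
    intro m h0 h4
    obtain rfl | rfl | rfl : m = 1 ∨ m = 2 ∨ m = 3 := by omega
    · exact Or.inl (by exact_mod_cast e_one K)
    · exact Or.inl (by exact_mod_cast h2)
    · exact Or.inr (by norm_num; exact e_one K))
  have hfA := mv_eq_of_e_eq_one (n := 4) (by exact_mod_cast h4) hA σ
  have htA := triv_of_not_dvd Nat.prime_three hσ hfA (by omega)
  have hτA := zero_of_triv hT hT1 hfA htA
  have hE : 0 ≤ (dv (T ^ 2 + T + 1))⁺ - pt A := sub_nonneg.mpr (pt_le_norm h5 hτA)
  have hdE : deg ((dv (T ^ 2 + T + 1))⁺ - pt A) = 6 := by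
    rw [map_sub, h5.deg_norm, deg_single, hA]; norm_num
  obtain ⟨B, hBE⟩ := exists_pos_of_ne hE (by rintro h; rw [h, map_zero] at hdE; omega)
  have hτB : T ^ 2 + T + 1 ∈ fil B 1 := by
    have := hBE B
    have hA' : 0 ≤ pt A B := pt_nonneg B
    rw [Finsupp.sub_apply, show pt B B = 1 from Finsupp.single_eq_same, posPart_apply, dv_apply] at this
    exact mem_fil_of_le (by omega)
  obtain ⟨k, hk⟩ := even_pdeg hτB
  have hR : 0 ≤ (dv (T ^ 2 + T + 1))⁺ - pt A - pt B := sub_nonneg.mpr hBE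
  have hdR : deg ((dv (T ^ 2 + T + 1))⁺ - pt A - pt B) = 6 - pdeg B := by
    rw [map_sub, hdE, deg_single, one_mul]
  have hR0 := deg_nonneg hR
  have hB : pdeg B = 6 := by
    have a := hpos B
    have b := hn2 B
    by_contra h
    have h4 : pdeg B = 4 := by omega
    have := e_pos hR (n := 2) (by rw [hdR, h4]; norm_num)
    omega
  have hZ : (dv (T ^ 2 + T + 1))⁺ = pt A + pt B := by
    have := eq_zero_of_deg hR (by rw [hdR, hB]; norm_num)
    rw [sub_sub] at this
    exact sub_eq_zero.mp this
  have hAB : A ≠ B := by rintro rfl; omega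
  have hoA : ordAt A.1 (T ^ 2 + T + 1) = 1 := by
    have := DFunLike.congr_fun hZ A
    rw [posPart_apply, dv_apply, Finsupp.add_apply, show pt A A = 1 from Finsupp.single_eq_same,
      show pt B A = 0 from Finsupp.single_eq_of_ne hAB] at this
    omega
  have hoB : ordAt B.1 (T ^ 2 + T + 1) = 1 := by
    have := DFunLike.congr_fun hZ B
    rw [posPart_apply, dv_apply, Finsupp.add_apply, show pt B B = 1 from Finsupp.single_eq_same,
      show pt A B = 0 from Finsupp.single_eq_of_ne hAB.symm] at this
    omega
  have hfB : mv σ B = B := by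
    by_contra hne
    have h := pt_le_norm h5 (mv_zero hT hT1 hτB) (mv σ B)
    have hA' : mv σ B ≠ A := fun h => by
      have := pdeg_mv σ B
      rw [h] at this
      omega
    rw [hZ, Finsupp.add_apply, show pt (mv σ B) (mv σ B) = 1 from Finsupp.single_eq_same,
      show pt A (mv σ B) = 0 from Finsupp.single_eq_of_ne hA',
      show pt B (mv σ B) = 0 from Finsupp.single_eq_of_ne hne] at h
    omega
  have hfix (n : ℤ) : Fixed σ (Finsupp.single A n - Finsupp.single B 1) := fun P => by
    rw [Finsupp.sub_apply, Finsupp.sub_apply, fixed_single hfA, fixed_single hfB]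
  have hinv : L (Finsupp.single A 3 - Finsupp.single B ((1 : ℕ) : ℤ)) ≤ Inv σ := by
    intro f hf
    rw [Nat.cast_one] at hf
    have hσf := map_mem_L (hfix 3) hf
    rw [mem_Inv, eq_comm, ← CharTwo.add_eq_zero]
    by_contra h0
    have hfA3 : f ∈ fil A (-3) := by
      have := mem_L.mp hf A
      rwa [Finsupp.sub_apply, Finsupp.single_eq_same, Finsupp.single_eq_of_ne hAB, sub_zero] at this
    have h1 := add_map_mem_fil_neg_two hT hT1 hfA htA hoA hfA3
    have h2' : f + σ f ∈ L (Finsupp.single A 2 - Finsupp.single B 1) := by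
      have hs := add_mem hf hσf
      refine mem_L.mpr fun P => ?_
      by_cases hP : P = A
      · subst hP
        rwa [Finsupp.sub_apply, Finsupp.single_eq_same, Finsupp.single_eq_of_ne hAB, sub_zero]
      · have := mem_L.mp hs P
        rw [Finsupp.sub_apply, Finsupp.single_eq_of_ne hP] at this ⊢
        exact this
    have := e_pos ((mem_L_of_ne h0).mp h2') (n := 2) (by
      rw [map_add, deg_dv, map_sub, deg_single, deg_single, hA, hB]; norm_num)
    omega
  have hc3 := card_L_eq (K := K) (D := Finsupp.single A 3 - Finsupp.single B ((1 : ℕ) : ℤ)) (n := 6) (by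
    rw [map_sub, deg_single, deg_single, hA, hB]; norm_num)
  have hc0 := card_L_eq (K := K) (D := Finsupp.single A 3 - Finsupp.single B ((2 : ℕ) : ℤ)) (n := 0) (by
    rw [map_sub, deg_single, deg_single, hA, hB]; norm_num)
  have he0 := e_zero (K := K)
  rw [h6] at hc3
  rw [he0] at hc0
  have hfin : Finite (L (Finsupp.single A 3 - Finsupp.single B ((2 : ℕ) : ℤ))) := finite_L _
  by_cases ht : Triv σ B
  · have hle : L (Finsupp.single A 3 - Finsupp.single B ((1 : ℕ) : ℤ)) ≤
        L (Finsupp.single A 3 - Finsupp.single B ((2 : ℕ) : ℤ)) := by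
      intro f hf
      by_cases h0 : f = 0
      · rw [h0]; exact zero_mem _
      refine mem_L.mpr fun P => ?_
      have hfP := mem_L.mp hf P
      by_cases hP : P = B
      · subst hP
        rw [Finsupp.sub_apply, Finsupp.single_eq_same, Finsupp.single_eq_of_ne hAB.symm,
          mem_fil_of_ne h0] at hfP ⊢
        by_contra h
        exact false_of_invariant hT hT1 hfB ht hτB hτ0 h0 (hinv hf) (by push_cast at *; omega)
      · rw [Finsupp.sub_apply, Finsupp.single_eq_of_ne hP] at hfP ⊢
        exact hfP
    have := AddSubgroup.card_le_of_le hle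
    omega
  · have h := card_L_Inv_step (σ := σ) (Finsupp.single A 3) B 1
    rw [inf_of_le_left hinv, hc3, card_Efix Nat.prime_three hσ hfB ht (n := 2) (by omega)] at h
    have := AddSubgroup.card_le_of_le (inf_le_left :
      L (Finsupp.single A 3 - Finsupp.single B ((2 : ℕ) : ℤ)) ⊓ Inv σ ≤ _)
    norm_num at h
    norm_num at hc0 this
    omega

/-- A Möbius involution of order three on the rational subfield does not lift to order three. -/
theorem false_of_order_three (hσ : σ ^ 3 = 1) (hT : σ T = (T + 1)⁻¹) (h5 : HasDeg T 5) : False := by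
  have := e_two_le (K := K)
  obtain h | h | h : e K 2 = 0 ∨ e K 2 = 1 ∨ e K 2 = 2 := by omega
  · exact false_of_order_three_of_e_two_eq_zero hσ hT h5 h
  · exact false_of_order_three_of_e_two_eq_one hσ hT h5 h
  · exact false_of_order_three_of_e_two_eq_two hσ hT h5 h

end
end CFF

namespace CFF
open Polynomial IsLocalRing
section
variable {K : Type} [Field K] [Algebra (ZMod 2) K]
variable {σ : K ≃ₐ[ZMod 2] K} {T : K}

theorem PolyIndep.map {m : ℕ} {b : Fin m → K} (hb : PolyIndep T b) (σ : K ≃ₐ[ZMod 2] K) :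
    PolyIndep (σ T) (σ ∘ b) := fun p hp => hb p (σ.injective (by
  rw [map_zero, ← hp, map_sum]
  exact Finset.sum_congr rfl fun i _ => by rw [map_mul, Function.comp, aeval_algHom_apply]))

theorem HasDeg.map {n : ℕ} (h : HasDeg T n) (σ : K ≃ₐ[ZMod 2] K) : HasDeg (σ T) n where
  trans := fun h' => h.trans (by simpa using h'.algHom σ.symm.toAlgHom)
  le := fun m b hb => h.le m (σ.symm ∘ b) (by simpa using hb.map σ.symm)
  ex := h.ex.imp' (σ ∘ ·) fun _ hu => hu.map σ

variable [FiveGonal K]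

theorem HasDeg.map_cases (h : HasDeg T 5) (σ : K ≃ₐ[ZMod 2] K) :
    σ T = T ∨ σ T = T + 1 ∨ σ T = T⁻¹ ∨ σ T = T⁻¹ + 1 ∨ σ T = (T + 1)⁻¹ ∨ σ T = (T + 1)⁻¹ + 1 := by
  have hσ := h.map σ
  obtain ⟨h0, h1⟩ := hσ.ne (by norm_num)
  have hL := mem_L_negPart (σ T)
  rcases eff_five h (negPart_nonneg (dv (σ T))) hσ.deg_poles with hE | hE | hE
  · rw [hE, mem_L_poles h] at hL
    tauto
  · rw [hE, ← negPart_inv, mem_L_poles h.inv] at hL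
    tauto
  · rw [hE, ← negPart_inv, mem_L_poles (h.add_one (by norm_num)).inv] at hL
    tauto

theorem false_of_map_eq_add_one (hT : σ T = T + 1) (h5 : HasDeg T 5)
    (h : ∀ ρ : K ≃ₐ[ZMod 2] K, ρ T = T → ρ ^ 5 = 1) : False := by
  have h2 : (σ ^ 2) T = T := by
    rw [pow_two, AlgEquiv.mul_apply, hT, map_add, hT, map_one, add_assoc, CharTwo.add_self_eq_zero,
      add_zero]
  refine false_of_involution (σ := σ ^ 5) (T := T) ?_ ?_ h5
  · rw [← pow_mul, mul_comm, pow_mul, h _ h2]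
  · rw [show σ ^ 5 = σ * (σ ^ 2 * σ ^ 2) by group, AlgEquiv.mul_apply, AlgEquiv.mul_apply, h2, h2, hT]

theorem false_of_map_eq_inv_add_one (hT : σ T = (T + 1)⁻¹) (h5 : HasDeg T 5)
    (h : ∀ ρ : K ≃ₐ[ZMod 2] K, ρ T = T → ρ ^ 5 = 1) : False := by
  have h0 := (h5.ne (by norm_num)).1
  have h1 := h5.add_one_ne_zero
  have h3 : (σ ^ 3) T = T := by
    rw [pow_succ, pow_two, AlgEquiv.mul_apply, AlgEquiv.mul_apply, hT, map_inv₀, map_add, map_one,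
      hT, map_inv₀, map_add, map_one, map_inv₀, map_add, map_one, hT,
      show (T + 1)⁻¹ + 1 = T * (T + 1)⁻¹ by
        field_simp; linear_combination CharTwo.two_eq_zero (R := K)]
    field_simp
    rw [show T + 1 + T = 1 by linear_combination T * CharTwo.two_eq_zero (R := K), div_one]
  refine false_of_order_three (σ := σ ^ 10) (T := T) ?_ ?_ h5
  · rw [← pow_mul, show 10 * 3 = 3 * 5 * 2 by norm_num, pow_mul, pow_mul, h _ h3, one_pow]
  · rw [show σ ^ 10 = σ * (σ ^ 3 * (σ ^ 3 * σ ^ 3)) by group, AlgEquiv.mul_apply,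
      AlgEquiv.mul_apply, AlgEquiv.mul_apply, h3, h3, h3, hT]

/-- Every automorphism fixes the function of degree five. -/
theorem map_eq_self (h5 : HasDeg T 5) (h : ∀ ρ : K ≃ₐ[ZMod 2] K, ρ T = T → ρ ^ 5 = 1)
    (σ : K ≃ₐ[ZMod 2] K) : σ T = T := by
  have h0 := (h5.ne (by norm_num)).1
  have h1 := h5.add_one_ne_zero
  have hinv (ρ : K ≃ₐ[ZMod 2] K) (hρ : ρ T⁻¹ = T⁻¹) : ρ ^ 5 = 1 :=
    h ρ (inv_injective (by rw [← map_inv₀, hρ]))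
  have hinv' (ρ : K ≃ₐ[ZMod 2] K) (hρ : ρ (T + 1)⁻¹ = (T + 1)⁻¹) : ρ ^ 5 = 1 :=
    h ρ (add_right_cancel (b := 1) (inv_injective (by rw [← hρ, map_inv₀, map_add, map_one])))
  rcases h5.map_cases σ with hσ | hσ | hσ | hσ | hσ | hσ
  · exact hσ
  · exact (false_of_map_eq_add_one hσ h5 h).elim
  · refine (false_of_map_eq_add_one (σ := σ) (T := (T + 1)⁻¹) ?_ (h5.add_one (by norm_num)).inv hinv').elim
    rw [map_inv₀, map_add, map_one, hσ, show T⁻¹ + 1 = (T + 1) / T by field_simp; ring, inv_div]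
    field_simp
    linear_combination -CharTwo.two_eq_zero (R := K)
  · refine (false_of_map_eq_inv_add_one (σ := σ) (T := T⁻¹) ?_ h5.inv hinv).elim
    rw [map_inv₀, hσ]
  · exact (false_of_map_eq_inv_add_one hσ h5 h).elim
  · refine (false_of_map_eq_add_one (σ := σ) (T := T⁻¹) ?_ h5.inv hinv).elim
    rw [map_inv₀, hσ, show (T + 1)⁻¹ + 1 = T / (T + 1) by
      field_simp; linear_combination CharTwo.two_eq_zero (R := K), inv_div]
    field_simp
    ring
end

section
variable {F E : Type*} [Field F] [Field E] [Algebra F E]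

theorem card_aut_dvd_finrank [FiniteDimensional F E] :
    Nat.card (E ≃ₐ[F] E) ∣ Module.finrank F E := by
  rw [← Subgroup.card_top (G := E ≃ₐ[F] E), ← IntermediateField.finrank_fixedField_eq_card]
  exact ⟨_, ((Module.finrank_mul_finrank F _ E).symm.trans (mul_comm _ _))⟩

theorem isSeparable_of_finrank_coprime (p : ℕ) [CharP F p] [FiniteDimensional F E]
    (hp : p.Prime) (h : ¬ p ∣ Module.finrank F E) : Algebra.IsSeparable F E := by
  refine ⟨fun x => ?_⟩
  have : Fact p.Prime := ⟨hp⟩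
  have hx : IsIntegral F x := IsIntegral.of_finite F x
  refine (separable_or p (minpoly.irreducible hx)).resolve_right ?_
  rintro ⟨-, g, -, hg⟩
  have hd := minpoly.degree_dvd hx
  rw [← hg, natDegree_expand] at hd
  exact h ((Dvd.intro_left _ rfl).trans hd)
end

section
variable {K : Type} [Field K] [Algebra (ZMod 2) K]
  [Algebra (RatFunc (ZMod 2)) K] [IsScalarTower (ZMod 2) (RatFunc (ZMod 2)) K]

/-- An automorphism fixing the generator of a rational subfield fixes that subfield. -/
def extendScalars (σ : K ≃ₐ[ZMod 2] K) (h : σ (algebraMap (RatFunc (ZMod 2)) K RatFunc.X) =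
    algebraMap (RatFunc (ZMod 2)) K RatFunc.X) : K ≃ₐ[RatFunc (ZMod 2)] K :=
  AlgEquiv.ofRingEquiv (f := σ.toRingEquiv) fun r => by
    have : (σ : K →+* K).comp (algebraMap (RatFunc (ZMod 2)) K) = algebraMap (RatFunc (ZMod 2)) K := by
      refine IsLocalization.ringHom_ext (nonZeroDivisors (ZMod 2)[X]) (Polynomial.ringHom_ext' ?_ ?_)
      · exact RingHom.ext_zmod _ _
      · simpa [RatFunc.algebraMap_X] using h
    exact RingHom.congr_fun this r
end
end CFF

open CFF in
/-- For a congruence function field `K` over `𝔽₂` of genus `4` and class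
number `1`, with (its unique) rational subfield `k = 𝔽₂(T)` of degree `5`
(modelled by an embedding of `RatFunc (ZMod 2)` with `[K:k] = 5`):
the order of `Aut_{𝔽₂}(K)` divides `30`, and `K/k` is normal if and only if
`Aut_{𝔽₂}(K)` is nontrivial. -/
theorem aut_divides_thirty_and_normal_iff_nontrivial_aut
    (K : Type) [Field K] [Algebra (ZMod 2) K]
    [Algebra (RatFunc (ZMod 2)) K] [IsScalarTower (ZMod 2) (RatFunc (ZMod 2)) K]
    (hFF : IsFunctionField (ZMod 2) K)
    (hconst : HasExactConstants (ZMod 2) K)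
    (hg : genus (ZMod 2) K = 4)
    (hh : classNumber (ZMod 2) K = 1)
    (hdeg : Module.finrank (RatFunc (ZMod 2)) K = 5) :
    Nat.card (K ≃ₐ[ZMod 2] K) ∣ 30 ∧
      (Normal (RatFunc (ZMod 2)) K ↔ Nontrivial (K ≃ₐ[ZMod 2] K)) := by
  have hT := hasDeg_X hFF
  rw [hdeg] at hT
  have : FiveGonal K :=
    { ff := hFF, const := hconst, genus_eq := hg, classNumber_eq := hh, exists_five := ⟨_, hT⟩ }
  have hfin : FiniteDimensional (RatFunc (ZMod 2)) K :=
    Module.finite_of_finrank_pos (by rw [hdeg]; norm_num)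
  have hdvd : Nat.card (K ≃ₐ[RatFunc (ZMod 2)] K) ∣ 5 := hdeg ▸ card_aut_dvd_finrank
  have h5 (ρ : K ≃ₐ[ZMod 2] K) (hρ : ρ (algebraMap (RatFunc (ZMod 2)) K RatFunc.X) =
      algebraMap (RatFunc (ZMod 2)) K RatFunc.X) : ρ ^ 5 = 1 := by
    have h := orderOf_dvd_iff_pow_eq_one.mp ((orderOf_dvd_natCard (extendScalars ρ hρ)).trans hdvd)
    exact AlgEquiv.ext fun x => AlgEquiv.congr_fun h x
  have hX := map_eq_self hT h5
  have e : (K ≃ₐ[ZMod 2] K) ≃ (K ≃ₐ[RatFunc (ZMod 2)] K) :=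
    { toFun := fun σ => extendScalars σ (hX σ)
      invFun := fun σ => σ.restrictScalars (ZMod 2)
      left_inv := fun σ => rfl
      right_inv := fun σ => rfl }
  have : CharP (RatFunc (ZMod 2)) 2 :=
    charP_of_injective_algebraMap (algebraMap (ZMod 2) (RatFunc (ZMod 2))).injective 2
  have := isSeparable_of_finrank_coprime (F := RatFunc (ZMod 2)) (E := K) 2 Nat.prime_two
    (by rw [hdeg]; norm_num)
  rw [Nat.card_congr e]
  refine ⟨hdvd.trans (by norm_num), ?_⟩
  rw [e.nontrivial_congr, ← Finite.one_lt_card_iff_nontrivial]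
  constructor
  · intro hn
    have : IsGalois (RatFunc (ZMod 2)) K := ⟨⟩
    rw [IsGalois.card_aut_eq_finrank, hdeg]
    norm_num
  · intro h
    have hc := ((Nat.dvd_prime (by norm_num)).mp hdvd).resolve_left h.ne'
    have := IsGalois.of_card_aut_eq_finrank (RatFunc (ZMod 2)) K (hc.trans hdeg.symm)
    exact IsGalois.to_normal
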